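/- Let N ≥ 1 be an integer, p > 1, s ∈ (0,1) with sp > p-1, and let K be a kernel with constants λ, Λ. Let u : ℝ^N × ℝ → ℝ be a continuous local weak solution of ∂_t u + L_K u = 0 in B_2 × (-2, 0] satisfying sup_{B_2 × (-2,0]} |u| + Tail_∞(u; 0, 2, (-2, 0]) ≤ 1. Then there exists a constant C > 0, depending only on N, s, p, λ, Λ, such that sup_{t ∈ (-1,0]} [u(·,t)]_{C^{0,1}(B_1)} ≤ C. -/

import Mathlib

open MeasureTheory Set Metric Filter
open scoped ENNReal NNReal Topology Classical

noncomputable section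

abbrev Euc (N : ℕ) := EuclideanSpace ℝ (Fin N)

/-- `J_p(t) = |t|^{p-2} t`. -/
def Jp (p t : ℝ) : ℝ := |t| ^ (p - 2) * t

/-- A symmetric kernel comparable to the fractional `p`-Laplace kernel. -/
def IsKernel (N : ℕ) (p s lam Lam : ℝ) (K : Euc N → ℝ) : Prop :=
  Measurable K ∧
  (∀ z : Euc N, z ≠ 0 → 0 < K z) ∧
  (∀ z : Euc N, z ≠ 0 → K (-z) = K z) ∧
  (∀ z : Euc N, z ≠ 0 →
    lam * ‖z‖ ^ (-((N : ℝ) + s * p)) ≤ K z ∧ K z ≤ Lam * ‖z‖ ^ (-((N : ℝ) + s * p)))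

/-- Local weak solution of `∂ₜ u + L_K u = 0` in `Ω × I`. -/
def IsLocalWeakSolution (N : ℕ) (p s : ℝ) (K : Euc N → ℝ)
    (Ω : Set (Euc N)) (I : Set ℝ) (u : Euc N → ℝ → ℝ) : Prop :=
  (∀ J : Set ℝ, IsCompact J → J ⊆ interior I →
    ∀ U : Set (Euc N), IsOpen U → IsCompact (closure U) → closure U ⊆ Ω →
      (∫⁻ t in J, ∫⁻ x in U, ∫⁻ y in U,
          ENNReal.ofReal (|u x t - u y t| ^ p * ‖x - y‖ ^ (-((N : ℝ) + s * p)))) < ⊤ ∧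
      (∫⁻ t in J, ∫⁻ x in U, ENNReal.ofReal (|u x t| ^ p)) < ⊤ ∧
      essSup (fun t => ∫⁻ x, ENNReal.ofReal (|u x t| ^ (p - 1) / (1 + ‖x‖ ^ ((N : ℝ) + s * p))))
        (volume.restrict J) < ⊤ ∧
      (∀ t₀ ∈ I, Tendsto (fun t => ∫ x in U, (u x t - u x t₀) ^ 2)
          (nhdsWithin t₀ I) (nhds 0))) ∧
  (∀ φ : Euc N × ℝ → ℝ, ContDiff ℝ (⊤ : ℕ∞) φ → HasCompactSupport φ →
    tsupport φ ⊆ Ω ×ˢ interior I →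
    -(∫ t in I, ∫ x in Ω, u x t * deriv (fun τ => φ (x, τ)) t) +
      (1 / 2) * ∫ t in I, ∫ x, ∫ y,
        Jp p (u x t - u y t) * (φ (x, t) - φ (y, t)) * K (x - y) = 0)

/-- Essential supremum of `|u|` over a space-time set. -/
def supAbs (N : ℕ) (u : Euc N → ℝ → ℝ) (Q : Set (Euc N × ℝ)) : ℝ≥0∞ :=
  essSup (fun q : Euc N × ℝ => ENNReal.ofReal |u q.1 q.2|) (volume.restrict Q)

/-- The nonlocal tail `Tail(w; x₀, r)`. -/
def tailFn (N : ℕ) (p s : ℝ) (w : Euc N → ℝ) (x₀ : Euc N) (r : ℝ) : ℝ :=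
  (r ^ (s * p) *
    ∫ x in (ball x₀ r)ᶜ, |w x| ^ (p - 1) * ‖x - x₀‖ ^ (-((N : ℝ) + s * p))) ^ (1 / (p - 1))

/-- The parabolic tail `Tail_∞(u; x₀, r, J)`. -/
def tailSup (N : ℕ) (p s : ℝ) (u : Euc N → ℝ → ℝ) (x₀ : Euc N) (r : ℝ) (J : Set ℝ) : ℝ≥0∞ :=
  essSup (fun t => ENNReal.ofReal (tailFn N p s (fun x => u x t) x₀ r)) (volume.restrict J)

/-- `M_R = ‖u‖_{L^∞(Q_{2R,2R^{sp}}(x₀,t₀))} + Tail_∞(u; x₀, R, (t₀-2R^{sp},t₀]) + 1`. -/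
def MR (N : ℕ) (p s : ℝ) (u : Euc N → ℝ → ℝ) (x₀ : Euc N) (R t₀ : ℝ) : ℝ≥0∞ :=
  supAbs N u (ball x₀ (2 * R) ×ˢ Ioc (t₀ - 2 * R ^ (s * p)) t₀)
    + tailSup N p s u x₀ R (Ioc (t₀ - 2 * R ^ (s * p)) t₀) + 1

/-- `φ ∈ C²ₓ ∩ C¹ₜ(U × I)` with derivative data `Dφ, D2φ, φt`. -/
def C2xC1t (N : ℕ) (U : Set (Euc N)) (I : Set ℝ) (φ : Euc N → ℝ → ℝ)
    (Dφ : Euc N → ℝ → (Euc N →L[ℝ] ℝ)) (D2φ : Euc N → ℝ → (Euc N →L[ℝ] Euc N →L[ℝ] ℝ))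
    (φt : Euc N → ℝ → ℝ) : Prop :=
  ContinuousOn (fun q : Euc N × ℝ => φ q.1 q.2) (U ×ˢ I) ∧
  (∀ x ∈ U, ∀ t ∈ I, HasFDerivAt (fun y => φ y t) (Dφ x t) x) ∧
  ContinuousOn (fun q : Euc N × ℝ => Dφ q.1 q.2) (U ×ˢ I) ∧
  (∀ x ∈ U, ∀ t ∈ I, HasFDerivAt (fun y => Dφ y t) (D2φ x t) x) ∧
  ContinuousOn (fun q : Euc N × ℝ => D2φ q.1 q.2) (U ×ˢ I) ∧
  (∀ x ∈ U, ∀ t ∈ I, HasDerivWithinAt (fun τ => φ x τ) (φt x t) I t) ∧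
  ContinuousOn (fun q : Euc N × ℝ => φt q.1 q.2) (U ×ˢ I)

/-- The truncated integral over the annulus `δ < |x - y| < ρ`. -/
def pvIntegral (N : ℕ) (p ρ : ℝ) (K : Euc N → ℝ) (w : Euc N → ℝ) (x : Euc N) (δ : ℝ) : ℝ :=
  ∫ y in {y : Euc N | δ < dist y x ∧ dist y x < ρ}, Jp p (w x - w y) * K (x - y)

/-- Existence of the principal value `L_K^{B_ρ} w (x) = l`. -/
def HasPV (N : ℕ) (p ρ : ℝ) (K : Euc N → ℝ) (w : Euc N → ℝ) (x : Euc N) (l : ℝ) : Prop :=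
  Tendsto (fun δ => pvIntegral N p ρ K w x δ) (nhdsWithin 0 (Ioi 0)) (nhds l)

/-- Weak supersolution of `∂ₜ w + L_K^{B_ρ} w = f` in `U × I`. -/
def IsTruncSuper (N : ℕ) (p ρ : ℝ) (K : Euc N → ℝ) (U : Set (Euc N)) (I : Set ℝ)
    (f w : Euc N → ℝ → ℝ) : Prop :=
  ∀ φ : Euc N × ℝ → ℝ, ContDiff ℝ (⊤ : ℕ∞) φ → HasCompactSupport φ →
    tsupport φ ⊆ U ×ˢ interior I → (∀ q, 0 ≤ φ q) →
    ∫ t in I, ∫ x in U, f x t * φ (x, t) ≤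
      -(∫ t in I, ∫ x in U, w x t * deriv (fun τ => φ (x, τ)) t) +
        (1 / 2) * ∫ t in I, ∫ q in {q : Euc N × Euc N | dist q.1 q.2 < ρ},
          Jp p (w q.1 t - w q.2 t) * (φ (q.1, t) - φ (q.2, t)) * K (q.1 - q.2)

/-- Weak subsolution of `∂ₜ w + L_K^{B_ρ} w = f` in `U × I`. -/
def IsTruncSub (N : ℕ) (p ρ : ℝ) (K : Euc N → ℝ) (U : Set (Euc N)) (I : Set ℝ)
    (f w : Euc N → ℝ → ℝ) : Prop :=
  ∀ φ : Euc N × ℝ → ℝ, ContDiff ℝ (⊤ : ℕ∞) φ → HasCompactSupport φ →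
    tsupport φ ⊆ U ×ˢ interior I → (∀ q, 0 ≤ φ q) →
    -(∫ t in I, ∫ x in U, w x t * deriv (fun τ => φ (x, τ)) t) +
        (1 / 2) * ∫ t in I, ∫ q in {q : Euc N × Euc N | dist q.1 q.2 < ρ},
          Jp p (w q.1 t - w q.2 t) * (φ (q.1, t) - φ (q.2, t)) * K (q.1 - q.2) ≤
      ∫ t in I, ∫ x in U, f x t * φ (x, t)


/-! ### Elementary facts about `Jp` -/

lemma Jp_zero (p : ℝ) : Jp p 0 = 0 := by simp [Jp]

lemma Jp_neg (p t : ℝ) : Jp p (-t) = -Jp p t := by simp [Jp]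

lemma Jp_of_nonneg {p t : ℝ} (hp : 1 < p) (ht : 0 ≤ t) : Jp p t = t ^ (p - 1) := by
  rcases ht.eq_or_lt with h | h
  · subst h; rw [Jp_zero, Real.zero_rpow (by linarith)]
  · unfold Jp
    rw [abs_of_pos h, show p - 1 = (p - 2) + 1 by ring, Real.rpow_add_one h.ne']

lemma Jp_eq {p : ℝ} (hp : 1 < p) (t : ℝ) :
    Jp p t = (max t 0) ^ (p - 1) - (max (-t) 0) ^ (p - 1) := by
  have h0 : (0 : ℝ) ^ (p - 1) = 0 := Real.zero_rpow (by linarith)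
  rcases le_total 0 t with h | h
  · rw [max_eq_left h, max_eq_right (by linarith), h0, Jp_of_nonneg hp h, sub_zero]
  · rw [max_eq_right h, max_eq_left (by linarith), h0, zero_sub, ← Jp_of_nonneg hp (by linarith),
      Jp_neg, neg_neg]

lemma Jp_continuous {p : ℝ} (hp : 1 < p) : Continuous (Jp p) := by
  have : Jp p = fun t => (max t 0) ^ (p - 1) - (max (-t) 0) ^ (p - 1) := by
    ext t; exact Jp_eq hp t
  rw [this]
  have h : (0:ℝ) ≤ p - 1 := by linarith
  exact ((continuous_id.max continuous_const).rpow_const (fun _ => Or.inr h)).sub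
    ((continuous_neg.max continuous_const).rpow_const (fun _ => Or.inr h))

lemma Jp_mono {p : ℝ} (hp : 1 < p) : Monotone (Jp p) := by
  intro a b hab
  rw [Jp_eq hp, Jp_eq hp]
  have h : (0:ℝ) ≤ p - 1 := by linarith
  have h1 : (max a 0) ^ (p - 1) ≤ (max b 0) ^ (p - 1) :=
    Real.rpow_le_rpow (le_max_right _ _) (max_le_max hab le_rfl) h
  have h2 : (max (-b) 0) ^ (p - 1) ≤ (max (-a) 0) ^ (p - 1) :=
    Real.rpow_le_rpow (le_max_right _ _) (max_le_max (by linarith) le_rfl) h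
  linarith

lemma Jp_abs {p : ℝ} (hp : 1 < p) (t : ℝ) : |Jp p t| = |t| ^ (p - 1) := by
  rcases le_total 0 t with h | h
  · rw [Jp_of_nonneg hp h, abs_of_nonneg h, abs_of_nonneg (Real.rpow_nonneg h _)]
  · have h' : 0 ≤ -t := by linarith
    rw [← abs_neg, ← Jp_neg, Jp_of_nonneg hp h', abs_of_nonneg (Real.rpow_nonneg h' _),
      abs_of_nonpos h]

lemma Jp_nonneg_mul {p : ℝ} (hp : 1 < p) {a b : ℝ} :
    0 ≤ (a - b) * (Jp p a - Jp p b) := by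
  rcases le_total a b with h | h
  · have := Jp_mono hp h
    nlinarith
  · have := Jp_mono hp h
    nlinarith

lemma Jp_abs_sub_le {p : ℝ} (hp : 1 < p) (a b : ℝ) :
    |Jp p (a - b)| ≤ 2 ^ (p - 1) * (|a| ^ (p - 1) + |b| ^ (p - 1)) := by
  rw [Jp_abs hp]
  have h : (0:ℝ) ≤ p - 1 := by linarith
  have h1 : |a - b| ≤ 2 * max |a| |b| := by
    have := abs_sub a b
    have := le_max_left |a| |b|
    have := le_max_right |a| |b|
    linarith
  have h2 : |a - b| ^ (p - 1) ≤ (2 * max |a| |b|) ^ (p - 1) :=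
    Real.rpow_le_rpow (abs_nonneg _) h1 h
  rw [Real.mul_rpow (by norm_num) (le_max_of_le_left (abs_nonneg _))] at h2
  refine h2.trans (mul_le_mul_of_nonneg_left ?_ (by positivity))
  have ha : 0 ≤ |a| ^ (p - 1) := by positivity
  have hb : 0 ≤ |b| ^ (p - 1) := by positivity
  rcases max_choice |a| |b| with h | h <;> rw [h] <;> linarith

/-- Difference of powers, exponent at least one. -/
lemma rpow_sub_le_of_one_le {r a b S : ℝ} (hr : 1 ≤ r) (hb : 0 ≤ b) (hab : b ≤ a) (haS : a ≤ S) :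
    a ^ r - b ^ r ≤ r * S ^ (r - 1) * (a - b) := by
  rcases (hb.trans hab).eq_or_lt with h | h
  · have : b = 0 := by linarith
    subst this; rw [← h]; simp
  have hx : -1 ≤ b / a - 1 := by
    have : 0 ≤ b / a := by positivity
    linarith
  have hB := one_add_mul_self_le_rpow_one_add hx hr
  have e1 : 1 + (b / a - 1) = b / a := by ring
  rw [e1, Real.div_rpow hb h.le, le_div_iff₀ (by positivity)] at hB
  have e2 : a ^ r = a ^ (r - 1) * a := by
    rw [← Real.rpow_add_one h.ne']; ring_nf
  have h3 : a ^ r - b ^ r ≤ r * a ^ (r - 1) * (a - b) := by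
    have : (1 + r * (b / a - 1)) * a ^ r = a ^ r - r * a ^ (r - 1) * (a - b) := by
      rw [e2]; field_simp; ring
    linarith
  refine h3.trans ?_
  have : a ^ (r - 1) ≤ S ^ (r - 1) := Real.rpow_le_rpow h.le haS (by linarith)
  have h4 : 0 ≤ a - b := by linarith
  gcongr

/-- Difference of powers, exponent at most one. -/
lemma rpow_sub_le_of_le_one {r a b : ℝ} (hr0 : 0 ≤ r) (hr : r ≤ 1) (hb : 0 ≤ b) (hab : b ≤ a) :
    a ^ r - b ^ r ≤ (a - b) ^ r := by
  have := Real.rpow_add_le_add_rpow hb (sub_nonneg.2 hab) hr0 hr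
  have e : b + (a - b) = a := by ring
  rw [e] at this
  linarith

/-- Local Hölder continuity of `Jp`. -/
lemma Jp_sub_le {p : ℝ} (hp : 1 < p) {a b S : ℝ} (hba : b ≤ a)
    (ha : |a| ≤ S) (hb : |b| ≤ S) :
    Jp p a - Jp p b ≤ 2 * p * ((a - b) ^ (min 1 (p - 1)) * S ^ (p - 1 - min 1 (p - 1))) := by
  rw [Jp_eq hp, Jp_eq hp]
  have hab0 : 0 ≤ a - b := by linarith
  have hS : 0 ≤ S := (abs_nonneg a).trans ha
  obtain ⟨ha1, ha2⟩ := abs_le.1 ha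
  obtain ⟨hb1, hb2⟩ := abs_le.1 hb
  have m1 : max a 0 - max b 0 ≤ a - b := by
    rcases le_total a 0 with h | h <;> rcases le_total b 0 with h' | h' <;>
      simp only [max_eq_left, max_eq_right, h, h'] <;> linarith
  have m2 : max (-b) 0 - max (-a) 0 ≤ a - b := by
    rcases le_total (-a) 0 with h | h <;> rcases le_total (-b) 0 with h' | h' <;>
      simp only [max_eq_left, max_eq_right, h, h'] <;> linarith
  have n1 : max b 0 ≤ max a 0 := max_le_max hba le_rfl
  have n2 : max (-a) 0 ≤ max (-b) 0 := max_le_max (by linarith) le_rfl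
  rcases le_total p 2 with hp2 | hp2
  · rw [min_eq_right (by linarith), sub_self, Real.rpow_zero, mul_one]
    have h1 := rpow_sub_le_of_le_one (r := p - 1) (by linarith) (by linarith) (le_max_right b 0) n1
    have h2 := rpow_sub_le_of_le_one (r := p - 1) (by linarith) (by linarith)
      (le_max_right (-a) 0) n2
    have h3 : (max a 0 - max b 0) ^ (p - 1) ≤ (a - b) ^ (p - 1) :=
      Real.rpow_le_rpow (by linarith) m1 (by linarith)
    have h4 : (max (-b) 0 - max (-a) 0) ^ (p - 1) ≤ (a - b) ^ (p - 1) :=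
      Real.rpow_le_rpow (by linarith) m2 (by linarith)
    have h5 : 0 ≤ (a - b) ^ (p - 1) := by positivity
    nlinarith
  · rw [min_eq_left (by linarith), Real.rpow_one]
    have h1 := rpow_sub_le_of_one_le (r := p - 1) (S := S) (by linarith) (le_max_right b 0) n1
      (max_le ha2 hS)
    have h2 := rpow_sub_le_of_one_le (r := p - 1) (S := S) (by linarith) (le_max_right (-a) 0) n2
      (max_le (by linarith) hS)
    have hS' : 0 ≤ (p - 1) * S ^ (p - 1 - 1) := mul_nonneg (by linarith) (by positivity)
    have h3 := mul_le_mul_of_nonneg_left m1 hS'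
    have h4 := mul_le_mul_of_nonneg_left m2 hS'
    have h5 : (p - 1) * S ^ (p - 1 - 1) * (a - b) ≤ p * S ^ (p - 1 - 1) * (a - b) := by
      gcongr; linarith
    nlinarith

/-- The comparison used in the outer region. -/
lemma Jp_outer {p : ℝ} (hp : 1 < p) {S χ dx dy : ℝ} (hS : 0 < S) (hχ : 0 ≤ χ)
    (h1 : dy - χ * S ≤ dx) (h2 : -S ≤ dx) (h3 : dy ≤ S) :
    -(2 * p * (χ ^ (min 1 (p - 1)) * S ^ (p - 1))) ≤ Jp p dx - Jp p dy := by
  rcases le_total dy dx with h | h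
  · have := Jp_mono hp h
    have h' : 0 ≤ 2 * p * (χ ^ (min 1 (p - 1)) * S ^ (p - 1)) := by positivity
    linarith
  · have := Jp_sub_le hp h (S := S) (abs_le.2 ⟨by linarith, by linarith⟩)
      (abs_le.2 ⟨by linarith, by linarith⟩)
    have hq : 0 ≤ min 1 (p - 1) := le_min (by norm_num) (by linarith)
    have h4 : (dy - dx) ^ (min 1 (p - 1)) ≤ (χ * S) ^ (min 1 (p - 1)) :=
      Real.rpow_le_rpow (by linarith) (by linarith) hq
    rw [Real.mul_rpow hχ hS.le] at h4
    have h5 : S ^ (min 1 (p - 1)) * S ^ (p - 1 - min 1 (p - 1)) = S ^ (p - 1) := by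
      rw [← Real.rpow_add hS]; ring_nf
    have h6 : (dy - dx) ^ (min 1 (p - 1)) * S ^ (p - 1 - min 1 (p - 1)) ≤
        χ ^ (min 1 (p - 1)) * S ^ (p - 1) := by
      rw [← h5, ← mul_assoc]
      gcongr
    have h7 : 2 * p * ((dy - dx) ^ (min 1 (p - 1)) * S ^ (p - 1 - min 1 (p - 1))) ≤
      2 * p * (χ ^ (min 1 (p - 1)) * S ^ (p - 1)) := by gcongr
    linarith

/-- The gain. -/
lemma Jp_gain {p : ℝ} (hp : 1 < p) {l d : ℝ} (hl : 0 < l) (hd : 0 ≤ d) (hdl : d ≤ l) :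
    min 1 (p - 1) * l ^ (p - 2) * d ≤ Jp p (-l + d) - Jp p (-l) := by
  have e : -l + d = -(l - d) := by ring
  rw [e, Jp_neg, Jp_neg, Jp_of_nonneg hp hl.le, Jp_of_nonneg hp (by linarith)]
  set y := d / l with hy
  have hy0 : 0 ≤ y := by positivity
  have hy1 : y ≤ 1 := (div_le_one hl).2 hdl
  have e2 : l - d = l * (1 - y) := by rw [hy]; field_simp
  rw [e2, Real.mul_rpow hl.le (by linarith)]
  have e3 : l ^ (p - 1) = l ^ (p - 2) * l := by
    rw [← Real.rpow_add_one hl.ne']; ring_nf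
  have e4 : min 1 (p - 1) * l ^ (p - 2) * d = min 1 (p - 1) * y * l ^ (p - 1) := by
    rw [e3, hy]; field_simp
  have key : (1 - y) ^ (p - 1) ≤ 1 - min 1 (p - 1) * y := by
    rcases le_total p 2 with hp2 | hp2
    · rw [min_eq_right (by linarith)]
      have := rpow_one_add_le_one_add_mul_self (s := -y) (by linarith) (p := p - 1)
        (by linarith) (by linarith)
      have e5 : 1 + -y = 1 - y := by ring
      rw [e5] at this
      linarith
    · rw [min_eq_left (by linarith)]
      have := Real.rpow_le_rpow_of_exponent_ge' (x := 1 - y) (by linarith) (by linarith)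
        (z := 1) (y := p - 1) (by norm_num) (by linarith)
      rw [Real.rpow_one] at this
      linarith
  have h0 : 0 ≤ l ^ (p - 1) := by positivity
  rw [e4]
  nlinarith

/-- The loss in the singular region. -/
lemma Jp_loss {p : ℝ} (hp : 1 < p) {l Q B : ℝ} (hl : l ≠ 0) (hQ : 0 ≤ Q) (hlB : |l| ≤ B)
    (hQB : Q ≤ B) :
    -(2 * p * 2 ^ p * ((|l| / B) ^ (-(max (2 - p) 0)) * B ^ (p - 2) * Q))
      ≤ Jp p (-l - Q) - Jp p (-l) := by
  have hl' : 0 < |l| := abs_pos.2 hl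
  have hB : 0 < B := by linarith
  have h2p : (1:ℝ) ≤ 2 ^ p := Real.one_le_rpow (by norm_num) (by linarith)
  rcases le_total p 2 with hp2 | hp2
  · rw [max_eq_left (by linarith)]
    have e1 : (|l| / B) ^ (-(2 - p)) * B ^ (p - 2) = |l| ^ (p - 2) := by
      rw [neg_sub, ← Real.mul_rpow (by positivity) hB.le, div_mul_cancel₀ _ hB.ne']
    rw [e1]
    have key : Jp p (-l) - Jp p (-l - Q) ≤ 2 * (|l| ^ (p - 2) * Q) := by
      set m := |l| with hm
      have em : m ^ (p - 1) = m ^ (p - 2) * m := by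
        rw [← Real.rpow_add_one hl'.ne']; ring_nf
      have hmp : 0 < m ^ (p - 2) := by positivity
      rcases le_total l 0 with h | h
      · have el : -l = m := by rw [hm, abs_of_nonpos h]
        rw [el]
        rcases le_total Q m with hQm | hQm
        · rw [Jp_of_nonneg hp hl'.le, Jp_of_nonneg hp (by linarith)]
          have h1 : m - Q = m * (1 - Q / m) := by field_simp
          have hy1 : Q / m ≤ 1 := (div_le_one hl').2 hQm
          have hy0 : 0 ≤ Q / m := by positivity
          rw [h1, Real.mul_rpow hl'.le (by linarith)]
          have h2 := Real.rpow_le_rpow_of_exponent_ge' (x := 1 - Q / m) (by linarith) (by linarith)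
            (z := p - 1) (y := 1) (by linarith) (by linarith)
          rw [Real.rpow_one] at h2
          have h3 : m ^ (p - 1) * (1 - Q / m) = m ^ (p - 1) - m ^ (p - 2) * Q := by
            rw [em]; field_simp
          have h4 : m ^ (p - 1) * (1 - Q / m) ≤ m ^ (p - 1) * (1 - Q / m) ^ (p - 1) := by
            gcongr
          nlinarith
        · have hQ' : 0 < Q := by linarith
          have h1 : m - Q = -(Q - m) := by ring
          rw [h1, Jp_neg, Jp_of_nonneg hp hl'.le, Jp_of_nonneg hp (by linarith), sub_neg_eq_add]
          have eQ : Q ^ (p - 1) = Q ^ (p - 2) * Q := by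
            rw [← Real.rpow_add_one hQ'.ne']; ring_nf
          have h2 : m ^ (p - 1) ≤ Q ^ (p - 1) := Real.rpow_le_rpow hl'.le hQm (by linarith)
          have h3 : (Q - m) ^ (p - 1) ≤ Q ^ (p - 1) :=
            Real.rpow_le_rpow (by linarith) (by linarith) (by linarith)
          have h4 : Q ^ (p - 2) ≤ m ^ (p - 2) :=
            Real.rpow_le_rpow_of_nonpos hl' hQm (by linarith)
          have h5 : Q ^ (p - 2) * Q ≤ m ^ (p - 2) * Q := by gcongr
          linarith
      · have el : l = m := by rw [hm, abs_of_nonneg h]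
        have e3 : -m - Q = -(m + Q) := by ring
        rw [el, e3, Jp_neg, Jp_neg, Jp_of_nonneg hp hl'.le, Jp_of_nonneg hp (by linarith)]
        have h1 : m + Q = m * (1 + Q / m) := by field_simp
        have hy0 : 0 ≤ Q / m := by positivity
        rw [h1, Real.mul_rpow hl'.le (by linarith)]
        have h2 := rpow_one_add_le_one_add_mul_self (s := Q / m) (by linarith) (p := p - 1)
          (by linarith) (by linarith)
        have h3 : m ^ (p - 1) * (1 + Q / m) = m ^ (p - 1) + m ^ (p - 2) * Q := by
          rw [em]; field_simp
        have h4 : m ^ (p - 1) * (1 + Q / m) ^ (p - 1) ≤ m ^ (p - 1) * (1 + Q / m) := by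
          gcongr; nlinarith
        nlinarith
    have h6 : 0 ≤ |l| ^ (p - 2) * Q := by positivity
    have h7 : (2:ℝ) ≤ 2 * p * 2 ^ p := by nlinarith
    nlinarith
  · rw [max_eq_right (by linarith), neg_zero, Real.rpow_zero, one_mul]
    have := Jp_sub_le hp (a := -l) (b := -l - Q) (S := 2 * B) (by linarith)
      (by rw [abs_neg]; linarith)
      (by
        have := abs_sub (-l) Q
        rw [abs_neg, abs_of_nonneg hQ] at this
        linarith)
    rw [min_eq_left (by linarith), Real.rpow_one, Real.mul_rpow (by norm_num) hB.le] at this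
    have e : -l - (-l - Q) = Q := by ring
    rw [e] at this
    have e2 : p - 1 - 1 = p - 2 := by ring
    rw [e2] at this
    have h3 : (2:ℝ) ^ (p - 2) ≤ 2 ^ p :=
      Real.rpow_le_rpow_of_exponent_le (by norm_num) (by linarith)
    have h4 : 2 * p * (Q * (2 ^ (p - 2) * B ^ (p - 2))) ≤ 2 * p * (Q * (2 ^ p * B ^ (p - 2))) := by
      gcongr
    nlinarith

section Part2
open scoped RealInnerProductSpace

lemma polar_lintegral {N : ℕ} (hN : 1 ≤ N) {h : ℝ → ℝ≥0∞} {k : Euc N → ℝ≥0∞}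
    (hh : Measurable h) (hk : Measurable k) :
    ∫⁻ z : Euc N, h ‖z‖ * k (‖z‖⁻¹ • z) =
      (∫⁻ w : sphere (0 : Euc N) 1, k w ∂(volume : Measure (Euc N)).toSphere) *
        ∫⁻ r in Ioi (0:ℝ), ENNReal.ofReal (r ^ (N - 1)) * h r := by
  have : Nonempty (Fin N) := ⟨⟨0, hN⟩⟩
  have hd : Module.finrank ℝ (Euc N) = N := by simp
  have e1 : ∫⁻ z : Euc N, h ‖z‖ * k (‖z‖⁻¹ • z)
      = ∫⁻ x : ({(0 : Euc N)}ᶜ : Set (Euc N)), h ‖x.1‖ * k (‖x.1‖⁻¹ • x.1)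
          ∂(Measure.comap (Subtype.val : ({(0 : Euc N)}ᶜ : Set (Euc N)) → Euc N) volume) := by
    rw [lintegral_subtype_comap (measurableSet_singleton _).compl
      (fun z : Euc N => h ‖z‖ * k (‖z‖⁻¹ • z)), MeasureTheory.restrict_compl_singleton]
  have mp := (volume : Measure (Euc N)).measurePreserving_homeomorphUnitSphereProd
  have e2 := mp.lintegral_comp_emb (Homeomorph.measurableEmbedding _)
    (fun q : sphere (0 : Euc N) 1 × Ioi (0:ℝ) => k q.1 * h q.2)
  simp only [homeomorphUnitSphereProd_apply_snd_coe, homeomorphUnitSphereProd_apply_fst_coe] at e2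
  have hks : Measurable (fun w : sphere (0 : Euc N) 1 => k w) := hk.comp measurable_subtype_coe
  have hhs : Measurable (fun w : Ioi (0:ℝ) => h w) := hh.comp measurable_subtype_coe
  rw [e1]
  simp_rw [mul_comm (h _) (k _)]
  rw [e2, lintegral_prod_mul hks.aemeasurable hhs.aemeasurable, hd]
  congr 1
  rw [Measure.volumeIoiPow, lintegral_withDensity_eq_lintegral_mul _ (by fun_prop) hhs]
  simp only [Pi.mul_apply]
  rw [lintegral_subtype_comap measurableSet_Ioi
    (fun r : ℝ => ENNReal.ofReal (r ^ (N - 1)) * h r)]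

lemma natpow_mul_rpow {N : ℕ} (hN : 1 ≤ N) {r : ℝ} (hr : 0 < r) (a : ℝ) :
    r ^ (N - 1) * r ^ a = r ^ ((N : ℝ) - 1 + a) := by
  rw [← Real.rpow_natCast, ← Real.rpow_add hr]
  congr 2
  push_cast [hN]; ring

lemma lint_Ioi_rpow {γ δ : ℝ} (hγ : 0 < γ) (hδ : 0 < δ) :
    ∫⁻ r in Ioi δ, ENNReal.ofReal (r ^ (-1 - γ)) = ENNReal.ofReal (δ ^ (-γ) / γ) := by
  rw [← ofReal_integral_eq_lintegral_ofReal (integrableOn_Ioi_rpow_of_lt (by linarith) hδ)]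
  · rw [integral_Ioi_rpow_of_lt (by linarith) hδ]
    congr 1
    rw [show -1 - γ + 1 = -γ by ring, neg_div_neg_eq]
  · filter_upwards [ae_restrict_mem measurableSet_Ioi] with r hr
    exact Real.rpow_nonneg (hδ.trans hr).le _

lemma lint_Ioo_rpow {γ ρ : ℝ} (hγ : 0 < γ) (hρ : 0 < ρ) :
    ∫⁻ r in Ioo 0 ρ, ENNReal.ofReal (r ^ (γ - 1)) = ENNReal.ofReal (ρ ^ γ / γ) := by
  rw [Measure.restrict_congr_set Ioo_ae_eq_Ioc]
  have hi : IntervalIntegrable (fun r : ℝ => r ^ (γ - 1)) volume 0 ρ :=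
    intervalIntegral.intervalIntegrable_rpow' (by linarith)
  rw [← ofReal_integral_eq_lintegral_ofReal hi.1]
  · rw [← intervalIntegral.integral_of_le hρ.le, integral_rpow (Or.inl (by linarith))]
    congr 1
    rw [sub_add_cancel, Real.zero_rpow hγ.ne', sub_zero]
  · filter_upwards [ae_restrict_mem measurableSet_Ioc] with r hr
    exact Real.rpow_nonneg hr.1.le _

lemma I1 {N : ℕ} (hN : 1 ≤ N) {γ : ℝ} (hγ : 0 < γ) :
    ∃ C : ℝ, 0 < C ∧ ∀ δ : ℝ, 0 < δ →
      ∫⁻ z in {z : Euc N | δ ≤ ‖z‖}, ENNReal.ofReal (‖z‖ ^ (-((N:ℝ) + γ)))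
        ≤ ENNReal.ofReal (C * δ ^ (-γ)) := by
  set A : ℝ≥0∞ := (volume : Measure (Euc N)).toSphere univ with hA
  have hAt : A ≠ ⊤ := measure_ne_top _ _
  refine ⟨A.toReal / γ + 1, by positivity, fun δ hδ => ?_⟩
  have hm : MeasurableSet {z : Euc N | δ ≤ ‖z‖} := measurableSet_le measurable_const measurable_norm
  rw [← lintegral_indicator hm]
  have e : ∀ z : Euc N, {z : Euc N | δ ≤ ‖z‖}.indicator
      (fun z => ENNReal.ofReal (‖z‖ ^ (-((N:ℝ) + γ)))) z
      = (Ici δ).indicator (fun r => ENNReal.ofReal (r ^ (-((N:ℝ) + γ)))) ‖z‖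
        * (fun _ : Euc N => (1:ℝ≥0∞)) (‖z‖⁻¹ • z) := by
    intro z; simp [indicator]
  simp_rw [e]
  rw [polar_lintegral hN (Measurable.indicator (by fun_prop) measurableSet_Ici) measurable_const]
  rw [lintegral_const, one_mul, ← hA]
  have e2 : ∫⁻ r in Ioi (0:ℝ), ENNReal.ofReal (r ^ (N - 1)) *
      (Ici δ).indicator (fun r => ENNReal.ofReal (r ^ (-((N:ℝ) + γ)))) r
      = ENNReal.ofReal (δ ^ (-γ) / γ) := by
    rw [← lint_Ioi_rpow hγ hδ, Measure.restrict_congr_set (Ioi_ae_eq_Ici (a := δ)),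
      ← lintegral_indicator measurableSet_Ioi, ← lintegral_indicator measurableSet_Ici]
    congr 1
    ext r
    by_cases hr : δ ≤ r
    · have hr0 : 0 < r := hδ.trans_le hr
      simp only [indicator, mem_Ioi, mem_Ici, hr0, hr, if_true]
      rw [← ENNReal.ofReal_mul (by positivity), natpow_mul_rpow hN hr0]
      congr 2; ring
    · simp [indicator, hr]
  rw [e2, ← ENNReal.ofReal_toReal hAt, ← ENNReal.ofReal_mul ENNReal.toReal_nonneg]
  apply ENNReal.ofReal_le_ofReal
  have : 0 ≤ δ ^ (-γ) := by positivity
  have e3 : A.toReal * (δ ^ (-γ) / γ) = A.toReal / γ * δ ^ (-γ) := by ring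
  rw [e3]; simp only [ENNReal.toReal_ofReal ENNReal.toReal_nonneg]; nlinarith

lemma slab_finite {N : ℕ} (i0 : Fin N) {β : ℝ} (hβ1 : β < 1) :
    ∫⁻ z in ball (0 : Euc N) 1, ENNReal.ofReal (|z i0| ^ (-β)) < ⊤ := by
  set f : Fin N → ℝ → ℝ := fun i x => if i = i0 then (Icc (-1:ℝ) 1).indicator (fun x => |x| ^ (-β)) x
    else (Icc (-1:ℝ) 1).indicator (fun _ => (1:ℝ)) x with hf
  have h1 : ∀ i, Integrable (f i) volume := by
    intro i
    by_cases h : i = i0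
    · simp only [hf, h, if_true]
      rw [integrable_indicator_iff measurableSet_Icc]
      have hpos : IntegrableOn (fun x : ℝ => |x| ^ (-β)) (Icc 0 1) := by
        have := (intervalIntegral.intervalIntegrable_rpow' (a := 0) (b := 1) (r := -β)
          (by linarith)).1
        rw [integrableOn_Icc_iff_integrableOn_Ioc]
        refine this.congr_fun (fun x hx => ?_) measurableSet_Ioc
        simp only; rw [abs_of_pos hx.1]
      have hneg : IntegrableOn (fun x : ℝ => |x| ^ (-β)) (Icc (-1) 0) := by
        have := (Measure.measurePreserving_neg (volume : Measure ℝ)).integrableOn_comp_preimage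
          (MeasurableEquiv.neg ℝ).measurableEmbedding (f := fun x : ℝ => |x| ^ (-β))
          (s := Icc 0 1)
        have h2 := this.2 hpos
        simpa [Function.comp_def] using h2
      have := hneg.union hpos
      rwa [Icc_union_Icc_eq_Icc (by norm_num) (by norm_num)] at this
    · simp only [hf, h, if_false]
      rw [integrable_indicator_iff measurableSet_Icc]
      exact integrableOn_const (by simp) (by simp)
  have h2 := Integrable.fintype_prod (μ := fun _ : Fin N => (volume : Measure ℝ)) h1
  have h3 := (PiLp.volume_preserving_ofLp (Fin N)).integrable_comp_of_integrable h2
  have hfn : ∀ i x, 0 ≤ f i x := by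
    intro i x
    simp only [hf]
    split_ifs <;> apply indicator_nonneg <;> intros <;> positivity
  have h4 : ∫⁻ z : Euc N, ENNReal.ofReal (∏ i, f i (z i)) < ⊤ := by
    have := h3.lintegral_lt_top
    simpa [Function.comp_def] using this
  refine lt_of_le_of_lt ?_ h4
  rw [← lintegral_indicator measurableSet_ball]
  apply lintegral_mono
  intro z
  apply indicator_le
  intro z hz
  apply ENNReal.ofReal_le_ofReal
  have hz' : ∀ i, z i ∈ Icc (-1:ℝ) 1 := by
    intro i
    have := PiLp.norm_apply_le z i
    rw [mem_ball_zero_iff] at hz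
    rw [Real.norm_eq_abs] at this
    exact abs_le.1 (this.trans hz.le)
  have : ∏ i, f i (z i) = |z i0| ^ (-β) := by
    rw [Finset.prod_eq_single i0]
    · simp only [hf, if_true, indicator_of_mem (hz' i0)]
    · intro i _ hi
      simp only [hf, hi, if_false, indicator_of_mem (hz' i)]
    · simp
  rw [this]

lemma slab_finite' {N : ℕ} (i0 : Fin N) (β : ℝ) (e : Euc N) (he : ‖e‖ = 1) :
    ∫⁻ z in ball (0 : Euc N) 1, ENNReal.ofReal (|⟪e, z⟫| ^ (-β))
      = ∫⁻ z in ball (0 : Euc N) 1, ENNReal.ofReal (|z i0| ^ (-β)) := by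
  set v : Euc N := EuclideanSpace.single i0 1
  have hv : ‖v‖ = 1 := by simp [v]
  set R := Submodule.reflection (ℝ ∙ (e - v))ᗮ with hR
  have hRe : R e = v := Submodule.reflection_sub (he.trans hv.symm)
  have mp : MeasurePreserving R := R.measurePreserving
  have := mp.setLIntegral_comp_preimage_emb R.toHomeomorph.measurableEmbedding
    (fun z => ENNReal.ofReal (|z i0| ^ (-β))) (ball 0 1)
  rw [← this]
  have hb : R ⁻¹' ball 0 1 = ball 0 1 := by ext z; simp
  rw [hb]
  congr 1
  ext z
  have : ⟪e, z⟫ = (R z) i0 := by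
    rw [← R.inner_map_map, hRe]
    simp [v, EuclideanSpace.inner_single_left]
  rw [this]

lemma sphere_const {N : ℕ} (hN : 1 ≤ N) {β : ℝ} (hβ1 : β < 1) :
    ∃ A : ℝ≥0∞, A ≠ ⊤ ∧ ∀ e : Euc N, ‖e‖ = 1 →
      ∫⁻ w : sphere (0 : Euc N) 1, ENNReal.ofReal (|⟪e, (w : Euc N)⟫| ^ (-β))
        ∂(volume : Measure (Euc N)).toSphere ≤ A := by
  have i0 : Fin N := ⟨0, hN⟩
  have : Nonempty (Fin N) := ⟨⟨0, hN⟩⟩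
  set S := ∫⁻ z in ball (0 : Euc N) 1, ENNReal.ofReal (|z i0| ^ (-β)) with hS
  have hSt : S < ⊤ := slab_finite i0 hβ1
  have hN1 : (1:ℝ) ≤ N := by exact_mod_cast hN
  set c : ℝ := 1 / ((N:ℝ) - β) with hc
  have hcp : 0 < c := by rw [hc]; apply one_div_pos.2; linarith
  refine ⟨S / ENNReal.ofReal c, ?_, fun e he => ?_⟩
  · exact ENNReal.div_ne_top hSt.ne (by simpa using hcp)
  rw [ENNReal.le_div_iff_mul_le (Or.inl (by simpa using hcp)) (Or.inl ENNReal.ofReal_ne_top)]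
  have key : ∫⁻ z : Euc N, (Iio (1:ℝ)).indicator (fun r => ENNReal.ofReal (r ^ (-β))) ‖z‖ *
      (fun w : Euc N => ENNReal.ofReal (|⟪e, w⟫| ^ (-β))) (‖z‖⁻¹ • z) = S := by
    rw [hS, ← slab_finite' i0 β e he, ← lintegral_indicator measurableSet_ball]
    apply lintegral_congr_ae
    have h0 : ∀ᵐ z : Euc N, z ≠ 0 := by
      simp [ae_iff]
    filter_upwards [h0] with z hz
    have hz' : 0 < ‖z‖ := norm_pos_iff.2 hz
    by_cases h : ‖z‖ < 1
    · simp only [indicator, mem_Iio, h, if_true, mem_ball_zero_iff]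
      rw [← ENNReal.ofReal_mul (by positivity), inner_smul_right, abs_mul,
        Real.mul_rpow (abs_nonneg _) (abs_nonneg _), ← mul_assoc, abs_of_pos (inv_pos.2 hz'),
        ← Real.mul_rpow hz'.le (inv_pos.2 hz').le, mul_inv_cancel₀ hz'.ne', Real.one_rpow, one_mul]
    · simp [indicator, h]
  rw [polar_lintegral hN (h := (Iio (1:ℝ)).indicator (fun r => ENNReal.ofReal (r ^ (-β))))
    (k := fun w : Euc N => ENNReal.ofReal (|⟪e, w⟫| ^ (-β)))
    (Measurable.indicator (by fun_prop) measurableSet_Iio)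
    (by fun_prop)] at key
  rw [← key]
  gcongr
  have h2 := lint_Ioo_rpow (γ := (N:ℝ) - β) (ρ := 1) (by linarith) one_pos
  rw [Real.one_rpow, ← hc] at h2
  rw [← h2]
  rw [← lintegral_indicator measurableSet_Ioi, ← lintegral_indicator measurableSet_Ioo]
  apply lintegral_mono
  intro r
  by_cases hr : r ∈ Ioo (0:ℝ) 1
  · simp only [indicator, hr, if_true, mem_Ioi, hr.1, mem_Iio, hr.2]
    rw [← ENNReal.ofReal_mul (pow_nonneg hr.1.le _), natpow_mul_rpow hN hr.1]
    apply le_of_eq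
    congr 2; ring
  · simp [indicator, hr]

lemma I2 {N : ℕ} (hN : 1 ≤ N) {β γ : ℝ} (hβ1 : β < 1) (hγ : 0 < γ) :
    ∃ C : ℝ, 0 < C ∧ ∀ e : Euc N, ‖e‖ = 1 → ∀ ρ : ℝ, 0 < ρ →
      ∫⁻ z in ball (0 : Euc N) ρ,
        ENNReal.ofReal ((|⟪e, z⟫| / ‖z‖) ^ (-β) * ‖z‖ ^ (γ - (N:ℝ)))
        ≤ ENNReal.ofReal (C * ρ ^ γ) := by
  obtain ⟨A, hAt, hA⟩ := sphere_const hN hβ1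
  refine ⟨A.toReal / γ + 1, by positivity, fun e he ρ hρ => ?_⟩
  rw [← lintegral_indicator measurableSet_ball]
  have e1 : ∀ z : Euc N, (ball (0 : Euc N) ρ).indicator
      (fun z => ENNReal.ofReal ((|⟪e, z⟫| / ‖z‖) ^ (-β) * ‖z‖ ^ (γ - (N:ℝ)))) z
      = (Iio ρ).indicator (fun r => ENNReal.ofReal (r ^ (γ - (N:ℝ)))) ‖z‖
        * (fun w : Euc N => ENNReal.ofReal (|⟪e, w⟫| ^ (-β))) (‖z‖⁻¹ • z) := by
    intro z
    by_cases h : ‖z‖ < ρ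
    · simp only [indicator, mem_Iio, h, if_true, mem_ball_zero_iff]
      rw [← ENNReal.ofReal_mul (by positivity), inner_smul_right, abs_mul, abs_inv, abs_norm,
        mul_comm, div_eq_inv_mul]
    · simp [indicator, h]
  simp_rw [e1]
  rw [polar_lintegral hN (h := (Iio ρ).indicator (fun r => ENNReal.ofReal (r ^ (γ - (N:ℝ)))))
    (k := fun w : Euc N => ENNReal.ofReal (|⟪e, w⟫| ^ (-β)))
    (Measurable.indicator (by fun_prop) measurableSet_Iio) (by fun_prop)]
  have e2 : ∫⁻ r in Ioi (0:ℝ), ENNReal.ofReal (r ^ (N - 1)) *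
      (Iio ρ).indicator (fun r => ENNReal.ofReal (r ^ (γ - (N:ℝ)))) r
      = ENNReal.ofReal (ρ ^ γ / γ) := by
    rw [← lint_Ioo_rpow hγ hρ,
      ← lintegral_indicator measurableSet_Ioi, ← lintegral_indicator measurableSet_Ioo]
    congr 1
    ext r
    by_cases hr : r ∈ Ioo (0:ℝ) ρ
    · simp only [indicator, hr, if_true, mem_Ioi, hr.1, mem_Iio, hr.2]
      rw [← ENNReal.ofReal_mul (pow_nonneg hr.1.le _), natpow_mul_rpow hN hr.1]
      congr 2; ring
    · by_cases h0 : 0 < r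
      · have : ¬ r < ρ := fun h => hr ⟨h0, h⟩
        simp [indicator, this]
      · simp [indicator, h0]
  rw [e2]
  calc _ ≤ A * ENNReal.ofReal (ρ ^ γ / γ) := by gcongr; exact hA e he
    _ ≤ _ := by
      rw [← ENNReal.ofReal_toReal hAt, ← ENNReal.ofReal_mul ENNReal.toReal_nonneg]
      apply ENNReal.ofReal_le_ofReal
      have : 0 ≤ ρ ^ γ := by positivity
      have e3 : A.toReal * (ρ ^ γ / γ) = A.toReal / γ * ρ ^ γ := by ring
      rw [e3]; simp only [ENNReal.toReal_ofReal ENNReal.toReal_nonneg]; nlinarith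

end Part2

section Part3

/-- Space-time-space triples `(t, x, y)`. -/
abbrev XX (N : ℕ) := ℝ × Euc N × Euc N

/-- Working bundle of properties of a solution. -/
structure Sol (N : ℕ) (p s lam Lam : ℝ) (K : Euc N → ℝ) (u : Euc N → ℝ → ℝ) : Prop where
  hN : 1 ≤ N
  hp : 1 < p
  hs : s ∈ Ioo (0 : ℝ) 1
  hLam : 0 < Lam
  ker : IsKernel N p s lam Lam K
  cont : Continuous (fun q : Euc N × ℝ => u q.1 q.2)
  energy : ∀ a b : ℝ, -2 < a → b < 0 →
    ∫⁻ t in Icc a b, ∫⁻ x in ball (0 : Euc N) (15/8), ∫⁻ y in ball (0 : Euc N) (15/8),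
      ENNReal.ofReal (|u x t - u y t| ^ p * ‖x - y‖ ^ (-((N : ℝ) + s * p))) < ⊤
  tail : ∀ᵐ t : ℝ, t ∈ Ioo (-2 : ℝ) 0 →
    ∫⁻ x in (ball (0 : Euc N) 2)ᶜ,
      ENNReal.ofReal (|u x t| ^ (p - 1) * ‖x‖ ^ (-((N : ℝ) + s * p))) ≤ 1
  bdd : ∀ x ∈ ball (0 : Euc N) 2, ∀ t ∈ Ioc (-2 : ℝ) 0, |u x t| ≤ 1
  weak : ∀ φ : Euc N × ℝ → ℝ, ContDiff ℝ (⊤ : ℕ∞) φ → HasCompactSupport φ →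
    tsupport φ ⊆ ball 0 2 ×ˢ Ioo (-2 : ℝ) 0 →
    -(∫ t in Ioc (-2 : ℝ) 0, ∫ x in ball (0 : Euc N) 2,
        u x t * deriv (fun τ => φ (x, τ)) t) +
      (1 / 2) * ∫ t in Ioc (-2 : ℝ) 0, ∫ x, ∫ y,
        Jp p (u x t - u y t) * (φ (x, t) - φ (y, t)) * K (x - y) = 0

/-- The nonlocal flux density. -/
def DD {N : ℕ} (p : ℝ) (K : Euc N → ℝ) (u : Euc N → ℝ → ℝ) (q : XX N) : ℝ :=
  Jp p (u q.2.1 q.1 - u q.2.2 q.1) * K (q.2.1 - q.2.2)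

/-- Far set. -/
def farS (N : ℕ) (δ : ℝ) : Set (XX N) := {q | δ ≤ ‖q.2.1 - q.2.2‖}

lemma farS_meas (N : ℕ) (δ : ℝ) : MeasurableSet (farS N δ) :=
  measurableSet_le measurable_const (by fun_prop)

def nearS (N : ℕ) (a b δ : ℝ) : Set (XX N) :=
  {q | q.1 ∈ Icc a b ∧ q.2.1 ∈ ball (0 : Euc N) (15/8) ∧ q.2.2 ∈ ball (0 : Euc N) (15/8) ∧
    ‖q.2.1 - q.2.2‖ < δ}

lemma nearS_meas (N : ℕ) (a b δ : ℝ) : MeasurableSet (nearS N a b δ) := by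
  have h1 : MeasurableSet {q : XX N | q.1 ∈ Icc a b} := measurable_fst measurableSet_Icc
  have h2 : MeasurableSet {q : XX N | q.2.1 ∈ ball (0 : Euc N) (15/8)} :=
    (measurable_fst.comp measurable_snd) measurableSet_ball
  have h3 : MeasurableSet {q : XX N | q.2.2 ∈ ball (0 : Euc N) (15/8)} :=
    (measurable_snd.comp measurable_snd) measurableSet_ball
  have h4 : MeasurableSet {q : XX N | ‖q.2.1 - q.2.2‖ < δ} :=
    measurableSet_lt (by fun_prop) measurable_const
  exact h1.inter (h2.inter (h3.inter h4))

/-- Energy density. -/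
def eden {N : ℕ} (p s : ℝ) (f : Euc N → ℝ → ℝ) (q : XX N) : ℝ≥0∞ :=
  ENNReal.ofReal (|f q.2.1 q.1 - f q.2.2 q.1| ^ p * ‖q.2.1 - q.2.2‖ ^ (-((N : ℝ) + s * p)))

variable {N : ℕ} {p s lam Lam : ℝ} {K : Euc N → ℝ} {u : Euc N → ℝ → ℝ}

lemma cont_fst_sub {f : Euc N → ℝ → ℝ} (hf : Continuous (fun q : Euc N × ℝ => f q.1 q.2)) :
    Continuous (fun q : XX N => f q.2.1 q.1) :=
  hf.comp (f := fun q : XX N => (q.2.1, q.1)) (by fun_prop)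

lemma cont_snd_sub {f : Euc N → ℝ → ℝ} (hf : Continuous (fun q : Euc N × ℝ => f q.1 q.2)) :
    Continuous (fun q : XX N => f q.2.2 q.1) :=
  hf.comp (f := fun q : XX N => (q.2.2, q.1)) (by fun_prop)

lemma eden_meas {f : Euc N → ℝ → ℝ} (hf : Continuous (fun q : Euc N × ℝ => f q.1 q.2)) :
    Measurable (eden p s f) := by
  have h1 := (cont_fst_sub hf).measurable
  have h2 := (cont_snd_sub hf).measurable
  unfold eden
  fun_prop

lemma DD_meas (hp : 1 < p) (hK : Measurable K)
    (hu : Continuous (fun q : Euc N × ℝ => u q.1 q.2)) : Measurable (DD p K u) := by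
  have h1 := (cont_fst_sub hu).measurable
  have h2 := (cont_snd_sub hu).measurable
  have h3 := (Jp_continuous hp).measurable
  unfold DD
  exact (h3.comp (h1.sub h2)).mul (hK.comp (by fun_prop))

/-- swapping the two space variables -/
def swapX (N : ℕ) : XX N ≃ᵐ XX N :=
  (MeasurableEquiv.refl ℝ).prodCongr MeasurableEquiv.prodComm

lemma swapX_apply (q : XX N) : swapX N q = (q.1, q.2.2, q.2.1) := rfl

lemma swapX_mp : MeasurePreserving (swapX N) volume volume :=
  (MeasurePreserving.id (volume : Measure ℝ)).prod
    (Measure.measurePreserving_swap (μ := (volume : Measure (Euc N))) (ν := volume))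

lemma integral_swapX (f : XX N → ℝ) : ∫ q, f (swapX N q) = ∫ q, f q :=
  swapX_mp.integral_comp' f

lemma integrable_swapX {f : XX N → ℝ} (hf : Integrable f) :
    Integrable (fun q => f (swapX N q)) :=
  swapX_mp.integrable_comp_of_integrable hf

lemma Kzero_ae : ∀ᵐ z : Euc N, 1 ≤ N → z ≠ 0 := by
  by_cases hN : 1 ≤ N
  · have : Nonempty (Fin N) := ⟨⟨0, hN⟩⟩
    simp [ae_iff, hN]
  · simp [hN]

lemma IsKernel.symm (hK : IsKernel N p s lam Lam K) (z : Euc N) : K (-z) = K z := by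
  by_cases h : z = 0
  · simp [h]
  · exact hK.2.2.1 z h

lemma IsKernel.abs_le (hK : IsKernel N p s lam Lam K) {z : Euc N} (h : z ≠ 0) :
    |K z| ≤ Lam * ‖z‖ ^ (-((N : ℝ) + s * p)) := by
  rw [abs_of_pos (hK.2.1 z h)]
  exact (hK.2.2.2 z h).2

lemma DD_swap (hK : IsKernel N p s lam Lam K) (q : XX N) :
    DD p K u (swapX N q) = -DD p K u q := by
  rw [swapX_apply]
  unfold DD
  simp only
  rw [← neg_sub, Jp_neg, ← neg_sub q.2.1 q.2.2, hK.symm]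
  ring

/-- The far tail bound: uniform in `x`. -/
lemma far_bound (hN : 1 ≤ N) (hp : 1 < p) (hs : s ∈ Ioo (0 : ℝ) 1) (hLam : 0 < Lam)
    {δ : ℝ} (hδ : 0 < δ) :
    ∃ C : ℝ, 0 < C ∧ ∀ (K : Euc N → ℝ) (u : Euc N → ℝ → ℝ), Sol N p s lam Lam K u →
      ∀ᵐ t : ℝ, t ∈ Ioo (-2 : ℝ) 0 → ∀ x ∈ closedBall (0 : Euc N) (7/4),
        ∫⁻ y in {y : Euc N | δ ≤ ‖x - y‖},
          ENNReal.ofReal |Jp p (u x t - u y t) * K (x - y)| ≤ ENNReal.ofReal C := by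
  have hsp : 0 < s * p := mul_pos hs.1 (by linarith)
  obtain ⟨C1, hC1, h1⟩ := I1 hN hsp
  set n : ℝ := (N : ℝ) + s * p with hn
  have hn0 : 0 < n := by positivity
  refine ⟨Lam * 2 ^ (p - 1) * (2 * (C1 * δ ^ (-(s * p))) + 8 ^ n), by positivity, ?_⟩
  intro K u S
  filter_upwards [S.tail] with t ht htI x hx
  have ht' := ht htI
  have htI' : t ∈ Ioc (-2 : ℝ) 0 := ⟨htI.1, htI.2.le⟩
  rw [mem_closedBall_zero_iff] at hx
  have hmeas : MeasurableSet {y : Euc N | δ ≤ ‖x - y‖} :=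
    measurableSet_le measurable_const (by fun_prop)
  have hucont : Continuous (fun y => u y t) :=
    S.cont.comp (f := fun y : Euc N => (y, t)) (by fun_prop)
  -- pointwise bound
  have hpt : ∀ y ∈ {y : Euc N | δ ≤ ‖x - y‖},
      ENNReal.ofReal |Jp p (u x t - u y t) * K (x - y)| ≤
        ENNReal.ofReal (Lam * 2 ^ (p - 1)) * (ENNReal.ofReal 2 * ENNReal.ofReal (‖x - y‖ ^ (-n)) +
          ENNReal.ofReal (8 ^ n) * (ball (0 : Euc N) 2)ᶜ.indicator
            (fun y => ENNReal.ofReal (|u y t| ^ (p - 1) * ‖y‖ ^ (-n))) y) := by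
    intro y hy
    have hxy : 0 < ‖x - y‖ := hδ.trans_le hy
    have hne : x - y ≠ 0 := norm_pos_iff.1 hxy
    have hux : |u x t| ≤ 1 := S.bdd x (by rw [mem_ball_zero_iff]; linarith) t htI'
    have hux' : |u x t| ^ (p - 1) ≤ 1 := Real.rpow_le_one (abs_nonneg _) hux (by linarith)
    have hb : |Jp p (u x t - u y t) * K (x - y)| ≤
        (Lam * 2 ^ (p - 1)) * ((1 + |u y t| ^ (p - 1)) * ‖x - y‖ ^ (-n)) := by
      rw [abs_mul]
      have a1 := Jp_abs_sub_le hp (u x t) (u y t)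
      have a2 := S.ker.abs_le hne
      calc _ ≤ (2 ^ (p - 1) * (|u x t| ^ (p - 1) + |u y t| ^ (p - 1))) *
            (Lam * ‖x - y‖ ^ (-n)) := by gcongr
        _ ≤ (2 ^ (p - 1) * (1 + |u y t| ^ (p - 1))) * (Lam * ‖x - y‖ ^ (-n)) := by gcongr
        _ = _ := by ring
    refine (ENNReal.ofReal_le_ofReal hb).trans ?_
    rw [ENNReal.ofReal_mul (by positivity)]
    gcongr
    by_cases hy2 : y ∈ ball (0 : Euc N) 2
    · have huy : |u y t| ^ (p - 1) ≤ 1 :=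
        Real.rpow_le_one (abs_nonneg _) (S.bdd y hy2 t htI') (by linarith)
      have : (1 + |u y t| ^ (p - 1)) * ‖x - y‖ ^ (-n) ≤ 2 * ‖x - y‖ ^ (-n) := by
        gcongr; linarith
      refine (ENNReal.ofReal_le_ofReal this).trans ?_
      rw [ENNReal.ofReal_mul (by norm_num)]
      simp
    · have hy2' : 2 ≤ ‖y‖ := by simpa using hy2
      have h8 : ‖y‖ ≤ 8 * ‖x - y‖ := by
        have := norm_sub_norm_le y x
        rw [norm_sub_rev] at this
        linarith
      have hk : ‖x - y‖ ^ (-n) ≤ 8 ^ n * ‖y‖ ^ (-n) := by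
        have : (8 * ‖x - y‖) ^ (-n) ≤ ‖y‖ ^ (-n) :=
          Real.rpow_le_rpow_of_nonpos (by linarith) h8 (by linarith)
        rw [Real.mul_rpow (by norm_num) hxy.le, Real.rpow_neg (by norm_num)] at this
        rwa [inv_mul_le_iff₀ (by positivity)] at this
      rw [indicator_of_mem (show y ∈ (ball (0 : Euc N) 2)ᶜ from hy2)]
      rw [← ENNReal.ofReal_mul (by positivity : (0:ℝ) ≤ 8 ^ n)]
      rw [← ENNReal.ofReal_mul (by norm_num : (0:ℝ) ≤ 2), ← ENNReal.ofReal_add (by positivity)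
        (by positivity)]
      apply ENNReal.ofReal_le_ofReal
      have a3 : |u y t| ^ (p - 1) * ‖x - y‖ ^ (-n) ≤ |u y t| ^ (p - 1) * (8 ^ n * ‖y‖ ^ (-n)) := by
        gcongr
      have a4 : 0 ≤ ‖x - y‖ ^ (-n) := by positivity
      nlinarith
  have hI : ∫⁻ y in {y : Euc N | δ ≤ ‖x - y‖}, ENNReal.ofReal (‖x - y‖ ^ (-n))
      ≤ ENNReal.ofReal (C1 * δ ^ (-(s * p))) := by
    have e : ∫⁻ y in {y : Euc N | δ ≤ ‖x - y‖}, ENNReal.ofReal (‖x - y‖ ^ (-n))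
        = ∫⁻ z in {z : Euc N | δ ≤ ‖z‖}, ENNReal.ofReal (‖z‖ ^ (-n)) := by
      rw [← lintegral_indicator hmeas, ← lintegral_indicator
        (measurableSet_le measurable_const (by fun_prop) : MeasurableSet {z : Euc N | δ ≤ ‖z‖})]
      exact lintegral_sub_left_eq_self
        ({z : Euc N | δ ≤ ‖z‖}.indicator (fun z => ENNReal.ofReal (‖z‖ ^ (-n)))) x
    rw [e]; exact h1 δ hδ
  have mu1 : Measurable (fun y => u y t) := hucont.measurable
  calc _ ≤ ∫⁻ y in {y : Euc N | δ ≤ ‖x - y‖}, ENNReal.ofReal (Lam * 2 ^ (p - 1)) *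
          (ENNReal.ofReal 2 * ENNReal.ofReal (‖x - y‖ ^ (-n)) +
          ENNReal.ofReal (8 ^ n) * (ball (0 : Euc N) 2)ᶜ.indicator
            (fun y => ENNReal.ofReal (|u y t| ^ (p - 1) * ‖y‖ ^ (-n))) y) :=
        setLIntegral_mono' hmeas hpt
    _ = ENNReal.ofReal (Lam * 2 ^ (p - 1)) * (ENNReal.ofReal 2 * (∫⁻ y in {y : Euc N | δ ≤ ‖x - y‖},
          ENNReal.ofReal (‖x - y‖ ^ (-n))) + ENNReal.ofReal (8 ^ n) *
          ∫⁻ y in {y : Euc N | δ ≤ ‖x - y‖}, (ball (0 : Euc N) 2)ᶜ.indicator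
            (fun y => ENNReal.ofReal (|u y t| ^ (p - 1) * ‖y‖ ^ (-n))) y) := by
        have m2 : Measurable ((ball (0 : Euc N) 2)ᶜ.indicator
            (fun y => ENNReal.ofReal (|u y t| ^ (p - 1) * ‖y‖ ^ (-n)))) :=
          Measurable.indicator (by fun_prop) measurableSet_ball.compl
        rw [lintegral_const_mul _ (by fun_prop), lintegral_add_left (by fun_prop),
          lintegral_const_mul _ (by fun_prop), lintegral_const_mul _ m2]
    _ ≤ ENNReal.ofReal (Lam * 2 ^ (p - 1)) * (ENNReal.ofReal 2 * ENNReal.ofReal (C1 * δ ^ (-(s * p))) +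
          ENNReal.ofReal (8 ^ n) * 1) := by
        gcongr
        refine (setLIntegral_le_lintegral _ _).trans ?_
        rw [lintegral_indicator measurableSet_ball.compl]
        exact ht'
    _ = _ := by
        rw [mul_one, ← ENNReal.ofReal_mul (by norm_num), ← ENNReal.ofReal_add (by positivity)
          (by positivity), ← ENNReal.ofReal_mul (by positivity)]

/-- integrability of the far part -/
lemma far_integrable (S : Sol N p s lam Lam K u) {δ : ℝ} (hδ : 0 < δ) {a b M : ℝ}
    (ha : -2 < a) (hb : b < 0) {T : Euc N → ℝ → ℝ}
    (hT : Continuous (fun q : Euc N × ℝ => T q.1 q.2))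
    (hTM : ∀ x t, |T x t| ≤ M)
    (hsupp : ∀ x t, T x t ≠ 0 → x ∈ closedBall (0 : Euc N) (7/4) ∧ t ∈ Icc a b) :
    Integrable (fun q : XX N => T q.2.1 q.1 * (farS N δ).indicator (DD p K u) q) := by
  obtain ⟨C, hC, hfb⟩ := far_bound (lam := lam) S.hN S.hp S.hs S.hLam hδ
  have hfb := hfb K u S
  have m1 : Measurable (fun q : XX N => T q.2.1 q.1 * (farS N δ).indicator (DD p K u) q) :=
    (cont_fst_sub hT).measurable.mul
      ((DD_meas S.hp S.ker.1 S.cont).indicator (farS_meas N δ))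
  refine ⟨m1.aestronglyMeasurable, ?_⟩
  unfold HasFiniteIntegral
  have m2 := m1.enorm
  rw [Measure.volume_eq_prod, lintegral_prod _ m2.aemeasurable]
  have hM : 0 ≤ M := (abs_nonneg _).trans (hTM 0 0)
  have step : ∀ᵐ t : ℝ, ∫⁻ r : Euc N × Euc N,
      ‖T r.1 t * (farS N δ).indicator (DD p K u) (t, r)‖ₑ ≤
      (Icc a b).indicator (fun _ => ENNReal.ofReal M * ENNReal.ofReal C *
        volume (closedBall (0 : Euc N) (7/4))) t := by
    filter_upwards [hfb] with t ht
    by_cases htI : t ∈ Icc a b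
    · rw [indicator_of_mem htI]
      have ht := ht ⟨ha.trans_le htI.1, htI.2.trans_lt hb⟩
      have m3 : Measurable (fun r : Euc N × Euc N =>
        ‖T r.1 t * (farS N δ).indicator (DD p K u) (t, r)‖ₑ) :=
        m2.comp (by fun_prop : Measurable (fun r : Euc N × Euc N => ((t, r) : XX N)))
      rw [Measure.volume_eq_prod, lintegral_prod _ m3.aemeasurable]
      calc _ ≤ ∫⁻ x : Euc N, (closedBall (0 : Euc N) (7/4)).indicator
            (fun _ => ENNReal.ofReal M * ENNReal.ofReal C) x := by
            apply lintegral_mono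
            intro x
            by_cases hx : x ∈ closedBall (0 : Euc N) (7/4)
            · rw [indicator_of_mem hx]
              simp only [enorm_mul]
              have m4 : Measurable (fun y : Euc N => ‖(farS N δ).indicator (DD p K u) (t, x, y)‖ₑ) :=
                ((DD_meas S.hp S.ker.1 S.cont).indicator (farS_meas N δ)).enorm.comp
                  (by fun_prop : Measurable (fun y : Euc N => ((t, x, y) : XX N)))
              rw [lintegral_const_mul _ m4]
              gcongr
              · rw [Real.enorm_eq_ofReal_abs]
                exact ENNReal.ofReal_le_ofReal (hTM x t)
              · refine le_trans (le_of_eq ?_) (ht x hx)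
                rw [← lintegral_indicator
                  (measurableSet_le measurable_const (by fun_prop) :
                    MeasurableSet {y : Euc N | δ ≤ ‖x - y‖})]
                congr 1
                ext y
                by_cases hy : δ ≤ ‖x - y‖
                · rw [indicator_of_mem (show (t, x, y) ∈ farS N δ from hy),
                    indicator_of_mem (show y ∈ {y : Euc N | δ ≤ ‖x - y‖} from hy),
                    Real.enorm_eq_ofReal_abs]
                  rfl
                · rw [indicator_of_notMem (show (t, x, y) ∉ farS N δ from hy),
                    indicator_of_notMem (show y ∉ {y : Euc N | δ ≤ ‖x - y‖} from hy)]
                  simp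
            · have : T x t = 0 := by
                by_contra h; exact hx (hsupp x t h).1
              simp [this, hx]
        _ = _ := by
            rw [lintegral_indicator measurableSet_closedBall, setLIntegral_const]
    · have : ∀ x, T x t = 0 := by
        intro x; by_contra h; exact htI (hsupp x t h).2
      simp [this, htI]
  calc _ ≤ _ := lintegral_mono_ae step
    _ < ⊤ := by
      rw [lintegral_indicator measurableSet_Icc, setLIntegral_const]
      refine ENNReal.mul_lt_top (ENNReal.mul_lt_top (ENNReal.mul_lt_top ?_ ?_) ?_) ?_
      · simp
      · simp
      · exact measure_closedBall_lt_top
      · simp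

end Part3

section Part4
variable {N : ℕ} {p s lam Lam : ℝ} {K : Euc N → ℝ} {u : Euc N → ℝ → ℝ}

lemma near_est (S : Sol N p s lam Lam K u) {f : Euc N → ℝ → ℝ}
    (hf : Continuous (fun q : Euc N × ℝ => f q.1 q.2)) (a b δ : ℝ) :
    ∫⁻ q in nearS N a b δ, ENNReal.ofReal |DD p K u q * (f q.2.1 q.1 - f q.2.2 q.1)| ≤
      ENNReal.ofReal Lam * ((∫⁻ q in nearS N a b δ, eden p s u q) ^ ((p - 1) / p) *
        (∫⁻ q in nearS N a b δ, eden p s f q) ^ (1 / p)) := by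
  have hp := S.hp
  have hp0 : 0 < p := by linarith
  have hLam := S.hLam
  have hpq : (p / (p - 1)).HolderConjugate p := by
    have := (Real.HolderConjugate.conjExponent hp).symm
    simpa [Real.conjExponent] using this
  set n : ℝ := (N : ℝ) + s * p with hn
  have mu := eden_meas (p := p) (s := s) S.cont
  have mf := eden_meas (p := p) (s := s) hf
  have hpt : ∀ q : XX N, ENNReal.ofReal |DD p K u q * (f q.2.1 q.1 - f q.2.2 q.1)| ≤
      ENNReal.ofReal Lam * ((fun q => eden p s u q ^ ((p - 1) / p)) * fun q => eden p s f q ^ (1 / p)) q := by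
    intro q
    by_cases hq : q.2.1 - q.2.2 = 0
    · have : DD p K u q = 0 := by
        unfold DD
        rw [sub_eq_zero.1 hq]; simp [Jp_zero]
      simp [this]
    · simp only [Pi.mul_apply, eden]
      set w := |u q.2.1 q.1 - u q.2.2 q.1| with hw
      set v := |f q.2.1 q.1 - f q.2.2 q.1| with hv
      set k := ‖q.2.1 - q.2.2‖ ^ (-n) with hk
      have hk0 : 0 ≤ k := by positivity
      have hw0 : 0 ≤ w := abs_nonneg _
      have hv0 : 0 ≤ v := abs_nonneg _
      rw [ENNReal.ofReal_rpow_of_nonneg (by positivity) (div_nonneg (by linarith) hp0.le),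
        ENNReal.ofReal_rpow_of_nonneg (by positivity) (by positivity),
        ← ENNReal.ofReal_mul (by positivity), ← ENNReal.ofReal_mul hLam.le]
      apply ENNReal.ofReal_le_ofReal
      have e1 : (w ^ p * k) ^ ((p - 1) / p) * (v ^ p * k) ^ (1 / p) = w ^ (p - 1) * v * k := by
        rw [Real.mul_rpow (by positivity) hk0, Real.mul_rpow (by positivity) hk0,
          ← Real.rpow_mul hw0, ← Real.rpow_mul hv0, mul_div_cancel₀ _ hp0.ne',
          mul_one_div_cancel hp0.ne', Real.rpow_one]
        have : k ^ ((p - 1) / p) * k ^ (1 / p) = k := by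
          rw [← Real.rpow_add_of_nonneg hk0 (div_nonneg (by linarith) hp0.le) (by positivity)]
          rw [← add_div, sub_add_cancel, div_self hp0.ne', Real.rpow_one]
        linear_combination w ^ (p - 1) * v * this
      rw [e1, abs_mul, ← hv]
      unfold DD
      rw [abs_mul, Jp_abs hp, ← hw]
      have := S.ker.abs_le hq
      rw [← hn, ← hk] at this
      calc w ^ (p - 1) * |K (q.2.1 - q.2.2)| * v ≤ w ^ (p - 1) * (Lam * k) * v := by gcongr
        _ = _ := by ring
  refine (lintegral_mono hpt).trans ?_
  rw [lintegral_const_mul _ ((mu.pow_const _).mul (mf.pow_const _))]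
  gcongr
  have := ENNReal.lintegral_mul_le_Lp_mul_Lq (volume.restrict (nearS N a b δ)) hpq
    (mu.pow_const ((p - 1) / p)).aemeasurable (mf.pow_const (1 / p)).aemeasurable
  refine this.trans (le_of_eq ?_)
  have hp1 : p - 1 ≠ 0 := by linarith
  congr 2
  · congr 1; ext q
    rw [← ENNReal.rpow_mul, show (p - 1) / p * (p / (p - 1)) = 1 by field_simp, ENNReal.rpow_one]
  · field_simp
  · congr 1; ext q
    rw [← ENNReal.rpow_mul, one_div_mul_cancel hp0.ne', ENNReal.rpow_one]

lemma energy_near (S : Sol N p s lam Lam K u) {a b : ℝ} (ha : -2 < a) (hb : b < 0) (δ : ℝ) :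
    ∫⁻ q in nearS N a b δ, eden p s u q < ⊤ := by
  refine lt_of_le_of_lt ?_ (S.energy a b ha hb)
  have hsub : nearS N a b δ ⊆ Icc a b ×ˢ (ball (0 : Euc N) (15/8) ×ˢ ball (0 : Euc N) (15/8)) :=
    fun q hq => ⟨hq.1, hq.2.1, hq.2.2.1⟩
  refine (lintegral_mono_set hsub).trans (le_of_eq ?_)
  have mu := eden_meas (p := p) (s := s) S.cont
  rw [Measure.volume_eq_prod, setLIntegral_prod _ mu.aemeasurable.restrict]
  congr 1; ext t
  have m3 : Measurable (fun r : Euc N × Euc N => eden p s u (t, r)) :=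
    mu.comp (by fun_prop : Measurable (fun r : Euc N × Euc N => ((t, r) : XX N)))
  rw [Measure.volume_eq_prod, setLIntegral_prod _ m3.aemeasurable.restrict]
  rfl

lemma energy_near_tendsto (S : Sol N p s lam Lam K u) {a b : ℝ} (ha : -2 < a) (hb : b < 0) :
    Tendsto (fun n : ℕ => ∫⁻ q in nearS N a b (1 / ((n:ℝ) + 8)), eden p s u q) atTop (𝓝 0) := by
  have mu := eden_meas (p := p) (s := s) S.cont
  have hdiag : ∫⁻ q in ⋂ n : ℕ, nearS N a b (1 / ((n:ℝ) + 8)), eden p s u q = 0 := by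
    rw [setLIntegral_eq_zero_iff (MeasurableSet.iInter fun n => nearS_meas _ _ _ _) mu]
    filter_upwards with q hq
    rw [mem_iInter] at hq
    have h1 : ‖q.2.1 - q.2.2‖ ≤ 0 := by
      refine ge_of_tendsto' (x := atTop) (f := fun n : ℕ => 1 / ((n:ℝ) + 8)) ?_ (fun n => (hq n).2.2.2.le)
      have : Tendsto (fun n : ℕ => ((n:ℝ) + 8)) atTop atTop :=
        tendsto_atTop_add_const_right _ _ tendsto_natCast_atTop_atTop
      simpa [Function.comp_def] using tendsto_inv_atTop_zero.comp this
    have h2 : q.2.1 - q.2.2 = 0 := by simpa using h1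
    unfold eden
    rw [sub_eq_zero.1 h2]
    have hp0 : p ≠ 0 := by have := S.hp; linarith
    simp [Real.zero_rpow hp0]
  rw [← hdiag]
  have hanti : Antitone (fun n : ℕ => nearS N a b (1 / ((n:ℝ) + 8))) := by
    intro m n hmn q hq
    refine ⟨hq.1, hq.2.1, hq.2.2.1, hq.2.2.2.trans_le ?_⟩
    have : (m:ℝ) ≤ n := by exact_mod_cast hmn
    gcongr
  have := tendsto_measure_iInter_atTop (μ := volume.withDensity (eden p s u))
    (fun n : ℕ => (nearS_meas N a b (1 / ((n:ℝ) + 8))).nullMeasurableSet) hanti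
    ⟨0, by
      rw [withDensity_apply _ (nearS_meas _ _ _ _)]
      exact (energy_near S ha hb _).ne⟩
  simp only [Function.comp_def] at this
  rw [withDensity_apply _ (MeasurableSet.iInter fun n => nearS_meas _ _ _ _)] at this
  refine this.congr fun n => ?_
  rw [withDensity_apply _ (nearS_meas _ _ _ _)]

lemma weak_far (S : Sol N p s lam Lam K u) {a b δ : ℝ} (ha : -2 < a) (hb : b < 0)
    (hδ : 0 < δ) (hδ8 : δ ≤ 1/8) {φ : Euc N × ℝ → ℝ} (hφ : ContDiff ℝ (⊤ : ℕ∞) φ)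
    (hsupp : tsupport φ ⊆ closedBall (0 : Euc N) (7/4) ×ˢ Icc a b)
    (hE : ∫⁻ q in nearS N a b δ, eden p s (fun x t => φ (x, t)) q ≠ ⊤) :
    |-(∫ q : Euc N × ℝ, u q.1 q.2 * deriv (fun τ => φ (q.1, τ)) q.2) +
      ∫ q : XX N, φ (q.2.1, q.1) * (farS N δ).indicator (DD p K u) q| ≤
      Lam * ((∫⁻ q in nearS N a b δ, eden p s u q) ^ ((p - 1) / p) *
        (∫⁻ q in nearS N a b δ, eden p s (fun x t => φ (x, t)) q) ^ (1 / p)).toReal := by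
  have hp := S.hp
  have hp0 : 0 < p := by linarith
  have hφc := hφ.continuous
  have hcs : HasCompactSupport φ :=
    HasCompactSupport.of_support_subset_isCompact
      ((isCompact_closedBall _ _).prod isCompact_Icc) ((subset_tsupport φ).trans hsupp)
  have hsub2 : tsupport φ ⊆ ball 0 2 ×ˢ Ioo (-2 : ℝ) 0 := by
    refine hsupp.trans (prod_mono (closedBall_subset_ball (by norm_num)) ?_)
    exact fun t ht => ⟨ha.trans_le ht.1, ht.2.trans_lt hb⟩
  have hz : ∀ x t, φ (x, t) ≠ 0 → x ∈ closedBall (0 : Euc N) (7/4) ∧ t ∈ Icc a b := by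
    intro x t h
    have := hsupp (subset_tsupport φ h)
    exact ⟨this.1, this.2⟩
  obtain ⟨M, hM⟩ : ∃ M, ∀ q, ‖φ q‖ ≤ M := hφc.bounded_above_of_compact_support hcs
  have hA := far_integrable S hδ ha hb (T := fun x t => φ (x, t)) hφc (fun x t => hM (x, t)) hz
  have mDD := DD_meas hp S.ker.1 S.cont
  have cφ1 : Continuous (fun q : XX N => φ (q.2.1, q.1)) := by fun_prop
  have cφ2 : Continuous (fun q : XX N => φ (q.2.2, q.1)) := by fun_prop
  -- the near part
  set Fn : XX N → ℝ := fun q => (nearS N a b δ).indicator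
    (fun q => DD p K u q * (φ (q.2.1, q.1) - φ (q.2.2, q.1))) q with hFn
  set Af : XX N → ℝ := fun q => φ (q.2.1, q.1) * (farS N δ).indicator (DD p K u) q with hAf
  set R := (∫⁻ q in nearS N a b δ, eden p s u q) ^ ((p - 1) / p) *
        (∫⁻ q in nearS N a b δ, eden p s (fun x t => φ (x, t)) q) ^ (1 / p) with hR
  have hRtop : R ≠ ⊤ := by
    apply ENNReal.mul_ne_top
    · exact ENNReal.rpow_ne_top_of_nonneg (div_nonneg (by linarith) hp0.le)
        (energy_near S ha hb δ).ne
    · exact ENNReal.rpow_ne_top_of_nonneg (by positivity) hE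
  have hFnm : Measurable Fn :=
    (mDD.mul (cφ1.measurable.sub cφ2.measurable)).indicator (nearS_meas _ _ _ _)
  have hFnL : ∫⁻ q, ‖Fn q‖ₑ ≤ ENNReal.ofReal Lam * R := by
    have := near_est S (f := fun x t => φ (x, t)) hφc a b δ
    refine le_trans (le_of_eq ?_) this
    rw [← lintegral_indicator (nearS_meas _ _ _ _)]
    congr 1; ext q
    simp only [hFn, enorm_indicator_eq_indicator_enorm]
    congr 1
    ext q; rw [Real.enorm_eq_ofReal_abs]
  have hFni : Integrable Fn := ⟨hFnm.aestronglyMeasurable, lt_of_le_of_lt hFnL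
    (ENNReal.mul_lt_top ENNReal.ofReal_lt_top (lt_top_iff_ne_top.2 hRtop))⟩
  have hFnb : |∫ q, Fn q| ≤ Lam * R.toReal := by
    have h1 := enorm_integral_le_lintegral_enorm (μ := (volume : Measure (XX N))) Fn
    rw [Real.enorm_eq_ofReal_abs] at h1
    have h2 := h1.trans hFnL
    rw [← ENNReal.ofReal_toReal hRtop, ← ENNReal.ofReal_mul S.hLam.le] at h2
    exact (ENNReal.ofReal_le_ofReal_iff (mul_nonneg S.hLam.le ENNReal.toReal_nonneg)).1 h2
  -- the whole integrand
  set F : XX N → ℝ := fun q => Jp p (u q.2.1 q.1 - u q.2.2 q.1) *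
    (φ (q.2.1, q.1) - φ (q.2.2, q.1)) * K (q.2.1 - q.2.2) with hF
  have hFeq : ∀ q, F q = Fn q + (Af q + Af (swapX N q)) := by
    intro q
    have e1 : F q = DD p K u q * (φ (q.2.1, q.1) - φ (q.2.2, q.1)) := by
      simp only [hF, DD]; ring
    by_cases hq : δ ≤ ‖q.2.1 - q.2.2‖
    · have h1 : q ∉ nearS N a b δ := fun h => absurd h.2.2.2 (not_lt.2 hq)
      have h2 : q ∈ farS N δ := hq
      have h3 : swapX N q ∈ farS N δ := by
        rw [swapX_apply]; change δ ≤ ‖q.2.2 - q.2.1‖; rwa [norm_sub_rev]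
      simp only [hFn, hAf, indicator_of_notMem h1, indicator_of_mem h2, indicator_of_mem h3,
        DD_swap S.ker]
      rw [e1, swapX_apply]
      ring
    · have h2 : q ∉ farS N δ := hq
      have h3 : swapX N q ∉ farS N δ := by
        rw [swapX_apply]; change ¬ δ ≤ ‖q.2.2 - q.2.1‖; rwa [norm_sub_rev]
      simp only [hAf, indicator_of_notMem h2, indicator_of_notMem h3, mul_zero, add_zero]
      by_cases h1 : q ∈ nearS N a b δ
      · simp only [hFn, indicator_of_mem h1]; exact e1
      · simp only [hFn, indicator_of_notMem h1]
        rw [e1]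
        have hx : φ (q.2.1, q.1) = 0 := by
          by_contra h
          have := hz _ _ h
          apply h1
          have hx := mem_closedBall_zero_iff.1 this.1
          refine ⟨this.2, ?_, ?_, not_le.1 hq⟩
          · rw [mem_ball_zero_iff]; linarith
          · rw [mem_ball_zero_iff]
            have := norm_sub_norm_le q.2.2 q.2.1
            rw [norm_sub_rev] at this
            linarith [not_le.1 hq]
        have hy : φ (q.2.2, q.1) = 0 := by
          by_contra h
          have := hz _ _ h
          apply h1
          have hx := mem_closedBall_zero_iff.1 this.1
          refine ⟨this.2, ?_, ?_, not_le.1 hq⟩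
          · rw [mem_ball_zero_iff]
            have := norm_sub_norm_le q.2.1 q.2.2
            linarith [not_le.1 hq]
          · rw [mem_ball_zero_iff]; linarith
        rw [hx, hy]; simp
  have hFi : Integrable F := by
    have : F = fun q => Fn q + (Af q + Af (swapX N q)) := funext hFeq
    rw [this]
    exact hFni.add (hA.add (integrable_swapX hA))
  have hFint : ∫ q, F q = (∫ q, Fn q) + 2 * ∫ q, Af q := by
    simp_rw [hFeq]
    have hAA : Integrable (fun q => Af q + Af (swapX N q)) := hA.add (integrable_swapX hA)
    rw [integral_add hFni hAA, integral_add hA (integrable_swapX hA),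
      integral_swapX]
    ring
  have hFiter : ∫ t in Ioc (-2 : ℝ) 0, ∫ x, ∫ y,
        Jp p (u x t - u y t) * (φ (x, t) - φ (y, t)) * K (x - y) = ∫ q, F q := by
    rw [setIntegral_eq_integral_of_forall_compl_eq_zero]
    · rw [Measure.volume_eq_prod, integral_prod _ hFi]
      apply integral_congr_ae
      filter_upwards [hFi.prod_right_ae] with t ht
      rw [Measure.volume_eq_prod, integral_prod _ ht]
    · intro t ht
      have : ∀ x, φ (x, t) = 0 := by
        intro x
        by_contra h
        have := (hz x t h).2
        exact ht ⟨ha.trans_le this.1, this.2.trans hb.le⟩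
      simp [this]
  have hw := S.weak φ hφ hcs hsub2
  rw [hFiter, hFint] at hw
  -- time term
  have hdz : ∀ x t, (x, t) ∉ tsupport φ → deriv (fun τ => φ (x, τ)) t = 0 := by
    intro x t h
    have h1 : φ =ᶠ[𝓝 (x, t)] 0 := notMem_tsupport_iff_eventuallyEq.1 h
    have h2 : (fun τ => φ (x, τ)) =ᶠ[𝓝 t] fun _ => 0 := by
      have : Tendsto (fun τ : ℝ => (x, τ)) (𝓝 t) (𝓝 (x, t)) :=
        (by fun_prop : Continuous (fun τ : ℝ => (x, τ))).tendsto t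
      exact this.eventually h1
    rw [h2.deriv_eq]; simp
  have hdform : ∀ q : Euc N × ℝ, deriv (fun τ => φ (q.1, τ)) q.2 = fderiv ℝ φ q (0, 1) := by
    intro q
    have h1 : HasFDerivAt φ (fderiv ℝ φ q) (q.1, q.2) :=
      (hφ.differentiable (by simp) q).hasFDerivAt
    have h2 : HasDerivAt (fun τ : ℝ => (q.1, τ)) ((0 : Euc N), (1:ℝ)) q.2 :=
      (hasDerivAt_const _ _).prodMk (hasDerivAt_id _)
    exact (h1.comp_hasDerivAt q.2 h2).deriv
  have hdc : Continuous (fun q : Euc N × ℝ => u q.1 q.2 * deriv (fun τ => φ (q.1, τ)) q.2) := by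
    simp_rw [hdform]
    exact S.cont.mul ((hφ.continuous_fderiv (by simp)).clm_apply continuous_const)
  have hdi : Integrable (fun q : Euc N × ℝ => u q.1 q.2 * deriv (fun τ => φ (q.1, τ)) q.2) := by
    apply hdc.integrable_of_hasCompactSupport
    apply HasCompactSupport.of_support_subset_isCompact hcs
    intro q hq
    by_contra h
    exact hq (by simp only; rw [hdz q.1 q.2 h, mul_zero])
  have htime : ∫ t in Ioc (-2 : ℝ) 0, ∫ x in ball (0 : Euc N) 2,
        u x t * deriv (fun τ => φ (x, τ)) t =
      ∫ q : Euc N × ℝ, u q.1 q.2 * deriv (fun τ => φ (q.1, τ)) q.2 := by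
    rw [setIntegral_eq_integral_of_forall_compl_eq_zero]
    · rw [Measure.volume_eq_prod, integral_prod_symm _ hdi]
      congr 1; ext t
      rw [setIntegral_eq_integral_of_forall_compl_eq_zero]
      intro x hx
      rw [hdz x t (fun h => hx (hsub2 h).1), mul_zero]
    · intro t ht
      have : ∀ x, deriv (fun τ => φ (x, τ)) t = 0 := by
        intro x
        refine hdz x t (fun h => ht ?_)
        have := (hsub2 h).2
        exact ⟨this.1, this.2.le⟩
      simp [this]
  rw [htime] at hw
  have e : -(∫ q : Euc N × ℝ, u q.1 q.2 * deriv (fun τ => φ (q.1, τ)) q.2) +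
      ∫ q : XX N, Af q = -(1/2) * ∫ q, Fn q := by linarith
  rw [e, abs_mul]
  have := abs_nonneg (∫ q, Fn q)
  norm_num
  linarith

end Part4

section Part5
open scoped Convolution

variable {N : ℕ} {p s : ℝ}

instance instHaarE (N : ℕ) : (volume : Measure (Euc N × ℝ)).IsAddHaarMeasure :=
  inferInstanceAs ((volume : Measure (Euc N)).prod (volume : Measure ℝ)).IsAddHaarMeasure

instance instHaarEE (N : ℕ) : (volume : Measure (Euc N × Euc N)).IsAddHaarMeasure :=
  inferInstanceAs ((volume : Measure (Euc N)).prod (volume : Measure (Euc N))).IsAddHaarMeasure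

instance instHaarXX (N : ℕ) : (volume : Measure (XX N)).IsAddHaarMeasure := by
  exact @Measure.prod.instIsAddHaarMeasure ℝ _ _ _ (Euc N × Euc N) _ _ _ volume volume _ _ _ _ _ _

/-- mollification of `g` by `ρ`. -/
def mol {N : ℕ} (ρ : Euc N × ℝ → ℝ) (g : Euc N × ℝ → ℝ) (q : Euc N × ℝ) : ℝ :=
  ∫ w, g w * ρ (q - w)

/-- An even mollifier at scale `ε`. -/
structure IsMol {N : ℕ} (ε : ℝ) (ρ : Euc N × ℝ → ℝ) : Prop where
  smooth : ContDiff ℝ (⊤ : ℕ∞) ρ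
  nonneg : ∀ q, 0 ≤ ρ q
  supp : Function.support ρ ⊆ ball 0 ε
  cs : HasCompactSupport ρ
  int1 : ∫ q, ρ q = 1
  even : ∀ q, ρ (-q) = ρ q

lemma exists_mol (N : ℕ) {ε : ℝ} (hε : 0 < ε) : ∃ ρ : Euc N × ℝ → ℝ, IsMol ε ρ := by
  let ζ : ContDiffBump (0 : Euc N × ℝ) := ⟨ε / 2, ε, by linarith, by linarith⟩
  refine ⟨ζ.normed volume, ζ.contDiff_normed, ζ.nonneg_normed, ?_, ζ.hasCompactSupport_normed,
    ζ.integral_normed, ζ.normed_neg⟩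
  rw [ζ.support_normed_eq]

variable {ε : ℝ} {ρ : Euc N × ℝ → ℝ}

lemma mol_eq_conv (g : Euc N × ℝ → ℝ) :
    mol ρ g = g ⋆[ContinuousLinearMap.mul ℝ ℝ, volume] ρ := rfl

lemma mol_eq (g : Euc N × ℝ → ℝ) (q : Euc N × ℝ) : mol ρ g q = ∫ w, g (q - w) * ρ w := by
  unfold mol
  rw [← integral_sub_left_eq_self (fun w => g w * ρ (q - w)) _ q]
  simp

lemma mol_smooth (h : IsMol ε ρ) {g : Euc N × ℝ → ℝ} (hg : Continuous g) :
    ContDiff ℝ (⊤ : ℕ∞) (mol ρ g) := by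
  rw [mol_eq_conv]
  exact h.cs.contDiff_convolution_right _ hg.locallyIntegrable h.smooth

/-- time derivative of the mollifier -/
def rt {N : ℕ} (ρ : Euc N × ℝ → ℝ) (q : Euc N × ℝ) : ℝ := fderiv ℝ ρ q (0, 1)

lemma rt_cont (h : IsMol ε ρ) : Continuous (rt ρ) :=
  (h.smooth.continuous_fderiv (by simp)).clm_apply continuous_const

lemma rt_cs (h : IsMol ε ρ) : HasCompactSupport (rt ρ) := by
  have := h.cs.fderiv (𝕜 := ℝ)
  exact this.comp_left (g := fun L : (Euc N × ℝ) →L[ℝ] ℝ => L (0, 1)) (by simp)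

lemma rt_neg (h : IsMol ε ρ) (q : Euc N × ℝ) : rt ρ (-q) = -rt ρ q := by
  have h1 : HasFDerivAt ρ (fderiv ℝ ρ (-q)) (-q) :=
    (h.smooth.differentiable (by simp) (-q)).hasFDerivAt
  have h2 : HasFDerivAt (fun w : Euc N × ℝ => -w) (-ContinuousLinearMap.id ℝ (Euc N × ℝ)) q :=
    (hasFDerivAt_id q).neg
  have h3 := h1.comp q h2
  have h4 : ρ ∘ (fun w : Euc N × ℝ => -w) = ρ := funext h.even
  rw [h4] at h3
  unfold rt
  rw [h3.fderiv]
  simp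

lemma mol_deriv (h : IsMol ε ρ) {g : Euc N × ℝ → ℝ} (hg : Continuous g) (x : Euc N) (t : ℝ) :
    HasDerivAt (fun τ => mol ρ g (x, τ)) (∫ w, g w * rt ρ ((x, t) - w)) t := by
  have h1 := h.cs.hasFDerivAt_convolution_right (ContinuousLinearMap.mul ℝ ℝ)
    hg.locallyIntegrable (μ := volume) (h.smooth.of_le (by simp)) (x, t)
  have h2 : HasDerivAt (fun τ : ℝ => (x, τ)) ((0 : Euc N), (1:ℝ)) t :=
    (hasDerivAt_const _ _).prodMk (hasDerivAt_id _)
  have h3 := h1.comp_hasDerivAt t h2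
  rw [convolution_precompR_apply (ContinuousLinearMap.mul ℝ ℝ) hg.locallyIntegrable
    (h.cs.fderiv (𝕜 := ℝ)) (h.smooth.continuous_fderiv (by simp))] at h3
  exact h3

lemma mol_adjoint (h : IsMol ε ρ) {g T : Euc N × ℝ → ℝ} (hg : Continuous g) (hT : Continuous T)
    (hTc : HasCompactSupport T) :
    ∫ q, g q * deriv (fun τ => mol ρ T (q.1, τ)) q.2 =
      -∫ q, T q * deriv (fun τ => mol ρ g (q.1, τ)) q.2 := by
  have e1 : ∀ q : Euc N × ℝ, g q * deriv (fun τ => mol ρ T (q.1, τ)) q.2 =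
      ∫ w, g q * (T w * rt ρ (q - w)) := by
    intro q
    rw [(mol_deriv h hT q.1 q.2).deriv, integral_const_mul]
  have e2 : ∀ w : Euc N × ℝ, T w * deriv (fun τ => mol ρ g (w.1, τ)) w.2 =
      ∫ q, T w * (g q * rt ρ (w - q)) := by
    intro q
    rw [(mol_deriv h hg q.1 q.2).deriv, integral_const_mul]
  simp_rw [e1, e2]
  have c1 : Continuous (Function.uncurry fun q w : Euc N × ℝ => g q * (T w * rt ρ (q - w))) := by
    have := rt_cont h
    simp only [Function.uncurry_def]
    fun_prop
  rw [integral_integral_swap_of_hasCompactSupport c1]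
  · rw [← integral_neg]
    congr 1; ext w
    rw [← integral_neg]
    congr 1; ext q
    rw [← neg_sub w q, rt_neg h]; ring
  · have hc := (hTc.isCompact.add (rt_cs h).isCompact).prod hTc.isCompact
    apply HasCompactSupport.of_support_subset_isCompact hc
    rintro ⟨q, w⟩ hq
    simp only [Function.mem_support, Function.uncurry_apply_pair] at hq
    have hTw : T w ≠ 0 := fun h0 => hq (by rw [h0]; ring)
    have hr : rt ρ (q - w) ≠ 0 := fun h0 => hq (by rw [h0]; ring)
    refine ⟨?_, subset_tsupport _ hTw⟩
    have : q = w + (q - w) := by abel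
    rw [this]
    exact add_mem_add (subset_tsupport _ hTw) (subset_tsupport _ hr)

lemma mol_int (h : IsMol ε ρ) {g : Euc N × ℝ → ℝ} (hg : Continuous g) (q : Euc N × ℝ) :
    Integrable (fun w => g (q - w) * ρ w) := by
  apply Continuous.integrable_of_hasCompactSupport
  · have := h.smooth.continuous
    fun_prop
  · exact h.cs.mul_left

lemma mol_approx (h : IsMol ε ρ) {g : Euc N × ℝ → ℝ} (hg : Continuous g) {q : Euc N × ℝ}
    {η : ℝ} (hη : ∀ q', dist q' q < ε → |g q' - g q| ≤ η) : |mol ρ g q - g q| ≤ η := by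
  have hρi : Integrable ρ := h.smooth.continuous.integrable_of_hasCompactSupport h.cs
  have e : mol ρ g q - g q = ∫ w, (g (q - w) - g q) * ρ w := by
    simp_rw [sub_mul]
    rw [mol_eq, integral_sub (mol_int h hg q) (hρi.const_mul _), integral_const_mul, h.int1,
      mul_one]
  rw [e]
  calc |∫ w, (g (q - w) - g q) * ρ w| ≤ ∫ w, η * ρ w := by
        rw [← Real.norm_eq_abs]
        apply norm_integral_le_of_norm_le (hρi.const_mul _)
        filter_upwards with w
        by_cases hw : ρ w = 0
        · simp [hw]
        · rw [norm_mul, Real.norm_eq_abs, Real.norm_eq_abs, abs_of_nonneg (h.nonneg w)]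
          have hw' := h.supp hw
          have := h.nonneg w
          gcongr
          apply hη
          rw [dist_eq_norm]
          simpa using hw'
    _ = η := by rw [integral_const_mul, h.int1, mul_one]

lemma mol_zero (h : IsMol ε ρ) {g : Euc N × ℝ → ℝ} {q : Euc N × ℝ}
    (hη : ∀ q', dist q' q < ε → g q' = 0) : mol ρ g q = 0 := by
  rw [mol_eq]
  have : ∀ w, g (q - w) * ρ w = 0 := by
    intro w
    by_cases hw : ρ w = 0
    · simp [hw]
    · rw [hη, zero_mul]
      rw [dist_eq_norm]
      simpa using h.supp hw
  simp [this]

/-- diagonal shift -/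
def shiftX {N : ℕ} (w : Euc N × ℝ) : XX N := (w.2, w.1, w.1)

lemma eden_mol_le (hp : 1 < p) (h : IsMol ε ρ) {g : Euc N × ℝ → ℝ} (hg : Continuous g) (q : XX N) :
    eden p s (fun x t => mol ρ g (x, t)) q ≤
      ∫⁻ w, ENNReal.ofReal (ρ w) * eden p s (fun x t => g (x, t)) (q - shiftX w) := by
  have hp0 : 0 < p := by linarith
  set n : ℝ := (N : ℝ) + s * p with hn
  set k := ‖q.2.1 - q.2.2‖ ^ (-n) with hk
  have hk0 : 0 ≤ k := by positivity
  have hρc := h.smooth.continuous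
  set H : Euc N × ℝ → ℝ := fun w => g ((q.2.1, q.1) - w) - g ((q.2.2, q.1) - w) with hH
  have hHc : Continuous H := by simp only [hH]; fun_prop
  have e1 : mol ρ g (q.2.1, q.1) - mol ρ g (q.2.2, q.1) = ∫ w, H w * ρ w := by
    rw [mol_eq, mol_eq, ← integral_sub (mol_int h hg _) (mol_int h hg _)]
    congr 1; ext w; simp only [hH]; ring
  have hρi : Integrable ρ := h.smooth.continuous.integrable_of_hasCompactSupport h.cs
  have hone : ∫⁻ w, ENNReal.ofReal (ρ w) = 1 := by
    rw [← ofReal_integral_eq_lintegral_ofReal hρi (Eventually.of_forall h.nonneg), h.int1]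
    simp
  have hpq : p.HolderConjugate (p / (p - 1)) := by
    have := (Real.HolderConjugate.conjExponent hp)
    simpa [Real.conjExponent] using this
  set ν := (volume : Measure (Euc N × ℝ)).withDensity (fun w => ENNReal.ofReal (ρ w)) with hν
  have mρ : Measurable (fun w => ENNReal.ofReal (ρ w)) := by fun_prop
  have mH : Measurable (fun w => ENNReal.ofReal |H w|) := by fun_prop
  have e2 : ENNReal.ofReal |∫ w, H w * ρ w| ≤ ∫⁻ w, ENNReal.ofReal |H w| ∂ν := by
    rw [hν, lintegral_withDensity_eq_lintegral_mul _ mρ mH]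
    have := enorm_integral_le_lintegral_enorm (μ := volume) (fun w => H w * ρ w)
    rw [Real.enorm_eq_ofReal_abs] at this
    refine this.trans (le_of_eq ?_)
    congr 1; ext w
    rw [Real.enorm_eq_ofReal_abs, abs_mul, abs_of_nonneg (h.nonneg w), Pi.mul_apply, mul_comm,
      ENNReal.ofReal_mul (h.nonneg w)]
  have e3 : (∫⁻ w, ENNReal.ofReal |H w| ∂ν) ≤ (∫⁻ w, ENNReal.ofReal |H w| ^ p ∂ν) ^ (1 / p) := by
    have := ENNReal.lintegral_mul_le_Lp_mul_Lq ν hpq mH.aemeasurable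
      (measurable_const (a := (1:ℝ≥0∞))).aemeasurable
    simp only [Pi.mul_apply, mul_one, ENNReal.one_rpow, lintegral_const] at this
    refine this.trans (le_of_eq ?_)
    have : ν univ = 1 := by rw [hν, withDensity_apply _ MeasurableSet.univ]; simpa using hone
    rw [this]; simp
  have e4 : ENNReal.ofReal |∫ w, H w * ρ w| ^ p ≤ ∫⁻ w, ENNReal.ofReal |H w| ^ p ∂ν := by
    have := ENNReal.rpow_le_rpow (e2.trans e3) hp0.le
    rwa [← ENNReal.rpow_mul, one_div_mul_cancel hp0.ne', ENNReal.rpow_one] at this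
  have e5 : eden p s (fun x t => mol ρ g (x, t)) q
      = ENNReal.ofReal |∫ w, H w * ρ w| ^ p * ENNReal.ofReal k := by
    unfold eden
    simp only
    rw [e1, ENNReal.ofReal_mul (by positivity), ENNReal.ofReal_rpow_of_nonneg (abs_nonneg _) hp0.le]
  rw [e5]
  calc _ ≤ (∫⁻ w, ENNReal.ofReal |H w| ^ p ∂ν) * ENNReal.ofReal k := by gcongr
    _ = _ := by
      rw [hν, lintegral_withDensity_eq_lintegral_mul _ mρ (mH.pow_const p),
        ← lintegral_mul_const _ (mρ.mul (mH.pow_const p))]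
      congr 1; ext w
      rw [Pi.mul_apply, mul_assoc]
      congr 1
      unfold eden shiftX
      simp only [Prod.fst_sub, Prod.snd_sub, sub_sub_sub_cancel_right]
      rw [ENNReal.ofReal_mul (by positivity), ENNReal.ofReal_rpow_of_nonneg (abs_nonneg _) hp0.le]
      rfl

lemma energy_mol_le (hp : 1 < p) (h : IsMol ε ρ) {g : Euc N × ℝ → ℝ} (hg : Continuous g)
    {A B : Set (XX N)} (hA : MeasurableSet A) (hB : MeasurableSet B)
    (hAB : ∀ q ∈ A, ∀ w ∈ ball (0 : Euc N × ℝ) ε, q - shiftX w ∈ B) :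
    ∫⁻ q in A, eden p s (fun x t => mol ρ g (x, t)) q ≤
      ∫⁻ q in B, eden p s (fun x t => g (x, t)) q := by
  have hρc := h.smooth.continuous
  have hρi : Integrable ρ := h.smooth.continuous.integrable_of_hasCompactSupport h.cs
  have hone : ∫⁻ w, ENNReal.ofReal (ρ w) = 1 := by
    rw [← ofReal_integral_eq_lintegral_ofReal hρi (Eventually.of_forall h.nonneg), h.int1]
    simp
  have mg := eden_meas (p := p) (s := s) (f := fun x t => g (x, t)) (by fun_prop)
  have mB : Measurable (B.indicator (eden p s (fun x t => g (x, t)))) := mg.indicator hB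
  have mS : Measurable (shiftX (N := N)) := by unfold shiftX; fun_prop
  calc _ ≤ ∫⁻ q in A, ∫⁻ w, ENNReal.ofReal (ρ w) *
          eden p s (fun x t => g (x, t)) (q - shiftX w) :=
        lintegral_mono fun q => eden_mol_le hp h hg q
    _ ≤ ∫⁻ q, ∫⁻ w, ENNReal.ofReal (ρ w) *
          B.indicator (eden p s (fun x t => g (x, t))) (q - shiftX w) := by
        rw [← lintegral_indicator hA]
        apply lintegral_mono
        intro q
        apply indicator_le
        intro q hq
        apply lintegral_mono
        intro w
        by_cases hw : ρ w = 0
        · simp [hw]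
        · simp only
          rw [indicator_of_mem (hAB q hq w (h.supp hw))]
    _ = ∫⁻ w, ∫⁻ q, ENNReal.ofReal (ρ w) *
          B.indicator (eden p s (fun x t => g (x, t))) (q - shiftX w) := by
        apply lintegral_lintegral_swap
        apply Measurable.aemeasurable
        simp only [Function.uncurry_def]
        apply Measurable.mul
        · fun_prop
        · exact mB.comp (measurable_fst.sub (mS.comp measurable_snd))
    _ = ∫⁻ w, ENNReal.ofReal (ρ w) * ∫⁻ q in B, eden p s (fun x t => g (x, t)) q := by
        congr 1; ext w
        rw [lintegral_const_mul _ (show Measurable (fun q : XX N => B.indicator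
            (eden p s (fun x t => g (x, t))) (q - shiftX w)) from mB.comp (measurable_id.sub_const _)),
          lintegral_sub_right_eq_self (B.indicator (eden p s (fun x t => g (x, t)))) (shiftX w),
          lintegral_indicator hB]
    _ = _ := by
        rw [lintegral_mul_const _ (by fun_prop), hone, one_mul]

end Part5

section Part6

variable {N : ℕ} {p s lam Lam : ℝ} {K : Euc N → ℝ} {u : Euc N → ℝ → ℝ}

/-- localized positive part -/
def tr {N : ℕ} (qb : Euc N × ℝ) (R : ℝ) (v : Euc N × ℝ → ℝ) : Euc N × ℝ → ℝ :=
  (closedBall qb R).indicator (fun q => max (v q) 0)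

lemma tr_nonneg (qb : Euc N × ℝ) (R : ℝ) (v : Euc N × ℝ → ℝ) (q) : 0 ≤ tr qb R v q :=
  indicator_nonneg (fun _ _ => le_max_right _ _) _

lemma tr_zero {qb : Euc N × ℝ} {R R' : ℝ} {v : Euc N × ℝ → ℝ}
    (hv : ∀ q ∈ closedBall qb R, R' < dist q qb → v q ≤ 0) {q : Euc N × ℝ} (hq : R' < dist q qb) :
    tr qb R v q = 0 := by
  unfold tr
  by_cases h : q ∈ closedBall qb R
  · rw [indicator_of_mem h, max_eq_right (hv q h hq)]
  · rw [indicator_of_notMem h]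

lemma tr_mem {qb : Euc N × ℝ} {R R' : ℝ} {v : Euc N × ℝ → ℝ}
    (hv : ∀ q ∈ closedBall qb R, R' < dist q qb → v q ≤ 0) {q : Euc N × ℝ} (hq : tr qb R v q ≠ 0) :
    q ∈ closedBall qb R' := by
  by_contra h
  exact hq (tr_zero hv (by simpa using h))

lemma tr_cont {qb : Euc N × ℝ} {R R' : ℝ} {v : Euc N × ℝ → ℝ} (hR : R' < R)
    (hv : ∀ q ∈ closedBall qb R, R' < dist q qb → v q ≤ 0) (hc : Continuous v) :
    Continuous (tr qb R v) := by
  unfold tr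
  apply Continuous.indicator
  · intro q hq
    have h1 : q ∈ closedBall qb R := isClosed_closedBall.frontier_subset hq
    have h2 : dist q qb = R := frontier_closedBall_subset_sphere hq
    exact max_eq_right (hv q h1 (by rw [h2]; exact hR))
  · fun_prop

lemma tr_cs {qb : Euc N × ℝ} {R : ℝ} {v : Euc N × ℝ → ℝ} : HasCompactSupport (tr qb R v) :=
  HasCompactSupport.of_support_subset_isCompact (isCompact_closedBall qb R)
    (support_indicator_subset)

lemma hasDerivAt_sqpos (y : ℝ) : HasDerivAt (fun y : ℝ => (max y 0) ^ 2 / 2) (max y 0) y := by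
  rcases lt_trichotomy y 0 with h | h | h
  · rw [max_eq_right h.le]
    apply (hasDerivAt_const y (0:ℝ)).congr_of_eventuallyEq
    filter_upwards [gt_mem_nhds h] with z hz
    rw [max_eq_right hz.le]; norm_num
  · subst h
    rw [max_self, hasDerivAt_iff_isLittleO]
    simp only [max_self, sub_zero, smul_zero, ne_eq, OfNat.ofNat_ne_zero, not_false_eq_true, zero_pow, zero_div]
    have h1 : (fun z : ℝ => (max z 0) ^ 2 / 2) =O[𝓝 0] fun z : ℝ => z ^ 2 := by
      apply Asymptotics.IsBigO.of_bound 1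
      filter_upwards with z
      rw [Real.norm_eq_abs, Real.norm_eq_abs, abs_of_nonneg (by positivity),
        abs_of_nonneg (by positivity)]
      rcases max_cases z 0 with h | h
      · rw [h.1]; nlinarith [sq_nonneg z]
      · rw [h.1]; nlinarith [sq_nonneg z]
    refine h1.trans_isLittleO ?_
    have := Asymptotics.isLittleO_pow_id (𝕜 := ℝ) (n := 2) (by norm_num)
    simpa using this
  · rw [max_eq_left h.le]
    have h1 : HasDerivAt (fun z : ℝ => z ^ 2 / 2) y y := by
      have := (hasDerivAt_pow 2 y).div_const 2
      have e : ((2:ℕ):ℝ) * y ^ (2 - 1) / 2 = y := by norm_num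
      rw [e] at this
      exact this
    apply h1.congr_of_eventuallyEq
    filter_upwards [lt_mem_nhds h] with z hz
    rw [max_eq_left hz.le]

lemma ftc_zero {qb : Euc N × ℝ} {R R' : ℝ} {v vt : Euc N × ℝ → ℝ} (hR : R' < R)
    (hv : ∀ q ∈ closedBall qb R, R' < dist q qb → v q ≤ 0) (hc : Continuous v)
    (hct : Continuous vt)
    (hd : ∀ q ∈ closedBall qb R, HasDerivAt (fun τ => v (q.1, τ)) (vt q) q.2) :
    ∫ q, tr qb R v q * vt q = 0 := by
  have hT := tr_cont hR hv hc
  have hTc : HasCompactSupport (tr qb R v) := tr_cs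
  have hi : Integrable (fun q => tr qb R v q * vt q) :=
    (hT.mul hct).integrable_of_hasCompactSupport hTc.mul_right
  rw [Measure.volume_eq_prod, integral_prod _ hi]
  have key : ∀ x : Euc N, ∫ t : ℝ, tr qb R v (x, t) * vt (x, t) = 0 := by
    intro x
    have hTt : Continuous (fun t : ℝ => tr qb R v (x, t)) := by fun_prop
    have hTcx : HasCompactSupport (fun t : ℝ => tr qb R v (x, t)) := by
      apply HasCompactSupport.of_support_subset_isCompact (isCompact_closedBall qb.2 R)
      intro t ht
      have : (x, t) ∈ closedBall qb R := by
        by_contra h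
        exact ht (indicator_of_notMem h _)
      rw [← Prod.mk.eta (p := qb), ← closedBall_prod_same] at this
      exact this.2
    have hder : ∀ t : ℝ, HasDerivAt (fun t => (tr qb R v (x, t)) ^ 2 / 2)
        (tr qb R v (x, t) * vt (x, t)) t := by
      intro t
      by_cases h : dist (x, t) qb < R
      · have hm : (x, t) ∈ closedBall qb R := h.le
        have h1 := (hasDerivAt_sqpos (v (x, t))).comp t (hd (x, t) hm)
        have h2 : tr qb R v (x, t) = max (v (x, t)) 0 := indicator_of_mem hm _
        rw [h2]
        apply h1.congr_of_eventuallyEq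
        have : ∀ᶠ τ in 𝓝 t, dist (x, τ) qb < R := by
          have : Continuous (fun τ : ℝ => dist (x, τ) qb) := by fun_prop
          exact this.continuousAt.eventually (gt_mem_nhds h)
        filter_upwards [this] with τ hτ
        simp only [Function.comp]
        rw [show tr qb R v (x, τ) = max (v (x, τ)) 0 from indicator_of_mem (show _ ∈ closedBall qb R from hτ.le) _]
      · have h' : R' < dist (x, t) qb := by linarith [not_lt.1 h]
        rw [tr_zero hv h', zero_mul]
        apply (hasDerivAt_const t (0:ℝ)).congr_of_eventuallyEq
        have : ∀ᶠ τ in 𝓝 t, R' < dist (x, τ) qb := by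
          have : Continuous (fun τ : ℝ => dist (x, τ) qb) := by fun_prop
          exact this.continuousAt.eventually (lt_mem_nhds h')
        filter_upwards [this] with τ hτ
        rw [tr_zero hv hτ]; norm_num
    apply integral_eq_zero_of_hasDerivAt_of_integrable hder
    · apply Continuous.integrable_of_hasCompactSupport
      · fun_prop
      · exact hTcx.mul_right
    · apply Continuous.integrable_of_hasCompactSupport
      · fun_prop
      · have : (fun t => tr qb R v (x, t) ^ 2 / 2) =
          fun t => tr qb R v (x, t) * (tr qb R v (x, t) / 2) := by ext t; ring
        rw [this]; exact hTcx.mul_right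
  simp [key]

/-- pairs in the box -/
def WW {N : ℕ} (qb : Euc N × ℝ) (R δ : ℝ) : Set (XX N) :=
  {q | (q.2.1, q.1) ∈ closedBall qb R ∧ (q.2.2, q.1) ∈ closedBall qb R ∧ ‖q.2.1 - q.2.2‖ < δ}

lemma WW_meas (qb : Euc N × ℝ) (R δ : ℝ) : MeasurableSet (WW qb R δ) := by
  have h1 : MeasurableSet {q : XX N | (q.2.1, q.1) ∈ closedBall qb R} :=
    (show Measurable (fun q : XX N => (q.2.1, q.1)) by fun_prop) measurableSet_closedBall
  have h2 : MeasurableSet {q : XX N | (q.2.2, q.1) ∈ closedBall qb R} :=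
    (show Measurable (fun q : XX N => (q.2.2, q.1)) by fun_prop) measurableSet_closedBall
  have h4 : MeasurableSet {q : XX N | ‖q.2.1 - q.2.2‖ < δ} :=
    measurableSet_lt (by fun_prop) measurable_const
  exact h1.inter (h2.inter h4)

lemma dist_pair_sametime (x y : Euc N) (t : ℝ) : dist ((x, t) : Euc N × ℝ) (y, t) = ‖x - y‖ := by
  rw [Prod.dist_eq]; simp [dist_eq_norm]

lemma tr_pair {qb : Euc N × ℝ} {R R' δ : ℝ} {v : Euc N × ℝ → ℝ}
    (hv : ∀ q ∈ closedBall qb R, R' < dist q qb → v q ≤ 0) (hδ : δ ≤ R - R') (h0 : R' ≤ R) {q : XX N}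
    (hq : ‖q.2.1 - q.2.2‖ < δ) (hne : tr qb R v (q.2.1, q.1) ≠ 0 ∨ tr qb R v (q.2.2, q.1) ≠ 0) :
    q ∈ WW qb R δ := by
  have hd := dist_pair_sametime q.2.1 q.2.2 q.1
  rcases hne with h | h
  · have h1 := tr_mem hv h
    refine ⟨closedBall_subset_closedBall h0 h1, ?_, hq⟩
    rw [mem_closedBall] at *
    have := dist_triangle_left (q.2.2, q.1) qb (q.2.1, q.1)
    linarith
  · have h1 := tr_mem hv h
    refine ⟨?_, closedBall_subset_closedBall h0 h1, hq⟩
    rw [mem_closedBall] at *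
    have := dist_triangle (q.2.1, q.1) (q.2.2, q.1) qb
    linarith

lemma eden_tr_le (hp : 1 < p) {qb : Euc N × ℝ} {R R' δ c : ℝ} {w ψ : Euc N × ℝ → ℝ}
    (hv : ∀ q ∈ closedBall qb R, R' < dist q qb → w q - ψ q - c ≤ 0) (hδ : δ ≤ R - R') (h0 : R' ≤ R)
    {q : XX N} (hq : ‖q.2.1 - q.2.2‖ < δ) :
    eden p s (fun x t => tr qb R (fun q => w q - ψ q - c) (x, t)) q ≤
      (WW qb R δ).indicator (fun q => ENNReal.ofReal (2 ^ p) * (eden p s (fun x t => w (x, t)) q +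
        eden p s (fun x t => ψ (x, t)) q)) q := by
  have hp0 : 0 < p := by linarith
  by_cases hW : q ∈ WW qb R δ
  · rw [indicator_of_mem hW]
    unfold eden
    rw [← ENNReal.ofReal_add (by positivity) (by positivity), ← ENNReal.ofReal_mul (by positivity)]
    apply ENNReal.ofReal_le_ofReal
    rw [← add_mul, ← mul_assoc]
    apply mul_le_mul_of_nonneg_right _ (by positivity)
    simp only [tr]
    rw [indicator_of_mem hW.1, indicator_of_mem hW.2.1]
    set a := |w (q.2.1, q.1) - w (q.2.2, q.1)|
    set b := |ψ (q.2.1, q.1) - ψ (q.2.2, q.1)|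
    have ha : 0 ≤ a := abs_nonneg _
    have hb : 0 ≤ b := abs_nonneg _
    have h1 := abs_max_sub_max_le_abs (w (q.2.1, q.1) - ψ (q.2.1, q.1) - c) (w (q.2.2, q.1) - ψ (q.2.2, q.1) - c) 0
    have h2 : |w (q.2.1, q.1) - ψ (q.2.1, q.1) - c - (w (q.2.2, q.1) - ψ (q.2.2, q.1) - c)| ≤ a + b := by
      have : w (q.2.1, q.1) - ψ (q.2.1, q.1) - c - (w (q.2.2, q.1) - ψ (q.2.2, q.1) - c) =
        (w (q.2.1, q.1) - w (q.2.2, q.1)) - (ψ (q.2.1, q.1) - ψ (q.2.2, q.1)) := by ring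
      rw [this]; exact abs_sub _ _
    calc _ ≤ (2 * max a b) ^ p := by
          apply Real.rpow_le_rpow (abs_nonneg _) _ hp0.le
          linarith [le_max_left a b, le_max_right a b]
      _ = 2 ^ p * (max a b) ^ p := Real.mul_rpow (by norm_num) (le_max_of_le_left ha)
      _ ≤ _ := by
          apply mul_le_mul_of_nonneg_left _ (by positivity)
          have := Real.rpow_nonneg ha p
          have := Real.rpow_nonneg hb p
          rcases max_cases a b with h | h <;> rw [h.1] <;> linarith
  · have : ¬ (tr qb R (fun q => w q - ψ q - c) (q.2.1, q.1) ≠ 0 ∨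
      tr qb R (fun q => w q - ψ q - c) (q.2.2, q.1) ≠ 0) := fun h => hW (tr_pair hv hδ h0 hq h)
    push Not at this
    unfold eden
    simp only [this.1, this.2]
    simp [Real.zero_rpow hp0.ne']

lemma eden_lip (hN : 1 ≤ N) (hp : 1 < p) (hs : s ∈ Ioo (0:ℝ) 1) {qb : Euc N × ℝ} {R δ Lip : ℝ} {ψ : Euc N × ℝ → ℝ} (hδ : 0 < δ)
    (hLip : ∀ x y t, (x, t) ∈ closedBall qb R → (y, t) ∈ closedBall qb R →
      |ψ (x, t) - ψ (y, t)| ≤ Lip * ‖x - y‖) :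
    ∫⁻ q in WW qb R δ, eden p s (fun x t => ψ (x, t)) q < ⊤ := by
  have hp0 : 0 < p := by linarith
  have hγ : 0 < p - s * p := by nlinarith [hs.2]
  obtain ⟨C, hC, hI⟩ := I2 (N := N) (β := 0) hN (by norm_num) hγ
  have hI := hI (EuclideanSpace.single ⟨0, hN⟩ 1) (by simp) δ hδ
  simp only [neg_zero, Real.rpow_zero, one_mul] at hI
  set g : Euc N → ℝ≥0∞ := (ball (0 : Euc N) δ).indicator
    (fun z => ENNReal.ofReal (‖z‖ ^ (p - s * p - (N:ℝ)))) with hg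
  have mg : Measurable g := Measurable.indicator (by fun_prop) measurableSet_ball
  have hpt : ∀ q ∈ WW qb R δ, eden p s (fun x t => ψ (x, t)) q ≤
      ENNReal.ofReal (|Lip| ^ p) * g (q.2.1 - q.2.2) := by
    intro q hq
    rw [hg, indicator_of_mem (show q.2.1 - q.2.2 ∈ ball 0 δ by simpa using hq.2.2),
      ← ENNReal.ofReal_mul (by positivity)]
    unfold eden
    apply ENNReal.ofReal_le_ofReal
    have h := hLip _ _ _ hq.1 hq.2.1
    by_cases hz : q.2.1 - q.2.2 = 0
    · simp only [sub_eq_zero.1 hz]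
      simp only [sub_self, abs_zero, Real.zero_rpow hp0.ne', zero_mul]
      positivity
    · have hz' : 0 < ‖q.2.1 - q.2.2‖ := norm_pos_iff.2 hz
      calc _ ≤ (|Lip| * ‖q.2.1 - q.2.2‖) ^ p * ‖q.2.1 - q.2.2‖ ^ (-((N : ℝ) + s * p)) := by
            gcongr
            exact h.trans (by gcongr; exact le_abs_self _)
        _ = _ := by
            rw [Real.mul_rpow (abs_nonneg _) hz'.le, mul_assoc, ← Real.rpow_add hz']
            congr 2; ring
  calc _ ≤ ∫⁻ q in WW qb R δ, ENNReal.ofReal (|Lip| ^ p) * g (q.2.1 - q.2.2) :=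
        setLIntegral_mono (by fun_prop) hpt
    _ ≤ ∫⁻ q in closedBall qb.2 R ×ˢ (closedBall qb.1 R ×ˢ (univ : Set (Euc N))),
          ENNReal.ofReal (|Lip| ^ p) * g (q.2.1 - q.2.2) := by
        apply lintegral_mono_set
        intro q hq
        have := hq.1
        rw [← Prod.mk.eta (p := qb), ← closedBall_prod_same] at this
        exact ⟨this.2, this.1, mem_univ _⟩
    _ = ∫⁻ t in closedBall qb.2 R, ∫⁻ x in closedBall qb.1 R, ∫⁻ y : Euc N,
          ENNReal.ofReal (|Lip| ^ p) * g (x - y) := by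
        have m3 : Measurable (fun q : XX N => ENNReal.ofReal (|Lip| ^ p) * g (q.2.1 - q.2.2)) := by
          fun_prop
        rw [Measure.volume_eq_prod, setLIntegral_prod _ m3.aemeasurable]
        congr 1; ext t
        have m4 : Measurable (fun q : Euc N × Euc N => ENNReal.ofReal (|Lip| ^ p) * g (q.1 - q.2)) := by
          fun_prop
        rw [Measure.volume_eq_prod, setLIntegral_prod _ m4.aemeasurable]
        simp
    _ ≤ ∫⁻ t in closedBall qb.2 R, ∫⁻ x in closedBall qb.1 R,
          ENNReal.ofReal (|Lip| ^ p) * ENNReal.ofReal (C * δ ^ (p - s * p)) := by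
        gcongr with t x
        rw [lintegral_const_mul _ (by fun_prop), lintegral_sub_left_eq_self g x]
        gcongr
        rw [hg, lintegral_indicator measurableSet_ball]
        exact hI
    _ < ⊤ := by
        simp only [lintegral_const]
        have h1 : volume (closedBall qb.2 R) < ⊤ := measure_closedBall_lt_top
        have h2 : volume (closedBall qb.1 R) < ⊤ := measure_closedBall_lt_top
        have := ENNReal.mul_lt_top (ENNReal.mul_lt_top (ENNReal.mul_lt_top (ENNReal.ofReal_lt_top (r := |Lip| ^ p)) (ENNReal.ofReal_lt_top (r := C * δ ^ (p - s * p)))) h2) h1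
        simpa using this

end Part6

section Part7

variable {N : ℕ} {p s lam Lam : ℝ} {K : Euc N → ℝ} {u : Euc N → ℝ → ℝ}

lemma tr_close {qb : Euc N × ℝ} {R η : ℝ} {v w : Euc N × ℝ → ℝ} (hη : 0 ≤ η)
    (h : ∀ q ∈ closedBall qb R, |v q - w q| ≤ η) (q) : |tr qb R v q - tr qb R w q| ≤ η := by
  unfold tr
  by_cases hq : q ∈ closedBall qb R
  · rw [indicator_of_mem hq, indicator_of_mem hq]
    exact (abs_max_sub_max_le_abs _ _ _).trans (h q hq)
  · rw [indicator_of_notMem hq, indicator_of_notMem hq]; simpa using hη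

lemma mol_deriv_cont {ε : ℝ} {ρ : Euc N × ℝ → ℝ} (h : IsMol ε ρ) {g : Euc N × ℝ → ℝ}
    (hg : Continuous g) : Continuous (fun q : Euc N × ℝ => deriv (fun τ => mol ρ g (q.1, τ)) q.2) := by
  have hs := mol_smooth h hg
  have e : (fun q : Euc N × ℝ => deriv (fun τ => mol ρ g (q.1, τ)) q.2) =
      fun q => fderiv ℝ (mol ρ g) q (0, 1) := by
    ext q
    have h1 : HasFDerivAt (mol ρ g) (fderiv ℝ (mol ρ g) q) q :=
      (hs.differentiable (by simp) q).hasFDerivAt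
    have h2 : HasDerivAt (fun τ : ℝ => (q.1, τ)) ((0 : Euc N), (1:ℝ)) q.2 :=
      (hasDerivAt_const _ _).prodMk (hasDerivAt_id _)
    exact (HasFDerivAt.comp_hasDerivAt (l := mol ρ g) (f := fun τ : ℝ => (q.1, τ)) q.2 h1 h2).deriv
  rw [e]
  exact (hs.continuous_fderiv (by simp)).clm_apply continuous_const

/-- One mollification step. -/
lemma V1_eps (S : Sol N p s lam Lam K u) {qb : Euc N × ℝ} {R R' c κ d δ η : ℝ}
    {ψ ψt : Euc N × ℝ → ℝ} (hR : R' < R) (hR0 : 0 < R) (hd : 0 < d) (h1 : ‖qb.1‖ + R + d ≤ 7/4)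
    (h2 : -2 < qb.2 - R - d) (h3 : qb.2 + R + d < 0) (hψ : Continuous ψ) (hψt : Continuous ψt)
    (hder : ∀ q ∈ closedBall qb R, HasDerivAt (fun τ => ψ (q.1, τ)) (ψt q) q.2)
    (hκ : 0 < κ)
    (hv : ∀ q ∈ closedBall qb R, R' < dist q qb → u q.1 q.2 - ψ q - c ≤ -κ)
    (hδ0 : 0 < δ) (hδ8 : δ ≤ 1/8) (hδR : δ ≤ R - R') (hη : 0 < η)
    (hfin : ∫⁻ q in WW qb R (1/8), eden p s (fun x t => ψ (x, t)) q < ⊤) :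
    |(∫ q, tr qb R (fun q => u q.1 q.2 - ψ q - c) q * ψt q) +
      ∫ q : XX N, tr qb R (fun q => u q.1 q.2 - ψ q - c) (q.2.1, q.1) *
        (farS N δ).indicator (DD p K u) q| ≤ η +
      Lam * ((∫⁻ q in nearS N (qb.2 - R - d) (qb.2 + R + d) δ, eden p s u q) ^ ((p - 1) / p) *
        (ENNReal.ofReal (2 ^ p) * ((∫⁻ q in nearS N (qb.2 - R - d) (qb.2 + R + d) (1/8), eden p s u q) +
          ∫⁻ q in WW qb R (1/8), eden p s (fun x t => ψ (x, t)) q)) ^ (1 / p)).toReal := by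
  have hp := S.hp
  have hp0 : 0 < p := by linarith
  set a := qb.2 - R - d with ha
  set b := qb.2 + R + d with hb
  set U : Euc N × ℝ → ℝ := fun q => u q.1 q.2 with hU
  have hUc : Continuous U := S.cont
  set T := tr qb R (fun q => u q.1 q.2 - ψ q - c) with hT
  have hv0 : ∀ q ∈ closedBall qb R, R' < dist q qb → u q.1 q.2 - ψ q - c ≤ 0 :=
    fun q hq hq' => (hv q hq hq').trans (by linarith)
  have hTc : Continuous T := tr_cont hR hv0 ((hUc.sub hψ).sub continuous_const)
  have hTcs : HasCompactSupport T := tr_cs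
  -- the comparison function
  set χ : Euc N × ℝ → ℝ := fun q => max 0 (R + d - dist q qb) with hχ
  have hχc : Continuous χ := by simp only [hχ]; fun_prop
  have hχi := far_integrable S hδ0 h2 h3 (T := fun x t => χ (x, t)) (M := R + d) hχc (by
      intro x t
      simp only [hχ]
      rw [abs_of_nonneg (le_max_left _ _)]
      exact max_le (by linarith) (by linarith [dist_nonneg (x := (x, t)) (y := qb)])) (by
      intro x t h
      have : dist (x, t) qb < R + d := by
        by_contra h'
        exact h (max_eq_left (by linarith))
      rw [Prod.dist_eq, max_lt_iff] at this
      simp only at this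
      constructor
      · rw [mem_closedBall_zero_iff]
        have := norm_le_norm_add_norm_sub' x qb.1
        rw [← dist_eq_norm] at this
        linarith
      · rw [Real.dist_eq, abs_lt] at this
        constructor <;> simp only [ha, hb] <;> linarith)
  set I1 := ∫ q : XX N, |χ (q.2.1, q.1) * (farS N δ).indicator (DD p K u) q| with hI1
  have hI10 : 0 ≤ I1 := integral_nonneg fun q => abs_nonneg _
  set I2 := ∫ q in closedBall qb R, |ψt q| with hI2
  have hI20 : 0 ≤ I2 := integral_nonneg fun q => abs_nonneg _
  have hI2i : IntegrableOn (fun q => |ψt q|) (closedBall qb R) :=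
    (by fun_prop : Continuous fun q => |ψt q|).continuousOn.integrableOn_compact (isCompact_closedBall _ _)
  -- choose closeness
  obtain ⟨θ, hθ, hθκ, hθη⟩ : ∃ θ > 0, θ ≤ κ ∧ (8 / d * I1 + I2) * θ ≤ η := by
    refine ⟨min κ (η / (8 / d * I1 + I2 + 1)), by positivity, min_le_left _ _, ?_⟩
    calc _ ≤ (8 / d * I1 + I2) * (η / (8 / d * I1 + I2 + 1)) := by
          gcongr; exact min_le_right _ _
      _ = η * ((8 / d * I1 + I2) / (8 / d * I1 + I2 + 1)) := by ring
      _ ≤ η * 1 := by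
          gcongr
          rw [div_le_one (by positivity)]; linarith
      _ = η := mul_one _
  -- uniform continuity
  have hUu : ∃ ε > 0, ∀ q ∈ closedBall qb R, ∀ q', dist q' q < ε → |U q' - U q| ≤ θ := by
    have hK : IsCompact (closedBall qb R) := isCompact_closedBall _ _
    have := hK.uniformContinuousAt_of_continuousAt U (fun q _ => hUc.continuousAt)
      (Metric.dist_mem_uniformity hθ)
    obtain ⟨ε, hε, h⟩ := Metric.mem_uniformity_dist.1 this
    refine ⟨ε, hε, fun q hq q' hqq => ?_⟩
    have := h (a := q) (b := q') (by rwa [dist_comm]) hq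
    simp only [mem_ofPred_eq] at this
    rw [← Real.dist_eq, dist_comm]; exact this.le
  obtain ⟨ε1, hε1, hUε⟩ := hUu
  have hTu : ∃ ε > 0, ∀ q q', dist q' q < ε → |T q' - T q| ≤ θ := by
    have := (hTc.uniformContinuous_of_tendsto_cocompact (x := 0) (hTcs.is_zero_at_infty))
    rw [Metric.uniformContinuous_iff] at this
    obtain ⟨ε, hε, h⟩ := this θ hθ
    exact ⟨ε, hε, fun q q' hqq => by rw [← Real.dist_eq]; exact (h hqq).le⟩
  obtain ⟨ε2, hε2, hTε⟩ := hTu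
  set ε := min (min ε1 ε2) (d / 2) with hε
  have hε0 : 0 < ε := by positivity
  obtain ⟨ρ, hρ⟩ := exists_mol N hε0
  set Uε := mol ρ U with hUεd
  have hUεc : Continuous Uε := (mol_smooth hρ hUc).continuous
  have hUcl : ∀ q ∈ closedBall qb R, |Uε q - U q| ≤ θ := fun q hq =>
    mol_approx hρ hUc fun q' hq' => hUε q hq q' (hq'.trans_le ((min_le_left _ _).trans (min_le_left _ _)))
  set Tε := tr qb R (fun q => Uε q - ψ q - c) with hTεd
  have hvε : ∀ q ∈ closedBall qb R, R' < dist q qb → Uε q - ψ q - c ≤ 0 := by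
    intro q hq hq'
    have := hv q hq hq'
    have := (abs_le.1 (hUcl q hq)).2
    simp only [hU] at this
    linarith
  have hTεc : Continuous Tε := tr_cont hR hvε (by fun_prop)
  have hTεcs : HasCompactSupport Tε := tr_cs
  have hTT : ∀ q, |Tε q - T q| ≤ θ := tr_close hθ.le (by
    intro q hq
    have := hUcl q hq
    simp only [hU] at this
    convert this using 2; ring)
  set φ := mol ρ Tε with hφ
  have hφs := mol_smooth hρ hTεc
  have hφT : ∀ q, |φ q - T q| ≤ 4 * θ := by
    intro q
    have h := mol_approx (q := q) (η := 3 * θ) hρ hTεc (fun q' hq' => by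
      have e1 := hTT q
      have e2 := hTT q'
      have e3 := hTε q q' (hq'.trans_le ((min_le_left _ _).trans (min_le_right _ _)))
      rw [abs_le] at *
      constructor <;> linarith)
    have e1 := hTT q
    rw [abs_le] at *
    constructor <;> linarith
  have hφz : ∀ q, R + d / 2 < dist q qb → φ q = 0 := by
    intro q hq
    apply mol_zero hρ
    intro q' hq'
    apply tr_zero hvε
    have := dist_triangle_left q qb q'
    have : ε ≤ d / 2 := min_le_right _ _
    linarith
  have hφsupp : tsupport φ ⊆ closedBall qb (R + d / 2) := by
    apply closure_minimal _ isClosed_closedBall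
    intro q hq
    by_contra h
    exact hq (hφz q (by simpa using h))
  have hφsupp2 : tsupport φ ⊆ closedBall (0 : Euc N) (7/4) ×ˢ Icc a b := by
    refine hφsupp.trans ?_
    intro q hq
    rw [← Prod.mk.eta (p := qb), ← closedBall_prod_same] at hq
    refine ⟨?_, ?_⟩
    · rw [mem_closedBall_zero_iff]
      have h4 := norm_le_norm_add_norm_sub' q.1 qb.1
      rw [← dist_eq_norm] at h4
      have := mem_closedBall.1 hq.1
      linarith
    · have := mem_closedBall.1 hq.2
      rw [Real.dist_eq, abs_le] at this
      constructor <;> simp only [ha, hb] <;> linarith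
  -- energy
  set Es := ENNReal.ofReal (2 ^ p) * ((∫⁻ q in nearS N a b (1/8), eden p s u q) +
          ∫⁻ q in WW qb R (1/8), eden p s (fun x t => ψ (x, t)) q) with hEs
  have hEsfin : Es ≠ ⊤ := by
    apply ENNReal.mul_ne_top ENNReal.ofReal_ne_top
    exact ENNReal.add_ne_top.2 ⟨(energy_near S h2 h3 _).ne, hfin.ne⟩
  have hE : ∫⁻ q in nearS N a b δ, eden p s (fun x t => φ (x, t)) q ≤ Es := by
    have mN : MeasurableSet {q : XX N | ‖q.2.1 - q.2.2‖ < δ} :=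
      measurableSet_lt (by fun_prop) measurable_const
    have mU := eden_meas (p := p) (s := s) (f := fun x t => Uε (x, t)) (by fun_prop)
    have mψ := eden_meas (p := p) (s := s) (f := fun x t => ψ (x, t)) (by fun_prop)
    calc _ ≤ ∫⁻ q in {q : XX N | ‖q.2.1 - q.2.2‖ < δ}, eden p s (fun x t => Tε (x, t)) q := by
          apply energy_mol_le hp hρ hTεc (nearS_meas _ _ _ _) mN
          intro q hq w _
          simp only [mem_ofPred_eq, shiftX, Prod.fst_sub, Prod.snd_sub, sub_sub_sub_cancel_right]
          exact hq.2.2.2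
      _ ≤ ∫⁻ q in {q : XX N | ‖q.2.1 - q.2.2‖ < δ}, (WW qb R δ).indicator (fun q =>
            ENNReal.ofReal (2 ^ p) * (eden p s (fun x t => Uε (x, t)) q +
            eden p s (fun x t => ψ (x, t)) q)) q := by
          apply setLIntegral_mono' mN
          intro q hq
          exact eden_tr_le hp hvε hδR hR.le hq
      _ ≤ ∫⁻ q, (WW qb R δ).indicator (fun q =>
            ENNReal.ofReal (2 ^ p) * (eden p s (fun x t => Uε (x, t)) q +
            eden p s (fun x t => ψ (x, t)) q)) q := setLIntegral_le_lintegral _ _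
      _ = ENNReal.ofReal (2 ^ p) * ((∫⁻ q in WW qb R δ, eden p s (fun x t => Uε (x, t)) q) +
            ∫⁻ q in WW qb R δ, eden p s (fun x t => ψ (x, t)) q) := by
          rw [lintegral_indicator (WW_meas _ _ _), lintegral_const_mul _ (show Measurable fun q =>
            eden p s (fun x t => Uε (x, t)) q + eden p s (fun x t => ψ (x, t)) q from mU.add mψ),
            lintegral_add_left mU]
      _ ≤ Es := by
          rw [hEs]
          refine mul_le_mul_right (add_le_add ?_ (lintegral_mono_set ?_)) _
          · have hsub := energy_mol_le (s := s) hp hρ hUc (WW_meas qb R δ) (nearS_meas N a b (1/8)) (by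
              intro q hq w hw
              have hw' : ‖w‖ < d / 2 := (mem_ball_zero_iff.1 hw).trans_le (min_le_right _ _)
              have hw1 : ‖w.1‖ < d / 2 := (norm_fst_le w).trans_lt hw'
              have hw2 : |w.2| < d / 2 := (norm_snd_le w).trans_lt hw'
              have g1 := hq.1
              have g2 := hq.2.1
              rw [← Prod.mk.eta (p := qb), ← closedBall_prod_same] at g1 g2
              have g1a := mem_closedBall.1 g1.1
              have g1b := mem_closedBall.1 g1.2
              have g2a := mem_closedBall.1 g2.1
              simp only at g1a g1b g2a
              rw [Real.dist_eq, abs_le] at g1b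
              rw [abs_lt] at hw2
              have k1 := norm_le_norm_add_norm_sub' q.2.1 qb.1
              have k2 := norm_le_norm_add_norm_sub' q.2.2 qb.1
              rw [← dist_eq_norm] at k1 k2
              have k3 := norm_sub_le q.2.1 w.1
              have k4 := norm_sub_le q.2.2 w.1
              simp only [nearS, shiftX, mem_ofPred_eq, Prod.fst_sub, Prod.snd_sub,
                sub_sub_sub_cancel_right, mem_ball_zero_iff]
              refine ⟨⟨?_, ?_⟩, ?_, ?_, hq.2.2.trans_le hδ8⟩
              · simp only [ha]; linarith
              · simp only [hb]; linarith
              · linarith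
              · linarith)
            exact hsub
          · exact fun q hq => ⟨hq.1, hq.2.1, hq.2.2.trans_le hδ8⟩
  have hW := weak_far S h2 h3 hδ0 hδ8 hφs hφsupp2 (ne_top_of_le_ne_top hEsfin hE)
  -- time term
  have htime : -(∫ q : Euc N × ℝ, u q.1 q.2 * deriv (fun τ => φ (q.1, τ)) q.2) = ∫ q, Tε q * ψt q := by
    have e1 := mol_adjoint hρ hUc hTεc hTεcs
    have hct := mol_deriv_cont hρ hUc
    have e2 := ftc_zero (v := fun q => Uε q - ψ q - c)
      (vt := fun q => deriv (fun τ => mol ρ U (q.1, τ)) q.2 - ψt q) hR hvε (by fun_prop) (hct.sub hψt)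
      (by
        intro q hq
        have := (mol_deriv hρ hUc q.1 q.2)
        rw [← this.deriv] at this
        exact (this.sub (hder q hq)).sub_const c)
    rw [show (fun q : Euc N × ℝ => u q.1 q.2 * deriv (fun τ => φ (q.1, τ)) q.2) =
      fun q => U q * deriv (fun τ => mol ρ Tε (q.1, τ)) q.2 from rfl, e1, neg_neg]
    simp_rw [mul_sub] at e2
    rw [integral_sub] at e2
    · exact sub_eq_zero.1 e2
    · exact (hTεc.mul hct).integrable_of_hasCompactSupport hTεcs.mul_right
    · exact (hTεc.mul hψt).integrable_of_hasCompactSupport hTεcs.mul_right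
  rw [htime] at hW
  -- differences
  have hdiff1 : |(∫ q, T q * ψt q) - ∫ q, Tε q * ψt q| ≤ θ * I2 := by
    have i1 : Integrable (fun q => T q * ψt q) :=
      (hTc.mul hψt).integrable_of_hasCompactSupport hTcs.mul_right
    have i2 : Integrable (fun q => Tε q * ψt q) :=
      (hTεc.mul hψt).integrable_of_hasCompactSupport hTεcs.mul_right
    rw [← integral_sub i1 i2]
    rw [hI2, ← integral_const_mul, ← integral_indicator measurableSet_closedBall, ← Real.norm_eq_abs]
    apply norm_integral_le_of_norm_le
    · rw [integrable_indicator_iff measurableSet_closedBall]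
      exact hI2i.const_mul θ
    · filter_upwards with q
      by_cases hq : q ∈ closedBall qb R
      · rw [indicator_of_mem hq, Real.norm_eq_abs, ← sub_mul, abs_mul]
        gcongr
        rw [abs_sub_comm]; exact hTT q
      · rw [indicator_of_notMem hq]
        simp [hT, hTεd, tr, indicator_of_notMem hq]
  have hTz : ∀ q, R < dist q qb → T q = 0 := fun q hq => indicator_of_notMem (by simpa using hq) _
  have hχb : ∀ q, |φ q - T q| ≤ 8 / d * θ * χ q := by
    intro q
    by_cases hq : R + d / 2 < dist q qb
    · rw [hφz q hq, hTz q (by linarith)]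
      simp only [sub_self, abs_zero]
      have : 0 ≤ χ q := le_max_left _ _
      positivity
    · have : d / 2 ≤ χ q := le_trans (by linarith) (le_max_right _ _)
      calc _ ≤ 4 * θ := hφT q
        _ = 8 / d * θ * (d / 2) := by field_simp; ring
        _ ≤ _ := by gcongr
  have hTi : Integrable (fun q : XX N => T (q.2.1, q.1) * (farS N δ).indicator (DD p K u) q) := by
    obtain ⟨M, hM⟩ : ∃ M, ∀ q, ‖T q‖ ≤ M := hTc.bounded_above_of_compact_support hTcs
    apply far_integrable S hδ0 h2 h3 (T := fun x t => T (x, t)) hTc (fun x t => hM (x, t))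
    intro x t h
    have : (x, t) ∈ closedBall qb R := by
      by_contra h'; exact h (indicator_of_notMem h' _)
    rw [← Prod.mk.eta (p := qb), ← closedBall_prod_same] at this
    refine ⟨?_, ?_⟩
    · rw [mem_closedBall_zero_iff]
      have h4 := norm_le_norm_add_norm_sub' x qb.1
      rw [← dist_eq_norm] at h4
      have := mem_closedBall.1 this.1
      linarith
    · have := mem_closedBall.1 this.2
      rw [Real.dist_eq, abs_le] at this
      constructor <;> linarith
  have hφi : Integrable (fun q : XX N => φ (q.2.1, q.1) * (farS N δ).indicator (DD p K u) q) := by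
    have hφcs : HasCompactSupport φ := HasCompactSupport.of_support_subset_isCompact
      (isCompact_closedBall qb (R + d / 2)) ((subset_tsupport _).trans hφsupp)
    obtain ⟨M, hM⟩ : ∃ M, ∀ q, ‖φ q‖ ≤ M := hφs.continuous.bounded_above_of_compact_support hφcs
    apply far_integrable S hδ0 h2 h3 (T := fun x t => φ (x, t)) hφs.continuous (fun x t => hM (x, t))
    intro x t h
    have := hφsupp2 (subset_tsupport φ h)
    exact ⟨this.1, this.2⟩
  have hdiff2 : |(∫ q : XX N, T (q.2.1, q.1) * (farS N δ).indicator (DD p K u) q) -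
      ∫ q : XX N, φ (q.2.1, q.1) * (farS N δ).indicator (DD p K u) q| ≤ 8 / d * θ * I1 := by
    rw [← integral_sub hTi hφi, hI1, ← integral_const_mul, ← Real.norm_eq_abs]
    apply norm_integral_le_of_norm_le (hχi.abs.const_mul _)
    filter_upwards with q
    rw [Real.norm_eq_abs, ← sub_mul, abs_mul, abs_mul, ← mul_assoc]
    gcongr
    rw [abs_sub_comm]
    refine (hχb _).trans ?_
    rw [abs_of_nonneg (show 0 ≤ χ (q.2.1, q.1) from le_max_left _ _)]
  have hfinal : Lam * ((∫⁻ q in nearS N a b δ, eden p s u q) ^ ((p - 1) / p) *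
        (∫⁻ q in nearS N a b δ, eden p s (fun x t => φ (x, t)) q) ^ (1 / p)).toReal ≤
      Lam * ((∫⁻ q in nearS N a b δ, eden p s u q) ^ ((p - 1) / p) * Es ^ (1 / p)).toReal := by
    apply mul_le_mul_of_nonneg_left _ S.hLam.le
    apply ENNReal.toReal_mono
    · apply ENNReal.mul_ne_top
      · exact ENNReal.rpow_ne_top_of_nonneg (div_nonneg (by linarith) hp0.le) (energy_near S h2 h3 _).ne
      · exact ENNReal.rpow_ne_top_of_nonneg (by positivity) hEsfin
    · gcongr
  have hW2 := hW.trans hfinal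
  rw [abs_le] at hdiff1 hdiff2 hW2 ⊢
  have : (8 / d * I1 + I2) * θ = θ * I2 + 8 / d * θ * I1 := by ring
  constructor <;> linarith

lemma V1 (S : Sol N p s lam Lam K u) {qb : Euc N × ℝ} {R R' c κ Lip : ℝ}
    {ψ ψt : Euc N × ℝ → ℝ} (hR : R' < R) (hR0 : 0 < R) (h1 : ‖qb.1‖ + R < 7/4)
    (h2 : -2 < qb.2 - R) (h3 : qb.2 + R < 0) (hψ : Continuous ψ) (hψt : Continuous ψt)
    (hder : ∀ q ∈ closedBall qb R, HasDerivAt (fun τ => ψ (q.1, τ)) (ψt q) q.2)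
    (hLip : ∀ x y t, (x, t) ∈ closedBall qb R → (y, t) ∈ closedBall qb R →
      |ψ (x, t) - ψ (y, t)| ≤ Lip * ‖x - y‖)
    (hκ : 0 < κ)
    (hv : ∀ q ∈ closedBall qb R, R' < dist q qb → u q.1 q.2 - ψ q - c ≤ -κ) {e : ℝ} (he : 0 < e) :
    ∃ n0 : ℕ, ∀ n ≥ n0, |(∫ q, tr qb R (fun q => u q.1 q.2 - ψ q - c) q * ψt q) +
      ∫ q : XX N, tr qb R (fun q => u q.1 q.2 - ψ q - c) (q.2.1, q.1) *
        (farS N (1 / ((n:ℝ) + 8))).indicator (DD p K u) q| ≤ e := by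
  have hp := S.hp
  have hp0 : 0 < p := by linarith
  obtain ⟨d, hd, hd1, hd2, hd3⟩ : ∃ d > 0, ‖qb.1‖ + R + d ≤ 7/4 ∧ -2 < qb.2 - R - d ∧ qb.2 + R + d < 0 := by
    refine ⟨min (7/4 - (‖qb.1‖ + R)) (min ((qb.2 - R + 2) / 2) (-(qb.2 + R) / 2)), ?_, ?_, ?_, ?_⟩
    · refine lt_min (by linarith) (lt_min (by linarith) (by linarith))
    · have := min_le_left (7/4 - (‖qb.1‖ + R)) (min ((qb.2 - R + 2) / 2) (-(qb.2 + R) / 2)); linarith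
    · have := (min_le_right (7/4 - (‖qb.1‖ + R)) (min ((qb.2 - R + 2) / 2) (-(qb.2 + R) / 2))).trans (min_le_left _ _); linarith
    · have := (min_le_right (7/4 - (‖qb.1‖ + R)) (min ((qb.2 - R + 2) / 2) (-(qb.2 + R) / 2))).trans (min_le_right _ _); linarith
  have hfin := eden_lip (p := p) (s := s) S.hN hp S.hs (qb := qb) (R := R) (δ := 1/8) (by norm_num) hLip
  set Es := (ENNReal.ofReal (2 ^ p) * ((∫⁻ q in nearS N (qb.2 - R - d) (qb.2 + R + d) (1/8), eden p s u q) +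
          ∫⁻ q in WW qb R (1/8), eden p s (fun x t => ψ (x, t)) q)) with hEs
  have hEsfin : Es ≠ ⊤ := by
    apply ENNReal.mul_ne_top ENNReal.ofReal_ne_top
    exact ENNReal.add_ne_top.2 ⟨(energy_near S hd2 hd3 _).ne, hfin.ne⟩
  have ht := energy_near_tendsto S hd2 hd3
  have hexp : 0 < (p - 1) / p := div_pos (by linarith) hp0
  have ht2 : Tendsto (fun n : ℕ => Lam * ((∫⁻ q in nearS N (qb.2 - R - d) (qb.2 + R + d) (1 / ((n:ℝ) + 8)), eden p s u q) ^ ((p - 1) / p) * Es ^ (1 / p)).toReal) atTop (𝓝 0) := by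
    have e1 := ((ENNReal.continuous_rpow_const (y := (p - 1) / p)).tendsto 0).comp ht
    rw [ENNReal.zero_rpow_of_pos hexp] at e1
    have e2 := ENNReal.Tendsto.mul_const (b := Es ^ (1 / p)) e1 (Or.inr (ENNReal.rpow_ne_top_of_nonneg (by positivity) hEsfin))
    rw [zero_mul] at e2
    have e3 := ((ENNReal.tendsto_toReal (a := 0) (by simp)).comp e2).const_mul Lam
    simpa [Function.comp_def] using e3
  have hev : ∀ᶠ n : ℕ in atTop, 1 / ((n:ℝ) + 8) ≤ R - R' := by
    have : Tendsto (fun n : ℕ => 1 / ((n:ℝ) + 8)) atTop (𝓝 0) := by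
      have : Tendsto (fun n : ℕ => ((n:ℝ) + 8)) atTop atTop :=
        tendsto_atTop_add_const_right _ _ tendsto_natCast_atTop_atTop
      simpa [Function.comp_def] using tendsto_inv_atTop_zero.comp this
    exact this.eventually (ge_mem_nhds (by linarith))
  have hall := (ht2.eventually (gt_mem_nhds (half_pos he))).and hev
  obtain ⟨n0, hn0⟩ := eventually_atTop.1 hall
  refine ⟨n0, fun n hn => ?_⟩
  obtain ⟨g1, g2⟩ := hn0 n hn
  have hn8 : (0:ℝ) < (n:ℝ) + 8 := by positivity
  have := V1_eps S hR hR0 hd hd1 hd2 hd3 hψ hψt hder hκ hv (δ := 1 / ((n:ℝ) + 8)) (by positivity)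
    (by gcongr; linarith [(Nat.cast_nonneg n : (0:ℝ) ≤ n)]) g2 (half_pos he) hfin
  linarith

end Part7

section Part8

variable {N : ℕ} {p s lam Lam : ℝ} {K : Euc N → ℝ} {u : Euc N → ℝ → ℝ}

/-- annulus in difference variable -/
def annS (N : ℕ) (δ ρ : ℝ) : Set (XX N) := {q | δ ≤ ‖q.2.1 - q.2.2‖ ∧ ‖q.2.1 - q.2.2‖ < ρ}

lemma annS_meas (N : ℕ) (δ ρ : ℝ) : MeasurableSet (annS N δ ρ) := by
  have h1 : MeasurableSet {q : XX N | δ ≤ ‖q.2.1 - q.2.2‖} :=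
    measurableSet_le measurable_const (by fun_prop)
  have h2 : MeasurableSet {q : XX N | ‖q.2.1 - q.2.2‖ < ρ} :=
    measurableSet_lt (by fun_prop) measurable_const
  exact h1.inter h2

/-- annulus in space -/
def annZ (N : ℕ) (δ ρ : ℝ) : Set (Euc N) := {z | δ ≤ ‖z‖ ∧ ‖z‖ < ρ}

lemma annZ_meas (N : ℕ) (δ ρ : ℝ) : MeasurableSet (annZ N δ ρ) := by
  have h1 : MeasurableSet {z : Euc N | δ ≤ ‖z‖} :=
    measurableSet_le measurable_const (by fun_prop)
  have h2 : MeasurableSet {z : Euc N | ‖z‖ < ρ} :=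
    measurableSet_lt (by fun_prop) measurable_const
  exact h1.inter h2

lemma annZ_fin (N : ℕ) (δ ρ : ℝ) : volume (annZ N δ ρ) < ⊤ :=
  (measure_mono (fun z hz => mem_ball_zero_iff.2 hz.2)).trans_lt
    (measure_ball_lt_top (x := (0 : Euc N)) (r := ρ))

lemma ker_bound (hK : IsKernel N p s lam Lam K) (hsp : 0 < s * p) (hLam : 0 < Lam) {δ : ℝ}
    (hδ : 0 < δ) {z : Euc N} (hz : δ ≤ ‖z‖) : |K z| ≤ Lam * δ ^ (-((N:ℝ) + s * p)) := by
  have hz0 : z ≠ 0 := norm_pos_iff.1 (hδ.trans_le hz)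
  refine (IsKernel.abs_le hK hz0).trans ?_
  gcongr 1
  exact Real.rpow_le_rpow_of_nonpos hδ hz (by have : (0:ℝ) ≤ N := Nat.cast_nonneg N; linarith)

lemma ann_integrable (hp : 1 < p) (hsp : 0 < s * p) (hLam : 0 < Lam) (hK : IsKernel N p s lam Lam K)
    {δ ρ : ℝ} (hδ : 0 < δ) {T : Euc N × ℝ → ℝ} (hT : Continuous T) {qb : Euc N × ℝ} {R : ℝ}
    (hTs : ∀ q, T q ≠ 0 → q ∈ closedBall qb R) {ψ : Euc N → ℝ → ℝ}
    (hψ : Continuous (fun q : Euc N × ℝ => ψ q.1 q.2)) :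
    Integrable (fun q : XX N => T (q.2.1, q.1) * (annS N δ ρ).indicator (DD p K ψ) q) := by
  have hTcs : HasCompactSupport T := HasCompactSupport.of_support_subset_isCompact
      (isCompact_closedBall qb R) hTs
  obtain ⟨M, hM⟩ : ∃ M, ∀ q, ‖T q‖ ≤ M := hT.bounded_above_of_compact_support hTcs
  obtain ⟨M1, hM1⟩ := (isCompact_closedBall qb (R + ρ)).exists_bound_of_continuousOn hψ.continuousOn
  obtain ⟨M2, hM2⟩ := (isCompact_closedBall qb R).exists_bound_of_continuousOn hψ.continuousOn
  have hmT : Measurable (fun q : XX N => T (q.2.1, q.1)) := by fun_prop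
  have m1 : Measurable (fun q : XX N => T (q.2.1, q.1) * (annS N δ ρ).indicator (DD p K ψ) q) :=
    hmT.mul ((DD_meas hp hK.1 hψ).indicator (annS_meas N δ ρ))
  set B : Set (XX N) := closedBall qb.2 R ×ˢ (closedBall qb.1 R ×ˢ closedBall qb.1 (R + ρ)) with hB
  have hBc : IsCompact B :=
    (isCompact_closedBall _ _).prod ((isCompact_closedBall _ _).prod (isCompact_closedBall _ _))
  have hsub : ∀ q : XX N, T (q.2.1, q.1) * (annS N δ ρ).indicator (DD p K ψ) q ≠ 0 →
      q ∈ annS N δ ρ ∧ (q.2.1, q.1) ∈ closedBall qb R ∧ (q.2.2, q.1) ∈ closedBall qb (R + ρ) := by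
    intro q hq
    have h1 : q ∈ annS N δ ρ := by
      by_contra h; exact hq (by rw [indicator_of_notMem h, mul_zero])
    have h2 := hTs _ (left_ne_zero_of_mul hq)
    refine ⟨h1, h2, ?_⟩
    have := dist_triangle_left (q.2.2, q.1) qb (q.2.1, q.1)
    rw [dist_pair_sametime] at this
    rw [mem_closedBall] at *
    linarith [h1.2]
  have hi : IntegrableOn (fun q : XX N => T (q.2.1, q.1) * (annS N δ ρ).indicator (DD p K ψ) q) B := by
    apply Measure.integrableOn_of_bounded (M := M * ((|M1| + |M2|) ^ (p - 1) * (Lam * δ ^ (-((N:ℝ) + s * p)))))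
      hBc.measure_lt_top.ne m1.aestronglyMeasurable
    filter_upwards with q
    by_cases hq : T (q.2.1, q.1) * (annS N δ ρ).indicator (DD p K ψ) q = 0
    · rw [hq, norm_zero]
      have := (norm_nonneg _).trans (hM qb)
      positivity
    · obtain ⟨h1, h2, h3⟩ := hsub q hq
      rw [indicator_of_mem h1, norm_mul]
      apply mul_le_mul (hM _) _ (norm_nonneg _) ((norm_nonneg _).trans (hM qb))
      unfold DD
      rw [norm_mul]
      apply mul_le_mul _ (ker_bound hK hsp hLam hδ h1.1) (abs_nonneg _) (by positivity)
      rw [Real.norm_eq_abs, Jp_abs hp]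
      apply Real.rpow_le_rpow (abs_nonneg _) _ (by linarith)
      have e1 := hM1 _ h3
      have e2 := hM2 _ h2
      simp only [Real.norm_eq_abs] at e1 e2
      have := abs_sub (ψ q.2.1 q.1) (ψ q.2.2 q.1)
      linarith [le_abs_self M1, le_abs_self M2]
  apply hi.integrable_of_forall_notMem_eq_zero
  intro q hq
  by_contra h
  obtain ⟨h1, h2, h3⟩ := hsub q h
  rw [← Prod.mk.eta (p := qb), ← closedBall_prod_same] at h2 h3
  exact hq ⟨h2.2, h2.1, h3.1⟩

lemma sym_nonneg (S : Sol N p s lam Lam K u) {qb : Euc N × ℝ} {R R' c δ ρ : ℝ}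
    {ψ : Euc N × ℝ → ℝ} (hR : R' < R) (hψ : Continuous ψ) (hδ : 0 < δ) (hρ : ρ ≤ R - R')
    (hv : ∀ q ∈ closedBall qb R, R' < dist q qb → u q.1 q.2 - ψ q - c ≤ 0) :
    ∫ q : XX N, tr qb R (fun q => u q.1 q.2 - ψ q - c) (q.2.1, q.1) *
        (annS N δ ρ).indicator (DD p K (fun x t => ψ (x, t))) q ≤
    ∫ q : XX N, tr qb R (fun q => u q.1 q.2 - ψ q - c) (q.2.1, q.1) *
        (annS N δ ρ).indicator (DD p K u) q := by
  have hp := S.hp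
  have hsp : 0 < s * p := mul_pos S.hs.1 (by linarith)
  set T := tr qb R (fun q => u q.1 q.2 - ψ q - c) with hT
  have hTc : Continuous T := tr_cont hR hv ((S.cont.sub hψ).sub continuous_const)
  have hTs : ∀ q, T q ≠ 0 → q ∈ closedBall qb R := fun q hq => by
    by_contra h; exact hq (indicator_of_notMem h _)
  have i1 := ann_integrable hp hsp S.hLam S.ker (ρ := ρ) hδ hTc hTs (ψ := fun x t => ψ (x, t)) hψ
  have i2 := ann_integrable hp hsp S.hLam S.ker (ρ := ρ) hδ hTc hTs (ψ := u) S.cont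
  rw [← sub_nonneg, ← integral_sub i2 i1]
  set F : XX N → ℝ := fun q => T (q.2.1, q.1) * (annS N δ ρ).indicator (DD p K u) q -
    T (q.2.1, q.1) * (annS N δ ρ).indicator (DD p K (fun x t => ψ (x, t))) q with hF
  have iF : Integrable F := i2.sub i1
  have h2 : ∫ q, F q = ∫ q, F (swapX N q) := (integral_swapX F).symm
  have h3 : 0 ≤ ∫ q, (F q + F (swapX N q)) := by
    apply integral_nonneg
    intro q
    have hsw : (swapX N q) ∈ annS N δ ρ ↔ q ∈ annS N δ ρ := by
      rw [swapX_apply]; unfold annS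
      simp only [mem_ofPred_eq, norm_sub_rev q.2.2 q.2.1]
    by_cases hq : q ∈ annS N δ ρ
    · have e : F q + F (swapX N q) = (T (q.2.1, q.1) - T (q.2.2, q.1)) *
          (Jp p (u q.2.1 q.1 - u q.2.2 q.1) - Jp p (ψ (q.2.1, q.1) - ψ (q.2.2, q.1))) * K (q.2.1 - q.2.2) := by
        simp only [hF]
        rw [indicator_of_mem hq, indicator_of_mem hq, indicator_of_mem (hsw.2 hq), indicator_of_mem (hsw.2 hq),
          DD_swap S.ker, DD_swap S.ker]
        rw [swapX_apply]
        unfold DD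
        ring
      simp only [Pi.zero_apply]
      rw [e]
      have hz : q.2.1 - q.2.2 ≠ 0 := norm_pos_iff.1 (hδ.trans_le hq.1)
      have hK0 : 0 ≤ K (q.2.1 - q.2.2) := by
        have := S.ker.2.1 (q.2.1 - q.2.2) hz
        exact this.le
      apply mul_nonneg _ hK0
      by_cases hne : T (q.2.1, q.1) ≠ 0 ∨ T (q.2.2, q.1) ≠ 0
      · have hW := tr_pair hv hρ hR.le hq.2 hne
        have t1 : T (q.2.1, q.1) = max (u q.2.1 q.1 - ψ (q.2.1, q.1) - c) 0 := indicator_of_mem hW.1 _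
        have t2 : T (q.2.2, q.1) = max (u q.2.2 q.1 - ψ (q.2.2, q.1) - c) 0 := indicator_of_mem hW.2.1 _
        rw [t1, t2]
        rcases le_total (u q.2.1 q.1 - u q.2.2 q.1) (ψ (q.2.1, q.1) - ψ (q.2.2, q.1)) with h | h
        · apply mul_nonneg_of_nonpos_of_nonpos
          · rw [sub_nonpos]; exact max_le_max (by linarith) le_rfl
          · rw [sub_nonpos]; exact Jp_mono hp h
        · apply mul_nonneg
          · rw [sub_nonneg]; exact max_le_max (by linarith) le_rfl
          · rw [sub_nonneg]; exact Jp_mono hp h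
      · push Not at hne
        rw [hne.1, hne.2]; simp
    · have hq2 : swapX N q ∉ annS N δ ρ := fun h => hq (hsw.1 h)
      simp [hF, indicator_of_notMem hq, indicator_of_notMem hq2]
  rw [integral_add iF (integrable_swapX iF), ← h2] at h3
  linarith

lemma fub {T : Euc N × ℝ → ℝ} (hT : Continuous T) (hTcs : HasCompactSupport T) (hT0 : ∀ q, 0 ≤ T q)
    {G : XX N → ℝ} (hi : Integrable (fun q : XX N => T (q.2.1, q.1) * G q)) {m : ℝ}
    (hm : ∀ᵐ t : ℝ, ∀ x, T (x, t) ≠ 0 → m ≤ ∫ y, G (t, x, y)) :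
    m * ∫ q, T q ≤ ∫ q : XX N, T (q.2.1, q.1) * G q := by
  have hTi : Integrable T := hT.integrable_of_hasCompactSupport hTcs
  have hTi' : Integrable (fun r : ℝ × Euc N => T (r.2, r.1)) := hTi.swap
  have e1 : m * ∫ q, T q = ∫ t : ℝ, ∫ x : Euc N, m * T (x, t) := by
    rw [Measure.volume_eq_prod, integral_prod_symm _ hTi, ← integral_const_mul]
    simp_rw [integral_const_mul]
  rw [e1, Measure.volume_eq_prod, integral_prod _ hi]
  have ae1 := hi.prod_right_ae
  apply integral_mono_ae
  · have := (hTi'.const_mul m).integral_prod_left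
    exact this
  · exact hi.integral_prod_left
  · filter_upwards [hm, ae1] with t ht hgood
    rw [Measure.volume_eq_prod, integral_prod _ hgood]
    have hgood2 := hgood.integral_prod_left
    apply integral_mono_ae
    · apply Integrable.const_mul
      apply Continuous.integrable_of_hasCompactSupport (by fun_prop)
      apply HasCompactSupport.of_support_subset_isCompact (hTcs.isCompact.image continuous_fst)
      intro x hx
      exact ⟨(x, t), subset_tsupport _ hx, rfl⟩
    · exact hgood2
    · filter_upwards with x
      rw [integral_const_mul]
      by_cases h : T (x, t) = 0
      · simp [h]
      · rw [mul_comm m]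
        exact mul_le_mul_of_nonneg_left (ht x h) (hT0 _)

/-- the middle integral -/
def midInt {N : ℕ} (p : ℝ) (K : Euc N → ℝ) (u : Euc N → ℝ → ℝ) (ρ ρ1 : ℝ) (q : Euc N × ℝ) : ℝ :=
  ∫ z in annZ N ρ ρ1, Jp p (u q.1 q.2 - u (q.1 + z) q.2) * K z

lemma annZ_integrable (hp : 1 < p) (hsp : 0 < s * p) (hLam : 0 < Lam) (hK : IsKernel N p s lam Lam K)
    {f : Euc N → ℝ} (hf : Continuous f) {ρ ρ1 : ℝ} (hρ : 0 < ρ) :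
    IntegrableOn (fun z => Jp p (f z) * K z) (annZ N ρ ρ1) := by
  obtain ⟨M, hM⟩ := (isCompact_closedBall (0 : Euc N) ρ1).exists_bound_of_continuousOn hf.continuousOn
  apply Measure.integrableOn_of_bounded (M := |M| ^ (p - 1) * (Lam * ρ ^ (-((N:ℝ) + s * p))))
    (annZ_fin _ _ _).ne
  · exact (((Jp_continuous hp).comp hf).measurable.mul hK.1).aestronglyMeasurable
  · rw [ae_restrict_iff' (annZ_meas _ _ _)]
    filter_upwards with z hz
    rw [norm_mul]
    apply mul_le_mul _ (ker_bound hK hsp hLam hρ hz.1) (abs_nonneg _) (by positivity)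
    rw [Real.norm_eq_abs, Jp_abs hp]
    apply Real.rpow_le_rpow (abs_nonneg _) _ (by linarith)
    exact (hM z (mem_closedBall_zero_iff.2 hz.2.le)).trans (le_abs_self M)

lemma midInt_cont (hp : 1 < p) (hsp : 0 < s * p) (hLam : 0 < Lam) (hK : IsKernel N p s lam Lam K)
    (hu : Continuous (fun q : Euc N × ℝ => u q.1 q.2)) {ρ ρ1 : ℝ} (hρ : 0 < ρ) (q0 : Euc N × ℝ) :
    ContinuousAt (midInt p K u ρ ρ1) q0 := by
  obtain ⟨M, hM⟩ := (isCompact_closedBall q0 (1 + |ρ1|)).exists_bound_of_continuousOn hu.continuousOn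
  have hc : ∀ z : Euc N, Continuous (fun q : Euc N × ℝ => u (q.1 + z) q.2) := fun z =>
    hu.comp (f := fun q : Euc N × ℝ => (q.1 + z, q.2)) (by fun_prop)
  have hc2 : ∀ q : Euc N × ℝ, Continuous (fun z : Euc N => u (q.1 + z) q.2) := fun q =>
    hu.comp (f := fun z : Euc N => (q.1 + z, q.2)) (by fun_prop)
  unfold midInt
  apply continuousAt_of_dominated (bound := fun _ => (2 * M) ^ (p - 1) * (Lam * ρ ^ (-((N:ℝ) + s * p))))
  · filter_upwards with q
    exact (((Jp_continuous hp).comp (continuous_const.sub (hc2 q))).measurable.mul hK.1).aestronglyMeasurable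
  · filter_upwards [closedBall_mem_nhds q0 one_pos] with q hq
    rw [ae_restrict_iff' (annZ_meas _ _ _)]
    filter_upwards with z hz
    have h1 := hM q (closedBall_subset_closedBall (by linarith [abs_nonneg ρ1]) hq)
    have h2 := hM (q.1 + z, q.2) (by
      rw [mem_closedBall] at *
      have := dist_triangle (q.1 + z, q.2) (q.1, q.2) q0
      rw [dist_pair_sametime] at this
      simp only [add_sub_cancel_left, Prod.mk.eta] at this
      linarith [hz.2, le_abs_self ρ1])
    simp only [Real.norm_eq_abs] at h1 h2
    have hM0 := (abs_nonneg _).trans h1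
    rw [norm_mul]
    apply mul_le_mul _ (ker_bound hK hsp hLam hρ hz.1) (abs_nonneg _) (by positivity)
    rw [Real.norm_eq_abs, Jp_abs hp]
    apply Real.rpow_le_rpow (abs_nonneg _) _ (by linarith)
    have := abs_sub (u q.1 q.2) (u (q.1 + z) q.2)
    linarith
  · rw [integrable_const_iff]
    right
    rw [isFiniteMeasure_restrict]
    exact (annZ_fin _ _ _).ne
  · filter_upwards with z
    exact (((Jp_continuous hp).comp (hu.sub (hc z))).mul continuous_const).continuousAt

end Part8

section Part9

variable {N : ℕ} {p s lam Lam : ℝ} {K : Euc N → ℝ} {u : Euc N → ℝ → ℝ}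

lemma inner_ann (hK : IsKernel N p s lam Lam K) (f : Euc N → ℝ → ℝ) (δ ρ t : ℝ) (x : Euc N) :
    ∫ y, (annS N δ ρ).indicator (DD p K f) (t, x, y) = midInt p K f δ ρ (x, t) := by
  unfold midInt
  rw [← integral_add_left_eq_self (fun y => (annS N δ ρ).indicator (DD p K f) (t, x, y)) x,
    ← integral_indicator (annZ_meas _ _ _)]
  congr 1; ext z
  by_cases hz : z ∈ annZ N δ ρ
  · rw [indicator_of_mem hz, indicator_of_mem]
    · unfold DD
      simp only [sub_add_cancel_left]
      rw [IsKernel.symm hK]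
    · simpa [annS, annZ] using hz
  · rw [indicator_of_notMem hz, indicator_of_notMem]
    simpa [annS, annZ] using hz

lemma inner_int (hp : 1 < p) (hsp : 0 < s * p) (hLam : 0 < Lam) (hK : IsKernel N p s lam Lam K)
    {f : Euc N → ℝ → ℝ} (hf : Continuous (fun q : Euc N × ℝ => f q.1 q.2)) {δ ρ t : ℝ} {x : Euc N}
    (hδ : 0 < δ) :
    Integrable (fun y => (annS N δ ρ).indicator (DD p K f) (t, x, y)) := by
  have h1 : IntegrableOn (fun z => Jp p (f x t - f (x + z) t) * K z) (annZ N δ ρ) :=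
    annZ_integrable hp hsp hLam hK (f := fun z => f x t - f (x + z) t)
      (continuous_const.sub (hf.comp (f := fun z : Euc N => (x + z, t)) (by fun_prop))) hδ
  rw [← integrable_indicator_iff (annZ_meas _ _ _)] at h1
  have h2 := h1.comp_add_left (-x)
  refine h2.congr (Eventually.of_forall fun y => ?_)
  simp only
  by_cases hz : -x + y ∈ annZ N δ ρ
  · rw [indicator_of_mem hz, indicator_of_mem]
    · unfold DD
      simp only [add_neg_cancel_left]
      rw [← IsKernel.symm hK]
      congr 2; abel
    · simp only [annZ, mem_ofPred_eq, annS] at hz ⊢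
      rwa [neg_add_eq_sub, norm_sub_rev] at hz
  · rw [indicator_of_notMem hz, indicator_of_notMem]
    simp only [annZ, mem_ofPred_eq, annS] at hz ⊢
    rwa [neg_add_eq_sub, norm_sub_rev] at hz

/-- **Weak solutions satisfy the viscosity inequality.** -/
lemma visc (S : Sol N p s lam Lam K u) {C0 : ℝ} (hC0 : 0 < C0)
    (hfar : ∀ᵐ t : ℝ, t ∈ Ioo (-2 : ℝ) 0 → ∀ x ∈ closedBall (0 : Euc N) (7/4),
        ∫⁻ y in {y : Euc N | 1/4 ≤ ‖x - y‖},
          ENNReal.ofReal |Jp p (u x t - u y t) * K (x - y)| ≤ ENNReal.ofReal C0)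
    {qb : Euc N × ℝ} {R ρ Lip A : ℝ}
    {ψ ψt : Euc N × ℝ → ℝ} (hρ0 : 0 < ρ) (hρR : 2 * ρ ≤ R) (hρ8 : ρ ≤ 1/8) (h1 : ‖qb.1‖ + R < 7/4)
    (h2 : -2 < qb.2 - R) (h3 : qb.2 + R < 0) (hψ : Continuous ψ) (hψt : Continuous ψt)
    (hder : ∀ q ∈ closedBall qb R, HasDerivAt (fun τ => ψ (q.1, τ)) (ψt q) q.2)
    (hLip : ∀ x y t, (x, t) ∈ closedBall qb R → (y, t) ∈ closedBall qb R →
      |ψ (x, t) - ψ (y, t)| ≤ Lip * ‖x - y‖)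
    (hmax : ∀ q ∈ closedBall qb R, u q.1 q.2 - ψ q ≤ u qb.1 qb.2 - ψ qb - dist q qb ^ 2)
    (hA : ∀ q ∈ closedBall qb ρ, ∀ δ, 0 < δ → δ < ρ →
      A ≤ midInt p K (fun x t => ψ (x, t)) δ ρ q) :
    ψt qb + A + midInt p K u ρ (1/4) qb ≤ C0 := by
  have hp := S.hp
  have hsp : 0 < s * p := mul_pos S.hs.1 (by linarith)
  apply le_of_forall_pos_le_add
  intro η hη
  -- choose the small radius
  obtain ⟨R', hR'0, hR'ρ, hR'1, hR'2⟩ : ∃ R' > 0, R' ≤ ρ ∧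
      (∀ q ∈ closedBall qb R', ψt qb - η / 2 ≤ ψt q) ∧
      (∀ q ∈ closedBall qb R', midInt p K u ρ (1/4) qb - η / 2 ≤ midInt p K u ρ (1/4) q) := by
    have c1 : ∀ᶠ q in 𝓝 qb, ψt qb - η / 2 < ψt q :=
      hψt.continuousAt.eventually (lt_mem_nhds (by linarith))
    have c2 : ∀ᶠ q in 𝓝 qb, midInt p K u ρ (1/4) qb - η / 2 < midInt p K u ρ (1/4) q :=
      (midInt_cont hp hsp S.hLam S.ker S.cont hρ0 qb).eventually (lt_mem_nhds (by linarith))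
    obtain ⟨r, hr, hb⟩ := Metric.eventually_nhds_iff.1 (c1.and c2)
    refine ⟨min (r / 2) ρ, by positivity, min_le_right _ _, fun q hq => ?_, fun q hq => ?_⟩
    · have : dist q qb < r := by
        have := (mem_closedBall.1 hq).trans (min_le_left _ _); linarith
      exact (hb this).1.le
    · have : dist q qb < r := by
        have := (mem_closedBall.1 hq).trans (min_le_left _ _); linarith
      exact (hb this).2.le
  have hR : R' < R := by linarith
  have hR0 : 0 < R := by linarith
  set κ := R' ^ 2 / 2 with hκd
  have hκ : 0 < κ := by positivity
  set c := u qb.1 qb.2 - ψ qb - κ with hc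
  have hv : ∀ q ∈ closedBall qb R, R' < dist q qb → u q.1 q.2 - ψ q - c ≤ -κ := by
    intro q hq hq'
    have := hmax q hq
    have : R' ^ 2 ≤ dist q qb ^ 2 := by gcongr
    simp only [hc, hκd] at *; linarith
  have hv0 : ∀ q ∈ closedBall qb R, R' < dist q qb → u q.1 q.2 - ψ q - c ≤ 0 :=
    fun q hq hq' => (hv q hq hq').trans (by linarith)
  set T := tr qb R (fun q => u q.1 q.2 - ψ q - c) with hT
  have hTc : Continuous T := tr_cont hR hv0 ((S.cont.sub hψ).sub continuous_const)
  have hTcs : HasCompactSupport T := tr_cs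
  have hT0 : ∀ q, 0 ≤ T q := tr_nonneg _ _ _
  have hTi : Integrable T := hTc.integrable_of_hasCompactSupport hTcs
  have hTs' : ∀ q, T q ≠ 0 → q ∈ closedBall qb R' := fun q hq => tr_mem hv0 hq
  have hTs : ∀ q, T q ≠ 0 → q ∈ closedBall qb R := fun q hq =>
    closedBall_subset_closedBall hR.le (hTs' q hq)
  have hTpos : 0 < ∫ q, T q := by
    rw [integral_pos_iff_support_of_nonneg hT0 hTi]
    have ho : IsOpen (Function.support T) := hTc.isOpen_support
    refine ho.measure_pos volume ⟨qb, ?_⟩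
    have : T qb = max (u qb.1 qb.2 - ψ qb - c) 0 := indicator_of_mem (mem_closedBall_self hR0.le) _
    rw [Function.mem_support, this]
    have : u qb.1 qb.2 - ψ qb - c = κ := by simp only [hc]; ring
    rw [this, max_eq_left hκ.le]; exact hκ.ne'
  set m := A + (midInt p K u ρ (1/4) qb - η / 2) - C0 with hm
  have hmem : ∀ q ∈ closedBall qb R, q.1 ∈ closedBall (0 : Euc N) (7/4) ∧ q.2 ∈ Icc (qb.2 - R) (qb.2 + R) := by
    intro q hq
    rw [← Prod.mk.eta (p := qb), ← closedBall_prod_same] at hq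
    refine ⟨?_, ?_⟩
    · rw [mem_closedBall_zero_iff]
      have h4 := norm_le_norm_add_norm_sub' q.1 qb.1
      rw [← dist_eq_norm] at h4
      have := mem_closedBall.1 hq.1
      linarith
    · have := mem_closedBall.1 hq.2
      rw [Real.dist_eq, abs_le] at this
      constructor <;> linarith
  obtain ⟨M, hM⟩ : ∃ M, ∀ q, ‖T q‖ ≤ M := hTc.bounded_above_of_compact_support hTcs
  have hfi : ∀ δ : ℝ, 0 < δ → Integrable (fun q : XX N => T (q.2.1, q.1) * (farS N δ).indicator (DD p K u) q) :=
    fun δ hδ => far_integrable S hδ h2 h3 (T := fun x t => T (x, t)) hTc (fun x t => hM (x, t))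
      (fun x t h => hmem (x, t) (hTs _ h))
  -- key inequality
  have key : ∀ δ, 0 < δ → δ < ρ → m * ∫ q, T q ≤
      ∫ q : XX N, T (q.2.1, q.1) * (farS N δ).indicator (DD p K u) q := by
    intro δ hδ hδρ
    have i1 := ann_integrable hp hsp S.hLam S.ker (ρ := ρ) hδ hTc hTs (ψ := u) S.cont
    have i2 := ann_integrable hp hsp S.hLam S.ker (ρ := ρ) hδ hTc hTs (ψ := fun x t => ψ (x, t)) hψ
    have i3 := hfi ρ hρ0
    have e1 : ∀ q : XX N, T (q.2.1, q.1) * (farS N δ).indicator (DD p K u) q =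
        T (q.2.1, q.1) * (annS N δ ρ).indicator (DD p K u) q +
        T (q.2.1, q.1) * (farS N ρ).indicator (DD p K u) q := by
      intro q
      rw [← mul_add]
      congr 1
      by_cases g1 : ρ ≤ ‖q.2.1 - q.2.2‖
      · rw [indicator_of_mem (show q ∈ farS N δ from hδρ.le.trans g1),
          indicator_of_mem (show q ∈ farS N ρ from g1),
          indicator_of_notMem (show q ∉ annS N δ ρ from fun h => absurd h.2 (not_lt.2 g1)), zero_add]
      · rw [indicator_of_notMem (show q ∉ farS N ρ from g1), add_zero]
        by_cases g2 : δ ≤ ‖q.2.1 - q.2.2‖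
        · rw [indicator_of_mem (show q ∈ farS N δ from g2),
            indicator_of_mem (show q ∈ annS N δ ρ from ⟨g2, not_le.1 g1⟩)]
        · rw [indicator_of_notMem (show q ∉ farS N δ from g2),
            indicator_of_notMem (show q ∉ annS N δ ρ from fun h => g2 h.1)]
    simp_rw [e1]
    rw [integral_add i1 i3]
    have hs := sym_nonneg S hR hψ hδ (ρ := ρ) (by linarith) hv0
    refine le_trans ?_ (add_le_add_left hs _)
    rw [← integral_add i2 i3]
    simp_rw [← mul_add]
    apply fub hTc hTcs hT0
    · simp_rw [mul_add]; exact i2.add i3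
    · filter_upwards [hfar] with t ht x hx
      have hq := hTs _ hx
      have hq' := hTs' _ hx
      have hx1 := (hmem _ hq).1
      have ht1 : t ∈ Ioo (-2:ℝ) 0 := ⟨by linarith [(hmem _ hq).2.1], by linarith [(hmem _ hq).2.2]⟩
      have hb := ht ht1 x hx1
      have j1 := inner_int hp hsp S.hLam S.ker (f := fun x t => ψ (x, t)) hψ (ρ := ρ) (t := t) (x := x) hδ
      have j2 := inner_int hp hsp S.hLam S.ker S.cont (ρ := 1/4) (t := t) (x := x) hρ0
      have mS : MeasurableSet {y : Euc N | 1/4 ≤ ‖x - y‖} :=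
        measurableSet_le measurable_const (by fun_prop)
      have mD : Measurable (fun y => Jp p (u x t - u y t) * K (x - y)) := by
        have := (DD_meas S.hp S.ker.1 S.cont).comp (by fun_prop : Measurable (fun y : Euc N => ((t, x, y) : XX N)))
        exact this
      set f3 : Euc N → ℝ := {y : Euc N | 1/4 ≤ ‖x - y‖}.indicator (fun y => Jp p (u x t - u y t) * K (x - y)) with hf3
      have hen : ∫⁻ y, ‖f3 y‖ₑ ≤ ENNReal.ofReal C0 := by
        refine le_trans (le_of_eq ?_) hb
        rw [← lintegral_indicator mS]
        congr 1; ext y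
        rw [hf3, enorm_indicator_eq_indicator_enorm]
        congr 1; ext y; rw [Real.enorm_eq_ofReal_abs]
      have j3 : Integrable f3 := ⟨(mD.indicator mS).aestronglyMeasurable, lt_of_le_of_lt hen ENNReal.ofReal_lt_top⟩
      have hf3b : -C0 ≤ ∫ y, f3 y := by
        have h4 := (enorm_integral_le_lintegral_enorm f3).trans hen
        rw [Real.enorm_eq_ofReal_abs, ENNReal.ofReal_le_ofReal_iff hC0.le] at h4
        exact (abs_le.1 h4).1
      have e2 : ∀ y, (annS N δ ρ).indicator (DD p K fun x t => ψ (x, t)) (t, x, y) +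
          (farS N ρ).indicator (DD p K u) (t, x, y) =
          (annS N δ ρ).indicator (DD p K fun x t => ψ (x, t)) (t, x, y) +
          ((annS N ρ (1/4)).indicator (DD p K u) (t, x, y) + f3 y) := by
        intro y
        congr 1
        by_cases g1 : 1/4 ≤ ‖x - y‖
        · rw [indicator_of_mem (show (t, x, y) ∈ farS N ρ from (show ρ ≤ ‖x - y‖ by linarith)),
            indicator_of_notMem (show (t, x, y) ∉ annS N ρ (1/4) from fun h => absurd h.2 (not_lt.2 g1)),
            hf3, indicator_of_mem (show y ∈ {y : Euc N | 1/4 ≤ ‖x - y‖} from g1), zero_add]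
          rfl
        · rw [hf3, indicator_of_notMem (show y ∉ {y : Euc N | 1/4 ≤ ‖x - y‖} from g1), add_zero]
          by_cases g2 : ρ ≤ ‖x - y‖
          · rw [indicator_of_mem (show (t, x, y) ∈ farS N ρ from g2),
              indicator_of_mem (show (t, x, y) ∈ annS N ρ (1/4) from ⟨g2, not_le.1 g1⟩)]
          · rw [indicator_of_notMem (show (t, x, y) ∉ farS N ρ from g2),
              indicator_of_notMem (show (t, x, y) ∉ annS N ρ (1/4) from fun h => g2 h.1)]
      simp_rw [e2]
      have j23 : Integrable (fun y => (annS N ρ (1/4)).indicator (DD p K u) (t, x, y) + f3 y) := j2.add j3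
      rw [integral_add j1 j23, integral_add j2 j3, inner_ann S.ker, inner_ann S.ker]
      have k1 := hA (x, t) (closedBall_subset_closedBall hR'ρ hq') δ hδ hδρ
      have k2 := hR'2 (x, t) hq'
      linarith
  have ktime : (ψt qb - η / 2) * ∫ q, T q ≤ ∫ q, T q * ψt q := by
    rw [← integral_const_mul]
    apply integral_mono (hTi.const_mul _)
    · exact (hTc.mul hψt).integrable_of_hasCompactSupport hTcs.mul_right
    · intro q
      simp only
      by_cases h : T q = 0
      · simp [h]
      · rw [mul_comm]
        exact mul_le_mul_of_nonneg_left (hR'1 q (hTs' q h)) (hT0 q)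
  have hfinal : (ψt qb - η / 2 + m) * ∫ q, T q ≤ 0 := by
    apply le_of_forall_pos_le_add
    intro e he
    obtain ⟨n0, hn0⟩ := V1 S hR hR0 h1 h2 h3 hψ hψt hder hLip hκ hv he
    have hev : ∀ᶠ n : ℕ in atTop, 1 / ((n:ℝ) + 8) < ρ := by
      have : Tendsto (fun n : ℕ => 1 / ((n:ℝ) + 8)) atTop (𝓝 0) := by
        have : Tendsto (fun n : ℕ => ((n:ℝ) + 8)) atTop atTop :=
          tendsto_atTop_add_const_right _ _ tendsto_natCast_atTop_atTop
        simpa [Function.comp_def] using tendsto_inv_atTop_zero.comp this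
      exact this.eventually (gt_mem_nhds hρ0)
    obtain ⟨n1, hn1⟩ := eventually_atTop.1 hev
    have g1 := hn0 (max n0 n1) (le_max_left _ _)
    have g2 := key _ (by positivity) (hn1 (max n0 n1) (le_max_right _ _))
    have g3 := (abs_le.1 g1).2
    rw [add_mul, zero_add]
    linarith
  have : ψt qb - η / 2 + m ≤ 0 := by
    by_contra h
    push Not at h
    exact absurd hfinal (not_le.2 (mul_pos h hTpos))
  simp only [hm] at this
  linarith

end Part9

section Part10
open scoped RealInnerProductSpace

variable {N : ℕ} {p s lam Lam : ℝ} {K : Euc N → ℝ} {u : Euc N → ℝ → ℝ}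

lemma odd_zero (hK : IsKernel N p s lam Lam K) (P : Euc N) (δ ρ : ℝ) :
    ∫ z in annZ N δ ρ, Jp p (-⟪P, z⟫) * K z = 0 := by
  rw [← integral_indicator (annZ_meas _ _ _)]
  set F : Euc N → ℝ := (annZ N δ ρ).indicator fun z => Jp p (-⟪P, z⟫) * K z with hF
  have h : ∀ z, F (-z) = - F z := by
    intro z
    by_cases hz : z ∈ annZ N δ ρ
    · have hz' : -z ∈ annZ N δ ρ := by simpa [annZ] using hz
      rw [hF, indicator_of_mem hz, indicator_of_mem hz', inner_neg_right, Jp_neg, IsKernel.symm hK]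
      ring
    · have hz' : -z ∉ annZ N δ ρ := by simpa [annZ] using hz
      rw [hF, indicator_of_notMem hz, indicator_of_notMem hz', neg_zero]
  have h2 : ∫ z, F (-z) = ∫ z, F z := integral_neg_eq_self F volume
  simp_rw [h] at h2
  rw [integral_neg] at h2
  linarith

lemma hyper_null {P : Euc N} (hP : P ≠ 0) : ∀ᵐ z : Euc N, ⟪P, z⟫ ≠ 0 := by
  have := Measure.addHaar_submodule (volume : Measure (Euc N)) (LinearMap.ker (innerSL ℝ P).toLinearMap) (by
    intro h
    have : P ∈ LinearMap.ker (innerSL ℝ P).toLinearMap := by rw [h]; trivial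
    simp at this
    exact hP this)
  rw [ae_iff]
  refine le_antisymm ((measure_mono ?_).trans this.le) zero_le
  intro z hz
  simpa using hz

/-- Lemma S: small annuli. -/
lemma lemS (hN : 1 ≤ N) (hp : 1 < p) (hs : s ∈ Ioo (0:ℝ) 1) (hLam : 0 < Lam) :
    ∃ C > 0, ∀ K : Euc N → ℝ, IsKernel N p s lam Lam K → ∀ (P : Euc N) (M δ ρ : ℝ) (f : Euc N → ℝ),
      Continuous f → 0 < δ → 0 < ρ → P ≠ 0 → 0 ≤ M → M * ρ ≤ ‖P‖ →
      (∀ z, ‖z‖ < ρ → -⟪P, z⟫ - M * ‖z‖^2 ≤ f z) →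
      -(C * (‖P‖^(p-2) * M * ρ^(p-s*p))) ≤ ∫ z in annZ N δ ρ, Jp p (f z) * K z := by
  have hsp : 0 < s * p := mul_pos hs.1 (by linarith)
  have hγ : 0 < p - s * p := by nlinarith [hs.2]
  obtain ⟨C, hC, hI⟩ := I2 (N := N) hN (β := max (2-p) 0) (γ := p - s*p) (by rw [max_lt_iff]; constructor <;> linarith) hγ
  refine ⟨2*p*2^p*Lam*C, by positivity, fun K hK P M δ ρ f hf hδ hρ hP hM hMρ hfz => ?_⟩
  have hP0 : 0 < ‖P‖ := norm_pos_iff.2 hP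
  set e := (‖P‖⁻¹) • P with he
  have he1 : ‖e‖ = 1 := by rw [he, norm_smul, norm_inv, norm_norm, inv_mul_cancel₀ hP0.ne']
  have hPe : ∀ z, ⟪P, z⟫ = ‖P‖ * ⟪e, z⟫ := by
    intro z; rw [he, real_inner_smul_left, ← mul_assoc, mul_inv_cancel₀ hP0.ne', one_mul]
  have hIe := hI e he1 ρ hρ
  set w : Euc N → ℝ := fun z => (|⟪e,z⟫|/‖z‖)^(-(max (2-p) 0)) * ‖z‖^((p-s*p)-(N:ℝ)) with hw
  have hw0 : ∀ z, 0 ≤ w z := fun z => by simp only [hw]; positivity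
  have hwm : Measurable w := by simp only [hw]; fun_prop
  have hwi : IntegrableOn w (ball 0 ρ) := by
    refine ⟨hwm.aestronglyMeasurable, ?_⟩
    rw [hasFiniteIntegral_iff_ofReal (Eventually.of_forall hw0)]
    exact lt_of_le_of_lt hIe ENNReal.ofReal_lt_top
  have hwI : ∫ z in ball 0 ρ, w z ≤ C * ρ^(p-s*p) := by
    rw [integral_eq_lintegral_of_nonneg_ae (Eventually.of_forall hw0) hwm.aestronglyMeasurable]
    refine ENNReal.toReal_le_of_le_ofReal (by positivity) hIe
  have hsub : annZ N δ ρ ⊆ ball 0 ρ := fun z hz => by rw [mem_ball_zero_iff]; exact hz.2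
  have i1 : IntegrableOn (fun z => Jp p (f z) * K z) (annZ N δ ρ) := annZ_integrable hp hsp hLam hK hf hδ
  have i2 : IntegrableOn (fun z => Jp p (-⟪P, z⟫) * K z) (annZ N δ ρ) :=
    annZ_integrable hp hsp hLam hK (f := fun z => -⟪P, z⟫) (by fun_prop) hδ
  set c := 2*p*2^p*Lam*(‖P‖^(p-2) * M) with hc
  have hc0 : 0 ≤ c := by positivity
  have i3 : IntegrableOn (fun z => c * w z) (annZ N δ ρ) := (hwi.mono_set hsub).const_mul c
  have hle : ∫ z in annZ N δ ρ, (Jp p (-⟪P, z⟫) * K z - c * w z) ≤ ∫ z in annZ N δ ρ, Jp p (f z) * K z := by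
    apply integral_mono_ae (i2.sub i3) i1
    filter_upwards [ae_restrict_of_ae (hyper_null hP), ae_restrict_mem (annZ_meas _ _ _)] with z hz hz2
    have hz0 : 0 < ‖z‖ := lt_of_lt_of_le hδ hz2.1
    have hzne : z ≠ 0 := norm_pos_iff.1 hz0
    have hKz := (hK.2.2.2 z hzne).2
    have hB : M * ‖z‖^2 ≤ ‖P‖ * ‖z‖ := by
      have : M * ‖z‖ ≤ ‖P‖ := le_trans (by gcongr; exact hz2.2.le) hMρ
      nlinarith
    have hl := Jp_loss hp (l := ⟪P,z⟫) (Q := M*‖z‖^2) (B := ‖P‖*‖z‖) hz (by positivity) (abs_real_inner_le_norm _ _) hB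
    have hm := Jp_mono hp (hfz z hz2.2)
    have hKpos : 0 < K z := hK.2.1 z hzne
    have e1 : |⟪P,z⟫| / (‖P‖*‖z‖) = |⟪e,z⟫|/‖z‖ := by
      rw [hPe, abs_mul, abs_of_pos hP0, mul_div_mul_left _ _ hP0.ne']
    rw [e1] at hl
    set b := (|⟪e,z⟫|/‖z‖)^(-(max (2-p) 0)) with hb
    have hb0 : 0 ≤ b := by positivity
    have e2 : (2*p*2^p*(b * (‖P‖*‖z‖)^(p-2) * (M*‖z‖^2))) * (Lam * ‖z‖ ^ (-((N : ℝ) + s * p))) = c * w z := by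
      rw [Real.mul_rpow hP0.le hz0.le, hc, hw]
      have : ‖z‖^((p-s*p)-(N:ℝ)) = ‖z‖^(p-2) * ‖z‖^2 * ‖z‖ ^ (-((N : ℝ) + s * p)) := by
        rw [← Real.rpow_natCast ‖z‖ 2, ← Real.rpow_add hz0, ← Real.rpow_add hz0]
        congr 1; push_cast; ring
      simp only [this]
      ring
    have h3 : (2*p*2^p*(b * (‖P‖*‖z‖)^(p-2) * (M*‖z‖^2))) * K z ≤ c * w z := by
      rw [← e2]
      exact mul_le_mul_of_nonneg_left hKz (by positivity)
    have h4 : (Jp p (-⟪P,z⟫) - (2*p*2^p*(b * (‖P‖*‖z‖)^(p-2) * (M*‖z‖^2)))) * K z ≤ Jp p (f z) * K z := by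
      apply mul_le_mul_of_nonneg_right _ hKpos.le
      linarith
    rw [sub_mul] at h4
    show Jp p (-⟪P,z⟫) * K z - c * w z ≤ Jp p (f z) * K z
    linarith
  rw [integral_sub i2 i3, odd_zero hK, integral_const_mul] at hle
  refine le_trans ?_ hle
  have : ∫ z in annZ N δ ρ, w z ≤ C * ρ^(p-s*p) :=
    (setIntegral_mono_set hwi (Eventually.of_forall hw0) hsub.eventuallyLE).trans hwI
  have := mul_le_mul_of_nonneg_left this hc0
  rw [hc] at *
  linarith

end Part10

section Part11
open scoped RealInnerProductSpace

variable {N : ℕ} {p s lam Lam : ℝ} {K : Euc N → ℝ} {u : Euc N → ℝ → ℝ}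

/-- cut-off extension of a locally C² function -/
lemma extend_C2 {ψ : Euc N × ℝ → ℝ} {qb : Euc N × ℝ} (h : ContDiffAt ℝ 2 ψ qb) :
    ∃ Ψ : Euc N × ℝ → ℝ, ContDiff ℝ 2 Ψ ∧ ∃ R > 0, ∀ q ∈ closedBall qb R, Ψ q = ψ q := by
  have h1 := h.eventually (by simp)
  obtain ⟨R, hR, hb⟩ := Metric.eventually_nhds_iff.1 h1
  let χ : ContDiffBump qb := ⟨R/4, R/2, by linarith, by linarith⟩
  refine ⟨fun q => χ q * ψ q, ?_, R/4, by linarith, fun q hq => ?_⟩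
  · rw [contDiff_iff_contDiffAt]
    intro q
    by_cases hq : dist q qb < R
    · exact χ.contDiffAt.mul (hb hq)
    · have : (fun q => χ q * ψ q) =ᶠ[𝓝 q] fun _ => 0 := by
        have hopen : IsOpen {y : Euc N × ℝ | R/2 < dist y qb} := isOpen_lt continuous_const (by fun_prop)
        filter_upwards [hopen.mem_nhds (show R/2 < dist q qb by linarith)] with y hy
        rw [χ.zero_of_le_dist (le_of_lt hy), zero_mul]
      exact contDiffAt_const.congr_of_eventuallyEq this
  · simp only
    rw [χ.one_of_mem_closedBall hq, one_mul]

set_option maxHeartbeats 1000000 in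
lemma visc2 (S : Sol N p s lam Lam K u) {C0 : ℝ} (hC0 : 0 < C0)
    (hfar : ∀ᵐ t : ℝ, t ∈ Ioo (-2 : ℝ) 0 → ∀ x ∈ closedBall (0 : Euc N) (7/4),
        ∫⁻ y in {y : Euc N | 1/4 ≤ ‖x - y‖},
          ENNReal.ofReal |Jp p (u x t - u y t) * K (x - y)| ≤ ENNReal.ofReal C0)
    {qb : Euc N × ℝ} {ψ : Euc N × ℝ → ℝ} {d : ℝ} (h1 : ‖qb.1‖ < 7/4)
    (h2 : -2 < qb.2) (h3 : qb.2 < 0) (hψ : ContDiffAt ℝ 2 ψ qb)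
    (hd : HasDerivAt (fun τ => ψ (qb.1, τ)) d qb.2)
    (hgrad : ∃ v : Euc N, ∃ c > 0, ∀ᶠ h in 𝓝[>] (0:ℝ), ψ (qb.1 + h • v, qb.2) - ψ qb ≤ -(c * h))
    (hmax : ∀ᶠ q in 𝓝 qb, u q.1 q.2 - ψ q ≤ u qb.1 qb.2 - ψ qb) {e : ℝ} (he : 0 < e) :
    ∀ᶠ ρ in 𝓝[>] (0:ℝ), d + midInt p K u ρ (1/4) qb ≤ C0 + e := by
  have hp := S.hp
  have hsp : 0 < s * p := mul_pos S.hs.1 (by linarith)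
  have hγ : 0 < p - s * p := by nlinarith [S.hs.2]
  obtain ⟨CS, hCS, hS⟩ := lemS (N := N) (lam := lam) S.hN hp S.hs S.hLam
  have hψ1 : ContDiffAt ℝ 2 (fun q => ψ q + (‖q.1 - qb.1‖^2 + (q.2 - qb.2)^2)) qb := by
    apply hψ.add
    apply ContDiffAt.add
    · exact (ContDiffAt.norm_sq ℝ (by fun_prop))
    · fun_prop
  obtain ⟨Ψ, hΨ, R1, hR1, hΨe⟩ := extend_C2 hψ1
  have hΨd : Differentiable ℝ Ψ := hΨ.differentiable (by norm_num)
  have hΨ' : ContDiff ℝ 1 (fderiv ℝ Ψ) := hΨ.fderiv_right (by norm_num)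
  obtain ⟨K1, t1, ht1, hL1⟩ := hΨ'.contDiffAt.exists_lipschitzOnWith (x := qb)
  obtain ⟨K0, t0, ht0, hL0⟩ := (hΨ.of_le (by norm_num : (1:WithTop ℕ∞) ≤ 2)).contDiffAt.exists_lipschitzOnWith (x := qb)
  set P : Euc N × ℝ → Euc N := fun q => (InnerProductSpace.toDual ℝ (Euc N)).symm
    ((fderiv ℝ Ψ q).comp (ContinuousLinearMap.inl ℝ (Euc N) ℝ)) with hPdef
  have hPz : ∀ q z, ⟪P q, z⟫ = fderiv ℝ Ψ q (z, 0) := by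
    intro q z; simp [hPdef]
  have hPc : Continuous P := by
    apply (InnerProductSpace.toDual ℝ (Euc N)).symm.continuous.comp
    exact hΨ'.continuous.clm_comp continuous_const
  have hdΨ : fderiv ℝ Ψ qb (0, 1) = d := by
    have g1 : HasDerivAt (fun τ => Ψ (qb.1, τ)) (fderiv ℝ Ψ qb (0, 1)) qb.2 :=
      (hΨd qb).hasFDerivAt.comp_hasDerivAt qb.2 (f := fun τ => (qb.1, τ))
        ((hasDerivAt_const _ _).prodMk (hasDerivAt_id _))
    have g2 : HasDerivAt (fun τ => ψ (qb.1, τ) + (τ - qb.2)^2) (d + 2 * (qb.2 - qb.2)) qb.2 := by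
      refine hd.add ?_
      have := ((hasDerivAt_id qb.2).sub_const qb.2).fun_pow 2
      simpa using this
    rw [sub_self, mul_zero, add_zero] at g2
    refine g1.unique (g2.congr_of_eventuallyEq ?_)
    filter_upwards [closedBall_mem_nhds qb.2 hR1] with τ hτ
    rw [hΨe (qb.1, τ) (by rw [mem_closedBall, Prod.dist_eq]; simpa [hR1.le] using hτ)]
    simp
  have hPb : P qb ≠ 0 := by
    intro h0
    obtain ⟨v, c, hc, hv⟩ := hgrad
    have g0 : fderiv ℝ Ψ qb (v, 0) = 0 := by rw [← hPz, h0, inner_zero_left]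
    have g1 : HasDerivAt (fun h : ℝ => Ψ (qb.1 + h • v, qb.2)) (fderiv ℝ Ψ qb (v, 0)) 0 := by
      have a1 : HasDerivAt (fun h : ℝ => ((qb.1 + h • v, qb.2) : Euc N × ℝ)) (v, 0) 0 := by
        refine HasDerivAt.prodMk ?_ (hasDerivAt_const _ _)
        have := ((hasDerivAt_id (0:ℝ)).smul_const v).const_add qb.1
        simpa using this
      have a2 : HasFDerivAt Ψ (fderiv ℝ Ψ qb) ((fun h : ℝ => ((qb.1 + h • v, qb.2) : Euc N × ℝ)) 0) := by
        have := (hΨd qb).hasFDerivAt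
        simpa using this
      exact a2.comp_hasDerivAt (0:ℝ) a1
    rw [g0, hasDerivAt_iff_isLittleO] at g1
    have g2 := g1.def (show 0 < c/4 by linarith)
    have g3 := g2.filter_mono (nhdsWithin_le_nhds (s := Ioi (0:ℝ)))
    have g4 : ∀ᶠ h in 𝓝[>] (0:ℝ), h * ‖v‖^2 < c/4 := by
      have : ContinuousAt (fun h : ℝ => h * ‖v‖^2) 0 := by fun_prop
      have h0 : 0 * ‖v‖^2 < c/4 := by rw [zero_mul]; linarith
      exact (this.eventually (gt_mem_nhds h0)).filter_mono nhdsWithin_le_nhds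
    have g5 : ∀ᶠ h in 𝓝[>] (0:ℝ), h * ‖v‖ < R1 := by
      have : ContinuousAt (fun h : ℝ => h * ‖v‖) 0 := by fun_prop
      have h0 : 0 * ‖v‖ < R1 := by rw [zero_mul]; linarith
      exact (this.eventually (gt_mem_nhds h0)).filter_mono nhdsWithin_le_nhds
    have hself : ∀ᶠ h in 𝓝[>] (0:ℝ), 0 < h := self_mem_nhdsWithin
    obtain ⟨h, ⟨⟨⟨k3, k4⟩, k5⟩, kv⟩, hpos⟩ := ((((g3.and g4).and g5).and hv).and hself).exists
    rw [hΨe (qb.1 + h • v, qb.2) (by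
      rw [mem_closedBall, Prod.dist_eq]
      simp [dist_eq_norm, norm_smul, abs_of_pos hpos, k5.le, hR1.le])] at k3
    simp only [zero_smul, add_zero, sub_zero, smul_zero, Prod.mk.eta] at k3
    rw [hΨe qb (mem_closedBall_self hR1.le)] at k3
    simp only [add_sub_cancel_left, sub_self, norm_zero, norm_smul, Real.norm_eq_abs, abs_of_pos hpos] at k3
    have := (abs_le.1 k3).1
    rw [mul_pow] at this
    nlinarith
  have hPb0 : 0 < ‖P qb‖ := norm_pos_iff.2 hPb
  have ev1 : ∀ᶠ q in 𝓝 qb, ‖P qb‖ / 2 < ‖P q‖ :=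
    hPc.norm.continuousAt.eventually (lt_mem_nhds (by linarith))
  have ev2 : ∀ᶠ q in 𝓝 qb, ‖P q‖^(p-2) < ‖P qb‖^(p-2) + 1 :=
    (hPc.norm.continuousAt.rpow_const (Or.inl hPb0.ne')).eventually (gt_mem_nhds (by linarith))
  have ev := (((ev1.and ev2).and hmax).and (show ∀ᶠ q in 𝓝 qb, q ∈ t1 from ht1)).and (show ∀ᶠ q in 𝓝 qb, q ∈ t0 from ht0)
  obtain ⟨R2, hR2, hb⟩ := Metric.eventually_nhds_iff.1 ev
  obtain ⟨R, hR0, hRle⟩ : ∃ R > 0, R ≤ R1 ∧ R < R2 ∧ ‖qb.1‖ + R < 7/4 ∧ -2 < qb.2 - R ∧ qb.2 + R < 0 := by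
    refine ⟨min R1 (min (R2/2) (min ((7/4-‖qb.1‖)/2) (min ((qb.2+2)/2) (-qb.2/2)))), ?_, ?_⟩
    · have a1 : 0 < (7/4-‖qb.1‖)/2 := by linarith
      have a2 : 0 < (qb.2+2)/2 := by linarith
      have a3 : 0 < -qb.2/2 := by linarith
      positivity
    · set m := min R1 (min (R2/2) (min ((7/4-‖qb.1‖)/2) (min ((qb.2+2)/2) (-qb.2/2)))) with hm
      have b1 : m ≤ R1 := min_le_left _ _
      have b2 : m ≤ R2/2 := (min_le_right _ _).trans (min_le_left _ _)
      have b3 : m ≤ (7/4-‖qb.1‖)/2 := (min_le_right _ _).trans ((min_le_right _ _).trans (min_le_left _ _))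
      have b4 : m ≤ (qb.2+2)/2 := (min_le_right _ _).trans ((min_le_right _ _).trans ((min_le_right _ _).trans (min_le_left _ _)))
      have b5 : m ≤ -qb.2/2 := (min_le_right _ _).trans ((min_le_right _ _).trans ((min_le_right _ _).trans (min_le_right _ _)))
      refine ⟨b1, by linarith, by linarith, by linarith, by linarith⟩
  obtain ⟨r1, r2, r3, r4, r5⟩ := hRle
  have hbR : ∀ q ∈ closedBall qb R, _ := fun q hq => hb (lt_of_le_of_lt (mem_closedBall.1 hq) r2)
  set M : ℝ := (K1 : ℝ) with hM
  have hM0 : 0 ≤ M := K1.2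
  set Acoef := CS * ((‖P qb‖^(p-2)+1) * M) with hAc
  have hAc0 : 0 ≤ Acoef := by positivity
  have lim1 : ∀ᶠ ρ in 𝓝[>] (0:ℝ), Acoef * ρ^(p-s*p) < e := by
    have : ContinuousAt (fun ρ : ℝ => Acoef * ρ^(p-s*p)) 0 :=
      continuousAt_const.mul (continuousAt_id.rpow_const (Or.inr hγ.le))
    have h0 : Acoef * (0:ℝ)^(p-s*p) < e := by rw [Real.zero_rpow hγ.ne', mul_zero]; exact he
    exact (this.eventually (gt_mem_nhds h0)).filter_mono nhdsWithin_le_nhds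
  have lim2 : ∀ᶠ ρ in 𝓝[>] (0:ℝ), ρ < min (R/2) (1/8) :=
    (gt_mem_nhds (by positivity)).filter_mono nhdsWithin_le_nhds
  have lim3 : ∀ᶠ ρ in 𝓝[>] (0:ℝ), M * ρ < ‖P qb‖/2 := by
    have : ContinuousAt (fun ρ : ℝ => M * ρ) 0 := by fun_prop
    have h0 : M * 0 < ‖P qb‖/2 := by rw [mul_zero]; linarith
    exact (this.eventually (gt_mem_nhds h0)).filter_mono nhdsWithin_le_nhds
  filter_upwards [lim1, lim2, lim3, self_mem_nhdsWithin] with ρ l1 l2 l3 hρ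
  have hρ0 : 0 < ρ := hρ
  have l2a := l2.trans_le (min_le_left _ _)
  have l2b := l2.trans_le (min_le_right _ _)
  have hm2 : ∀ q ∈ closedBall qb R, u q.1 q.2 - Ψ q ≤ u qb.1 qb.2 - Ψ qb - dist q qb ^ 2 := by
    intro q hq
    have hq' := (hbR q hq).1.1.2
    rw [hΨe q (closedBall_subset_closedBall r1 hq), hΨe qb (mem_closedBall_self hR1.le)]
    have : dist q qb ^ 2 ≤ ‖q.1 - qb.1‖^2 + (q.2 - qb.2)^2 := by
      rw [Prod.dist_eq, dist_eq_norm, Real.dist_eq]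
      rcases max_cases ‖q.1 - qb.1‖ |q.2 - qb.2| with h | h
      · rw [h.1]; nlinarith [sq_nonneg (q.2 - qb.2)]
      · rw [h.1, sq_abs]; nlinarith [sq_nonneg ‖q.1 - qb.1‖]
    simp only [sub_self, norm_zero]
    linarith
  have := visc S hC0 hfar (qb := qb) (R := R) (ρ := ρ) (Lip := K0) (A := -e) (ψ := Ψ)
    (ψt := fun q => fderiv ℝ Ψ q (0,1)) hρ0 (by linarith) l2b.le r3 r4 r5 hΨ.continuous
    (hΨ'.continuous.clm_apply continuous_const) ?_ ?_ hm2 ?_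
  · simp only [hdΨ] at this
    linarith
  · intro q hq
    have g := (hΨd q).hasFDerivAt.comp_hasDerivAt q.2 (f := fun τ => (q.1, τ))
      ((hasDerivAt_const _ _).prodMk (hasDerivAt_id _))
    exact g
  · intro x y t hx hy
    have := hL0.dist_le_mul _ (hbR _ hx).2 _ (hbR _ hy).2
    rw [Real.dist_eq, Prod.dist_eq] at this
    simpa [dist_eq_norm] using this
  · intro q hq δ hδ hδρ
    have hqR : q ∈ closedBall qb R := closedBall_subset_closedBall (by linarith) hq
    have hq1 := (hbR q hqR).1.1.1
    have hqP : P q ≠ 0 := by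
      rw [← norm_pos_iff]; linarith [hq1.1]
    have := hS K S.ker (P q) M δ ρ (fun z => Ψ q - Ψ (q.1 + z, q.2)) ?_ hδ hρ0 hqP hM0 (by linarith [hq1.1]) ?_
    · refine le_trans ?_ this
      rw [neg_le_neg_iff]
      refine le_trans ?_ l1.le
      rw [hAc]
      have : ‖P q‖^(p-2) * M * ρ^(p-s*p) ≤ (‖P qb‖^(p-2)+1) * M * ρ^(p-s*p) := by
        have := hq1.2.le
        gcongr
      nlinarith
    · exact continuous_const.sub (hΨ.continuous.comp (by fun_prop))
    · intro z hz
      rw [hPz]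
      have hsubs : closedBall q ‖z‖ ⊆ closedBall qb R := by
        apply closedBall_subset_closedBall'
        have := mem_closedBall.1 hq
        linarith
      have hy : (q.1 + z, q.2) ∈ closedBall q ‖z‖ := by
        rw [mem_closedBall, Prod.dist_eq]; simp [dist_eq_norm]
      have := (convex_closedBall q ‖z‖).norm_image_sub_le_of_norm_fderiv_le' (𝕜 := ℝ) (f := Ψ) (C := M * ‖z‖)
        (φ := fderiv ℝ Ψ q) (fun x _ => hΨd x) (fun x hx => by
          have g1 := hL1.dist_le_mul x (hbR x (hsubs hx)).1.2 q (hbR q hqR).1.2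
          rw [dist_eq_norm] at g1
          refine g1.trans ?_
          have := mem_closedBall.1 hx
          gcongr) (mem_closedBall_self (norm_nonneg z)) hy
      have e1 : ((q.1 + z, q.2) - q : Euc N × ℝ) = (z, 0) := by
        ext1 <;> simp
      rw [e1] at this
      have e2 : ‖((z, 0) : Euc N × ℝ)‖ = ‖z‖ := by simp [Prod.norm_def]
      rw [e2, Real.norm_eq_abs] at this
      have h9 := (abs_le.1 this).2
      have e3 : M * ‖z‖ * ‖z‖ = M * ‖z‖^2 := by ring
      rw [e3] at h9
      have e4 : Ψ (q.1 + z, q.2) - Ψ q - (fderiv ℝ Ψ q) (z, 0) ≤ M * ‖z‖^2 := h9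
      clear_value M
      linarith

end Part11

section Part12
open scoped RealInnerProductSpace

def phi (θ r : ℝ) : ℝ := r - r^(1+θ)/16
def dphi (θ r : ℝ) : ℝ := 1 - (1+θ)*r^θ/16

variable {N : ℕ} {θ r r' β : ℝ}

lemma rpow_le4 (hθ : 0 < θ) (hθ1 : θ ≤ 1) (hr : 0 ≤ r) (hr4 : r ≤ 4) : r^θ ≤ 4 := by
  calc r^θ ≤ 4^θ := by gcongr
    _ ≤ 4^(1:ℝ) := by gcongr; norm_num
    _ = 4 := by norm_num

lemma rpow_split (hθ : 0 < θ) (hr : 0 ≤ r) : r^(1+θ) = r * r^θ := by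
  rw [Real.rpow_add' hr (by linarith), Real.rpow_one]

lemma phi_le (hr : 0 ≤ r) : phi θ r ≤ r := by
  unfold phi; have : 0 ≤ r^(1+θ) := by positivity
  linarith

lemma phi_ge (hθ : 0 < θ) (hθ1 : θ ≤ 1) (hr : 0 ≤ r) (hr4 : r ≤ 4) : r/2 ≤ phi θ r := by
  unfold phi; rw [rpow_split hθ hr]
  nlinarith [rpow_le4 hθ hθ1 hr hr4]

lemma dphi_le (hθ : 0 < θ) (hr : 0 ≤ r) : dphi θ r ≤ 1 := by
  unfold dphi; have : 0 ≤ r^θ := by positivity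
  have : 0 ≤ (1+θ)*r^θ := by positivity
  linarith

lemma dphi_ge (hθ : 0 < θ) (hθ1 : θ ≤ 1) (hr : 0 ≤ r) (hr4 : r ≤ 4) : 1/2 ≤ dphi θ r := by
  unfold dphi
  have h1 : 0 ≤ r^θ := by positivity
  have := rpow_le4 hθ hθ1 hr hr4
  nlinarith

lemma phi_tangent (hθ : 0 < θ) (hr : 0 < r) (hr' : 0 ≤ r') :
    phi θ r' ≤ phi θ r + dphi θ r * (r' - r) := by
  have h1 : 1 + (1+θ) * ((r'-r)/r) ≤ (1 + (r'-r)/r)^(1+θ) :=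
    one_add_mul_self_le_rpow_one_add (by rw [le_div_iff₀ hr]; linarith) (by linarith)
  have e1 : 1 + (r'-r)/r = r'/r := by field_simp; ring
  rw [e1, Real.div_rpow hr' hr.le, le_div_iff₀ (by positivity)] at h1
  have e2 : (1 + (1+θ) * ((r'-r)/r)) * r^(1+θ) = r^(1+θ) + (1+θ)*r^θ*(r'-r) := by
    rw [rpow_split hθ hr.le]; field_simp
  rw [e2] at h1
  unfold phi dphi
  linarith

lemma rpow_strong (hθ : 0 < θ) (hθ1 : θ ≤ 1) {y : ℝ} (h1 : -(1/2) ≤ y) (h2 : y ≤ 1/2) :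
    1 + (1+θ)*y + θ^2/3*y^2 ≤ (1+y)^(1+θ) := by
  have hy : 0 < 1 + y := by linarith
  set v := y/(1+y) with hv
  have hvy : v * (1+y) = y := by rw [hv]; field_simp
  have hv1 : -1 ≤ v := by rw [hv, le_div_iff₀ hy]; linarith
  have hv2 : v ≤ 1/3 := by rw [hv, div_le_iff₀ hy]; linarith
  have hb := rpow_one_add_le_one_add_mul_self (s := -v) (p := θ) (by linarith) hθ.le hθ1
  have e1 : 1 + -v = (1+y)⁻¹ := by rw [hv]; field_simp; ring
  rw [e1, Real.inv_rpow hy.le] at hb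
  have hx : 0 < 1 - θ * v := by nlinarith
  have hpos : 0 < (1+y)^θ := by positivity
  have hb2 : 1 ≤ (1 - θ*v) * (1+y)^θ := by
    rw [inv_le_iff_one_le_mul₀ hpos] at hb
    linarith
  -- lower bound (1+y)^θ
  have hq : 1 + θ*v + (θ*v)^2/2 ≤ (1+y)^θ := by
    have h3 : (1 - θ*v) * (1 + θ*v + (θ*v)^2/2) ≤ (1 - θ*v) * (1+y)^θ := by
      refine le_trans ?_ hb2
      have : -1 ≤ θ * v := by nlinarith
      nlinarith [sq_nonneg (θ*v), mul_nonneg (sq_nonneg (θ*v)) (show 0 ≤ 1 + θ*v by linarith)]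
    exact le_of_mul_le_mul_left h3 hx
  rw [rpow_split hθ hy.le]
  have h4 : (1+y) * (1 + θ*v + (θ*v)^2/2) ≤ (1+y) * (1+y)^θ := by gcongr
  refine le_trans ?_ h4
  have e3 : (1+y) * (1 + θ*v + (θ*v)^2/2) = 1 + y + θ*y + θ^2 * (y * v)/2 := by
    have : (1+y)*(θ*v) = θ*y := by
      calc (1+y)*(θ*v) = θ*(v*(1+y)) := by ring
        _ = _ := by rw [hvy]
    have h5 : (1+y)*((θ*v)^2) = θ^2*(y*v) := by
      calc (1+y)*((θ*v)^2) = θ^2*((v*(1+y))*v) := by ring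
        _ = _ := by rw [hvy]
    linarith [this, h5]
  rw [e3]
  have h6 : 2/3 * y^2 ≤ y*v := by
    rw [hv, ← mul_div_assoc, le_div_iff₀ hy]; nlinarith [sq_nonneg y]
  nlinarith [sq_nonneg θ]

lemma phi_expand (hθ : 0 < θ) (hθ1 : θ ≤ 1) (hr : 0 < r) (h : |r' - r| ≤ r/2) :
    phi θ r' ≤ phi θ r + dphi θ r * (r' - r) - θ^2/48 * (r^(1+θ) * ((r'-r)/r)^2) := by
  rw [abs_le] at h
  have hr' : 0 ≤ r' := by linarith
  have h1 := rpow_strong hθ hθ1 (y := (r'-r)/r) (by rw [le_div_iff₀ hr]; linarith) (by rw [div_le_iff₀ hr]; linarith)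
  have e1 : 1 + (r'-r)/r = r'/r := by field_simp; ring
  rw [e1, Real.div_rpow hr' hr.le, le_div_iff₀ (by positivity)] at h1
  have e2 : (1+θ) * ((r'-r)/r) * r^(1+θ) = (1+θ)*r^θ*(r'-r) := by
    rw [rpow_split hθ hr.le]; field_simp
  have e3 : (1 + (1+θ) * ((r'-r)/r) + θ^2/3*((r'-r)/r)^2) * r^(1+θ) = r^(1+θ) + (1+θ) * ((r'-r)/r) * r^(1+θ)
     + θ^2/3 * (r^(1+θ) * ((r'-r)/r)^2) := by ring
  rw [e3, e2] at h1
  unfold phi dphi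
  linarith

lemma norm_add_upper {a z : Euc N} (ha : a ≠ 0) :
    ‖a + z‖ ≤ ‖a‖ + ⟪a,z⟫/‖a‖ + ‖z‖^2/(2*‖a‖) := by
  have hr : 0 < ‖a‖ := norm_pos_iff.2 ha
  have h := norm_add_sq_real a z
  have h2 : ‖a+z‖ * (2*‖a‖) ≤ ‖a‖^2 + ‖a+z‖^2 := by nlinarith [sq_nonneg (‖a+z‖-‖a‖)]
  have e : ‖a‖ + ⟪a,z⟫/‖a‖ + ‖z‖^2/(2*‖a‖) = (‖a‖^2 + (‖a‖^2 + 2*⟪a,z⟫+‖z‖^2))/(2*‖a‖) := by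
    field_simp; ring
  rw [e, le_div_iff₀ (by positivity), ← h]
  exact h2

lemma norm_add_lower {a z : Euc N} (ha : a ≠ 0) :
    ‖a‖ + ⟪a,z⟫/‖a‖ ≤ ‖a + z‖ := by
  have hr : 0 < ‖a‖ := norm_pos_iff.2 ha
  have h := real_inner_le_norm a (a+z)
  rw [inner_add_right, real_inner_self_eq_norm_sq] at h
  have e : ‖a‖ + ⟪a,z⟫/‖a‖ = (‖a‖^2 + ⟪a,z⟫)/‖a‖ := by field_simp
  rw [e, div_le_iff₀ hr]; linarith

lemma phi_vec (hθ : 0 < θ) (hθ1 : θ ≤ 1) {a z : Euc N} (ha : a ≠ 0) (h4 : ‖a‖ ≤ 4) :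
    phi θ ‖a+z‖ ≤ phi θ ‖a‖ + dphi θ ‖a‖ * (⟪a,z⟫/‖a‖) + ‖z‖^2/(2*‖a‖) := by
  have hr : 0 < ‖a‖ := norm_pos_iff.2 ha
  have h1 := phi_tangent hθ hr (norm_nonneg (a+z))
  have h2 := norm_add_upper (z := z) ha
  have h3 := dphi_le hθ hr.le (r := ‖a‖)
  have h5 := dphi_ge hθ hθ1 hr.le h4
  have h6 : 0 ≤ ‖z‖^2/(2*‖a‖) := by positivity
  have h7 : dphi θ ‖a‖ * (‖a+z‖-‖a‖) ≤ dphi θ ‖a‖ * (⟪a,z⟫/‖a‖ + ‖z‖^2/(2*‖a‖)) :=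
    mul_le_mul_of_nonneg_left (by linarith) (by linarith)
  nlinarith

lemma phi_lip_vec (hθ : 0 < θ) (hθ1 : θ ≤ 1) {a z : Euc N} (ha : a ≠ 0) (h4 : ‖a‖ ≤ 4) :
    phi θ ‖a+z‖ ≤ phi θ ‖a‖ + ‖z‖ := by
  have hr : 0 < ‖a‖ := norm_pos_iff.2 ha
  have h1 := phi_tangent hθ hr (norm_nonneg (a+z))
  have h3 := dphi_le hθ hr.le (r := ‖a‖)
  have h5 := dphi_ge hθ hθ1 hr.le h4
  have h2 := norm_add_le a z
  have h7 : dphi θ ‖a‖ * (‖a+z‖-‖a‖) ≤ dphi θ ‖a‖ * ‖z‖ :=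
    mul_le_mul_of_nonneg_left (by linarith) (by linarith)
  nlinarith [norm_nonneg z]

/-- strong gain -/
lemma phi_gain (hθ : 0 < θ) (hθ1 : θ ≤ 1) {a z : Euc N} (ha : a ≠ 0) (h4 : ‖a‖ ≤ 1)
    (hz : ‖z‖ ≤ ‖a‖/2) (hs : ‖a‖/8 ≤ |⟪a,z⟫/‖a‖|)
    (hperp : ‖z‖^2 - (⟪a,z⟫/‖a‖)^2 ≤ (θ/160)^2 * (‖a‖ * ‖a‖^(1+θ))) :
    phi θ ‖a+z‖ ≤ phi θ ‖a‖ + dphi θ ‖a‖ * (⟪a,z⟫/‖a‖) - θ^2/25600 * ‖a‖^(1+θ) := by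
  have hr : 0 < ‖a‖ := norm_pos_iff.2 ha
  set r := ‖a‖ with hrd
  set sg := ⟪a,z⟫/r with hsg
  have hin : ⟪a,z⟫ = sg * r := by rw [hsg]; field_simp
  have hsz : |sg| ≤ ‖z‖ := by
    rw [hsg, abs_div, abs_of_pos hr, div_le_iff₀ hr]
    have := abs_real_inner_le_norm a z
    linarith
  have hs2 := abs_le.1 (hsz.trans hz)
  have hX : r^(1+θ) ≤ r := by
    calc r^(1+θ) ≤ r^(1:ℝ) := Real.rpow_le_rpow_of_exponent_ge hr h4 (by linarith)
      _ = r := Real.rpow_one r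
  set X := r^(1+θ) with hXd
  have hX0 : 0 ≤ X := by positivity
  have hnorm : ‖a+z‖^2 = (r+sg)^2 + (‖z‖^2 - sg^2) := by
    rw [norm_add_sq_real, hin]; ring
  have hlow : r + sg ≤ ‖a+z‖ := norm_add_lower ha
  have hup : ‖a+z‖ ≤ r + sg + (θ/160)^2 * X := by
    have h1 : ‖a+z‖ * (2*(r+sg)) ≤ (r+sg)^2 + ‖a+z‖^2 := by nlinarith [sq_nonneg (‖a+z‖-(r+sg))]
    rw [hnorm] at h1
    have h2 : ‖a+z‖ * (2*(r+sg)) ≤ (r + sg + (θ/160)^2 * X) * (2 * (r+sg)) := by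
      have : r ≤ 2*(r+sg) := by linarith [hs2.1]
      have h3 : (θ/160)^2 * (r*X) ≤ (θ/160)^2 * X * (2*(r+sg)) := by
        calc (θ/160)^2 * (r*X) = (θ/160)^2 * X * r := by ring
          _ ≤ _ := by gcongr
      nlinarith
    exact le_of_mul_le_mul_right h2 (by linarith [hs2.1])
  have hθ2 : (θ/160)^2 ≤ 1/25600 := by nlinarith
  have hsmall : (θ/160)^2 * X ≤ r/16 := by nlinarith
  have hd : (r/16) ≤ |‖a+z‖ - r| := by
    rcases le_total 0 sg with h | h
    · rw [abs_of_nonneg h] at hs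
      rw [abs_of_nonneg (by linarith)]; linarith
    · rw [abs_of_nonpos h] at hs
      rw [abs_of_nonpos (by linarith)]; linarith
  have hd2 : |‖a+z‖ - r| ≤ r/2 := by
    have := abs_norm_sub_norm_le (a+z) a
    rw [add_sub_cancel_left] at this
    exact this.trans hz
  have h1 := phi_expand hθ hθ1 hr hd2
  have h2 : 1/256 ≤ ((‖a+z‖-r)/r)^2 := by
    rw [div_pow, le_div_iff₀ (by positivity), ← sq_abs (‖a+z‖-r)]
    nlinarith
  have h3 := dphi_le hθ hr.le (r := r)
  have h5 := dphi_ge hθ hθ1 hr.le (by linarith)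
  have h7 : dphi θ r * (‖a+z‖-r) ≤ dphi θ r * (sg + (θ/160)^2 * X) :=
    mul_le_mul_of_nonneg_left (by linarith) (by linarith)
  have h8 : dphi θ r * ((θ/160)^2 * X) ≤ 1 * ((θ/160)^2 * X) := by gcongr
  have h9 : θ^2/48 * (X * (1/256)) ≤ θ^2/48 * (X * ((‖a+z‖-r)/r)^2) := by gcongr
  have h10 : 0 ≤ θ^2 * X := by positivity
  have e5 : (θ/160)^2 * X = θ^2 * X / 25600 := by ring
  rw [mul_add] at h7
  linarith

end Part12

section Part13
open scoped RealInnerProductSpace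

def eta {N : ℕ} (q : Euc N × ℝ) : ℝ := (9/4 - ‖q.1‖^2) * ((q.2+3/2)/4)
def gg {N : ℕ} (β : ℝ) (q : Euc N × ℝ) : ℝ := eta q ^ (-β)

variable {N : ℕ} {θ β : ℝ} {x z a : Euc N} {t : ℝ}

lemma eta_cont : Continuous (eta (N := N)) := by unfold eta; fun_prop

lemma eta_pos (hx : ‖x‖ < 3/2) (ht : -(3/2) < t) : 0 < eta (x, t) := by
  unfold eta
  have : 0 < 9/4 - ‖x‖^2 := by nlinarith [norm_nonneg x]
  have : 0 < (t+3/2)/4 := by linarith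
  simp only; positivity

lemma eta_lt_one (hx : ‖x‖ ≤ 3/2) (ht : -(3/2) ≤ t) (ht0 : t ≤ 0) : eta (x, t) < 1 := by
  unfold eta
  have h1 : 0 ≤ 9/4 - ‖x‖^2 := by nlinarith [norm_nonneg x]
  have h2 : 9/4 - ‖x‖^2 ≤ 9/4 := by nlinarith [norm_nonneg x]
  have h3 : 0 ≤ (t+3/2)/4 := by linarith
  have h4 : (t+3/2)/4 ≤ 3/8 := by linarith
  simp only
  calc (9/4 - ‖x‖^2) * ((t+3/2)/4) ≤ 9/4 * (3/8) := by gcongr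
    _ < 1 := by norm_num

lemma gg_one_le (hβ : 0 ≤ β) (hx : ‖x‖ < 3/2) (ht : -(3/2) < t) (ht0 : t ≤ 0) : 1 ≤ gg β (x, t) := by
  unfold gg
  exact Real.one_le_rpow_of_pos_of_le_one_of_nonpos (eta_pos hx ht) (eta_lt_one hx.le ht.le ht0).le (by linarith)

lemma bern (hβ : 1 ≤ β) {w : ℝ} (hw : |w| ≤ 1/(2*β)) :
    (1+w)^(-β) ≤ 1 - β*w + 2*β^2*w^2 ∧ 1 - 2*β*|w| ≤ (1+w)^(-β) := by
  have hβ0 : 0 < β := by linarith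
  have hbw : β * |w| ≤ 1/2 := by
    rw [le_div_iff₀ (by positivity)] at hw; linarith
  have hw2 : |w| ≤ 1/2 := by nlinarith [abs_nonneg w]
  have hbw' : -(1/2) ≤ β*w ∧ β*w ≤ 1/2 := by
    rw [← abs_le, abs_mul, abs_of_pos hβ0]; exact hbw
  have hw3 := abs_le.1 hw2
  have h1w : 0 < 1 + w := by linarith
  constructor
  · have h1 := one_add_mul_self_le_rpow_one_add (s := w) (p := β) (by linarith) hβ
    rw [Real.rpow_neg h1w.le]
    have h2 : 0 < 1 + β*w := by linarith
    refine (inv_anti₀ h2 h1).trans ?_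
    rw [inv_le_iff_one_le_mul₀ h2]
    nlinarith [mul_nonneg (sq_nonneg (β*w)) (show 0 ≤ 1/2 + β*w by linarith)]
  · have h1 := one_add_mul_self_le_rpow_one_add (s := -(w/(1+w))) (p := β) (by
      rw [neg_le_neg_iff, div_le_one h1w]; linarith) hβ
    have e : 1 + -(w/(1+w)) = (1+w)⁻¹ := by field_simp; ring
    rw [e, Real.inv_rpow h1w.le, ← Real.rpow_neg h1w.le] at h1
    refine le_trans ?_ h1
    have : w/(1+w) ≤ 2*|w| := by
      rw [div_le_iff₀ h1w]
      nlinarith [abs_nonneg w, le_abs_self w]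
    nlinarith

/-- the vector giving the gradient of g in x -/
def gV {N : ℕ} (β : ℝ) (q : Euc N × ℝ) : Euc N := (2*β*gg β q*((q.2+3/2)/4)/eta q) • q.1

lemma gV_norm (hβ : 1 ≤ β) (hx : ‖x‖ < 3/2) (ht : -(3/2) < t) (ht0 : t ≤ 0) :
    ‖gV β (x,t)‖ ≤ 2*β*gg β (x,t)/eta (x,t) := by
  have hη := eta_pos hx ht
  have hg : 0 < gg β (x,t) := Real.rpow_pos_of_pos hη _
  have h3 : 0 < (t+3/2)/4 := by linarith
  have hβ0 : 0 < β := by linarith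
  unfold gV
  rw [norm_smul, Real.norm_eq_abs]
  simp only
  rw [abs_of_pos (by positivity)]
  calc 2*β*gg β (x,t)*((t+3/2)/4)/eta (x,t) * ‖x‖ = 2*β*gg β (x,t)/eta (x,t) * (((t+3/2)/4)*‖x‖) := by ring
    _ ≤ 2*β*gg β (x,t)/eta (x,t) * 1 := by
      gcongr
      nlinarith [norm_nonneg x]
    _ = _ := by ring

lemma g_expand (hβ : 1 ≤ β) (hx : ‖x‖ < 3/2) (ht : -(3/2) < t) (ht0 : t ≤ 0)
    (hz : ‖z‖ ≤ eta (x,t) / (4*β)) :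
    0 < eta (x+z, t) ∧ ‖x+z‖ < 3/2 ∧
    gg β (x+z,t) - gg β (x,t) ≤ ⟪gV β (x,t), z⟫ + 9*β^2*gg β (x,t)*‖z‖^2/(eta (x,t))^2 ∧
    |gg β (x+z,t) - gg β (x,t)| ≤ 4*β*gg β (x,t)*‖z‖/eta (x,t) := by
  have hη := eta_pos hx ht
  have hη1 := eta_lt_one hx.le ht.le ht0
  have hβ0 : 0 < β := by linarith
  set η := eta (x,t) with hηd
  set T := (t+3/2)/4 with hT
  have hT0 : 0 < T := by rw [hT]; linarith
  have hT1 : T ≤ 3/8 := by rw [hT]; linarith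
  set w := -(2*⟪x,z⟫+‖z‖^2)*T/η with hw
  have hz1 : ‖z‖ ≤ 1 := by
    refine hz.trans ?_
    rw [div_le_one (by positivity)]; linarith
  have hin := abs_real_inner_le_norm x z
  have hin' : |⟪x,z⟫| ≤ 3/2*‖z‖ := hin.trans (by gcongr)
  have hw1 : |w| ≤ 2*‖z‖/η := by
    rw [hw, abs_div, abs_of_pos hη]
    gcongr
    rw [abs_mul, abs_neg, abs_of_pos hT0]
    have : |2*⟪x,z⟫+‖z‖^2| ≤ 4*‖z‖ := by
      rw [abs_le] at hin' ⊢
      constructor <;> nlinarith [norm_nonneg z]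
    nlinarith [abs_nonneg (2*⟪x,z⟫+‖z‖^2)]
  have hw2 : |w| ≤ 1/(2*β) := by
    refine hw1.trans ?_
    rw [le_div_iff₀ (by positivity)] at hz
    rw [div_le_div_iff₀ hη (by positivity)]
    linarith
  have he : eta (x+z,t) = η * (1+w) := by
    have : η * (1+w) = η - (2*⟪x,z⟫+‖z‖^2)*T := by rw [hw]; field_simp; ring
    rw [this, hηd]
    unfold eta
    simp only
    rw [norm_add_sq_real]; ring
  have hbw : β * |w| ≤ 1/2 := by
    rw [le_div_iff₀ (by positivity)] at hw2; linarith
  have hwh : |w| ≤ 1/2 := by nlinarith [abs_nonneg w]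
  have h1w : 0 < 1 + w := by linarith [(abs_le.1 hwh).1]
  have hpos : 0 < eta (x+z,t) := by rw [he]; positivity
  have hg : 0 < gg β (x,t) := Real.rpow_pos_of_pos hη _
  set g := gg β (x,t) with hgd
  have hge : gg β (x+z,t) = g * (1+w)^(-β) := by
    have h0 : gg β (x+z,t) = eta (x+z,t)^(-β) := rfl
    rw [h0, he, Real.mul_rpow hη.le h1w.le]
    rfl
  obtain ⟨b1, b2⟩ := bern hβ hw2
  refine ⟨hpos, ?_, ?_, ?_⟩
  · by_contra h
    push Not at h
    have : eta (x+z,t) ≤ 0 := by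
      unfold eta
      simp only
      apply mul_nonpos_of_nonpos_of_nonneg _ hT0.le
      nlinarith
    linarith
  · rw [hge]
    have hV : ⟪gV β (x,t), z⟫ = g*(β*(2*⟪x,z⟫*T/η)) := by
      unfold gV
      rw [real_inner_smul_left]
      simp only [← hηd, ← hgd, ← hT]; ring
    rw [hV]
    have h1 : -(β*w) = β*(2*⟪x,z⟫*T/η) + β*‖z‖^2*T/η := by rw [hw]; ring
    have hww : w^2 ≤ 4*‖z‖^2/η^2 := by
      rw [← sq_abs w]
      calc |w|^2 ≤ (2*‖z‖/η)^2 := by gcongr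
        _ = _ := by ring
    have h2 : β*‖z‖^2*T/η ≤ β^2*‖z‖^2/η^2 := by
      rw [div_le_div_iff₀ hη (by positivity)]
      have : T * η ≤ 1 * 1 := by gcongr; linarith
      have hb : β ≤ β^2 := by nlinarith
      calc β*‖z‖^2*T*η^2 = β * ‖z‖^2 * (T*η) * η := by ring
        _ ≤ β^2 * ‖z‖^2 * (1*1) * η := by gcongr
        _ = _ := by ring
    have h3 : (1+w)^(-β) - 1 ≤ β*(2*⟪x,z⟫*T/η) + 9*β^2*‖z‖^2/η^2 := by
      have : 2*β^2*w^2 ≤ 2*β^2*(4*‖z‖^2/η^2) := by gcongr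
      have e : 2*β^2*(4*‖z‖^2/η^2) + β^2*‖z‖^2/η^2 = 9*β^2*‖z‖^2/η^2 := by ring
      linarith
    have := mul_le_mul_of_nonneg_left h3 hg.le
    have e : g*(β*(2*⟪x,z⟫*T/η) + 9*β^2*‖z‖^2/η^2) = g*(β*(2*⟪x,z⟫*T/η)) + 9*β^2*g*‖z‖^2/η^2 := by ring
    linarith
  · rw [hge]
    have h3 : |(1+w)^(-β) - 1| ≤ 2*β*|w| := by
      rw [abs_le]
      refine ⟨by linarith, ?_⟩
      have : 2*β^2*w^2 ≤ β*|w| := by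
        rw [← sq_abs w]
        nlinarith [mul_nonneg hβ0.le (abs_nonneg w)]
      have h5 : -(β*w) ≤ β*|w| := by nlinarith [neg_abs_le w]
      linarith
    have e : g * (1+w)^(-β) - g = g * ((1+w)^(-β) - 1) := by ring
    rw [e, abs_mul, abs_of_pos hg]
    calc g * |(1+w)^(-β) - 1| ≤ g * (2*β*(2*‖z‖/η)) := by
          gcongr; exact h3.trans (by gcongr)
      _ = _ := by ring

lemma gg_deriv (hβ : 1 ≤ β) (hx : ‖x‖ < 3/2) (ht : -(3/2) < t) :
    ∃ d, HasDerivAt (fun τ => gg β (x,τ)) d t ∧ -(β*gg β (x,t)/eta (x,t)) ≤ d := by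
  have hη := eta_pos hx ht
  have h1 : HasDerivAt (fun τ => eta (x,τ)) ((9/4 - ‖x‖^2) * (1/4)) t := by
    unfold eta
    have := (((hasDerivAt_id t).add_const (3/2)).div_const 4).const_mul (9/4 - ‖x‖^2)
    simpa using this
  refine ⟨_, h1.rpow_const (Or.inl hη.ne'), ?_⟩
  have hg : 0 < gg β (x,t) := Real.rpow_pos_of_pos hη _
  have e : eta (x,t) ^ (-β-1) = gg β (x,t) / eta (x,t) := by
    unfold gg; rw [Real.rpow_sub_one hη.ne']
  rw [e]
  have h2 : (9/4 - ‖x‖^2) * (1/4) ≤ 1 := by nlinarith [norm_nonneg x]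
  have h3 : 0 ≤ gg β (x,t) / eta (x,t) := by positivity
  have h4 : ((9/4 - ‖x‖^2) * (1/4)) * (β * (gg β (x,t) / eta (x,t))) ≤ 1 * (β * (gg β (x,t) / eta (x,t))) := by
    gcongr
  have e2 : β*gg β (x,t)/eta (x,t) = β * (gg β (x,t) / eta (x,t)) := by ring
  rw [e2]
  linarith

lemma gg_contDiffAt (hx : ‖x‖ < 3/2) (ht : -(3/2) < t) : ContDiffAt ℝ 2 (gg (N := N) β) (x,t) := by
  unfold gg
  apply ContDiffAt.rpow_const_of_ne _ (eta_pos hx ht).ne'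
  unfold eta
  apply ContDiffAt.mul
  · exact contDiffAt_const.sub (ContDiffAt.norm_sq ℝ (by fun_prop))
  · fun_prop

lemma phi_contDiffAt {r : ℝ} (hr : 0 < r) : ContDiffAt ℝ 2 (phi θ) r := by
  unfold phi
  exact contDiffAt_id.sub ((contDiffAt_id.rpow_const_of_ne hr.ne').div_const _)

end Part13

section Part14

def PhiF {N : ℕ} (L θ β κ ε : ℝ) (u : Euc N → ℝ → ℝ) (x y : Euc N) (t τ : ℝ) : ℝ :=
  u x t - u y τ - L * phi θ ‖x - y‖ * gg β (x, t) - κ/(-t) - (t-τ)^2/(2*ε)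

structure MaxPt {N : ℕ} (L θ β κ ε : ℝ) (u : Euc N → ℝ → ℝ) (xb yb : Euc N) (tb τb : ℝ) : Prop where
  hx : ‖xb‖ < 3/2
  ht : -(3/2) < tb
  ht0 : tb < 0
  hτ : -(7/4) < τb
  hτ0 : τb < 0
  hy : ‖yb‖ < 7/4
  hne : xb ≠ yb
  hsm : L * phi θ ‖xb - yb‖ * gg β (xb, tb) ≤ 2
  hmax : ∀ (x y : Euc N) (t τ : ℝ), ‖x‖ < 3/2 → -(3/2) < t → t < 0 → ‖y‖ ≤ 7/4 → -(7/4) ≤ τ → τ ≤ 0 →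
    PhiF L θ β κ ε u x y t τ ≤ PhiF L θ β κ ε u xb yb tb τb

variable {N : ℕ} {L θ β : ℝ} {u : Euc N → ℝ → ℝ}

set_option maxHeartbeats 1000000 in
lemma exists_max (hθ : 0 < θ) (hθ1 : θ ≤ 1) (hβ : 1 ≤ β) (hL : 64 ≤ L)
    (hu : Continuous (fun q : Euc N × ℝ => u q.1 q.2))
    (hb : ∀ x ∈ ball (0 : Euc N) 2, ∀ t ∈ Ioc (-2:ℝ) 0, |u x t| ≤ 1)
    {x0 y0 : Euc N} {t0 : ℝ} (hx0 : ‖x0‖ < 1) (hy0 : ‖y0‖ < 1) (ht0 : -1 < t0) (ht0' : t0 < 0)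
    (hbig : L * phi θ ‖x0 - y0‖ * gg β (x0, t0) < u x0 t0 - u y0 t0) :
    ∃ κ > 0, ∃ ε > 0, ∃ xb yb tb τb, MaxPt L θ β κ ε u xb yb tb τb := by
  have hL0 : 0 < L := by linarith
  have hβ0 : 0 < β := by linarith
  set m1 := u x0 t0 - u y0 t0 - L * phi θ ‖x0 - y0‖ * gg β (x0, t0) with hm1
  have hm1p : 0 < m1 := by rw [hm1]; linarith
  have hnn : ∀ x y : Euc N, ∀ t : ℝ, ‖x‖ < 3/2 → -(3/2) < t → t < 0 → ‖y‖ ≤ 7/4 →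
      ‖x-y‖ ≤ 4 ∧ 0 ≤ phi θ ‖x-y‖ ∧ 1 ≤ gg β (x,t) := by
    intro x y t hx ht ht0 hy
    have h1 : ‖x - y‖ ≤ 4 := (norm_sub_le x y).trans (by linarith)
    refine ⟨h1, ?_, gg_one_le hβ0.le hx ht ht0.le⟩
    have := phi_ge hθ hθ1 (norm_nonneg (x-y)) h1
    linarith [norm_nonneg (x-y)]
  have hub : ∀ x y : Euc N, ∀ t τ : ℝ, ‖x‖ < 3/2 → -(3/2) < t → t < 0 → ‖y‖ ≤ 7/4 → -(7/4) ≤ τ → τ ≤ 0 →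
      u x t - u y τ ≤ 2 := by
    intro x y t τ hx ht ht0 hy hτ hτ0
    have h1 := hb x (by rw [mem_ball_zero_iff]; linarith) t ⟨by linarith, ht0.le⟩
    have h2 := hb y (by rw [mem_ball_zero_iff]; linarith) τ ⟨by linarith, hτ0⟩
    rw [abs_le] at h1 h2
    linarith
  set κ := m1 * (-t0) / 4 with hκ
  have hκ0 : 0 < κ := by rw [hκ]; have : 0 < -t0 := by linarith
                         positivity
  have hm2 : m1 ≤ 2 := by
    have h1 := hub x0 y0 t0 t0 (by linarith) (by linarith) ht0' (by linarith) (by linarith) ht0'.le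
    have h2 := hnn x0 y0 t0 (by linarith) (by linarith) ht0' (by linarith)
    have h3 : 0 ≤ L * phi θ ‖x0 - y0‖ * gg β (x0, t0) :=
      mul_nonneg (mul_nonneg hL0.le h2.2.1) (by linarith [h2.2.2])
    rw [hm1]; linarith
  have hκ1 : κ ≤ 1/2 := by rw [hκ]; nlinarith
  set m0 := m1 * (3/4) with hm0
  have hm0p : 0 < m0 := by positivity
  -- uniform continuity
  have hcpt : IsCompact (closedBall (0 : Euc N) (7/4) ×ˢ Icc (-(7/4):ℝ) 0) :=
    (isCompact_closedBall _ _).prod isCompact_Icc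
  obtain ⟨ϱ, hϱ, hunif⟩ := Metric.uniformContinuousOn_iff.1
    (hcpt.uniformContinuousOn_of_continuous hu.continuousOn) m0 hm0p
  set δ1 := min (ϱ/2) (κ/4) with hδ1
  have hδ1p : 0 < δ1 := by positivity
  have hδ1a : δ1 ≤ ϱ/2 := min_le_left _ _
  have hδ1b : δ1 ≤ κ/4 := min_le_right _ _
  set ε := δ1^2/4 with hε
  have hε0 : 0 < ε := by positivity
  set G0 := 4/(L*ϱ) with hG0
  have hG0p : 0 < G0 := by positivity
  set η0 := G0^(-(1/β)) with hη0
  have hη0p : 0 < η0 := by positivity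
  have facts : ∀ (x y : Euc N) (t τ : ℝ), ‖x‖ < 3/2 → -(3/2) < t → t < 0 → ‖y‖ ≤ 7/4 → -(7/4) ≤ τ → τ ≤ 0 →
      m0 ≤ PhiF L θ β κ ε u x y t τ →
      κ/2 ≤ -t ∧ |t-τ| ≤ δ1 ∧ ‖x-y‖ ≤ 1/16 ∧ ϱ ≤ ‖x-y‖ ∧ η0 ≤ eta (x,t) ∧ L * phi θ ‖x-y‖ * gg β (x,t) ≤ 2 := by
    intro x y t τ hx ht ht0 hy hτ hτ0 hm
    obtain ⟨n1, n2, n3⟩ := hnn x y t hx ht ht0 hy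
    have n4 := hub x y t τ hx ht ht0 hy hτ hτ0
    have n5 : 0 ≤ L * phi θ ‖x - y‖ * gg β (x, t) := mul_nonneg (mul_nonneg hL0.le n2) (by linarith)
    have n6 : 0 < κ/(-t) := by have : 0 < -t := by linarith
                               positivity
    have n7 : 0 ≤ (t-τ)^2/(2*ε) := by positivity
    unfold PhiF at hm
    have f1 : κ/2 ≤ -t := by
      have : κ/(-t) ≤ 2 := by linarith
      rw [div_le_iff₀ (by linarith)] at this; linarith
    have f2 : |t-τ| ≤ δ1 := by
      have : (t-τ)^2/(2*ε) ≤ 2 := by linarith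
      rw [div_le_iff₀ (by positivity)] at this
      apply abs_le_of_sq_le_sq _ hδ1p.le
      rw [hε] at this; linarith
    have f6 : L * phi θ ‖x-y‖ * gg β (x,t) ≤ 2 := by linarith
    have n8 := phi_ge hθ hθ1 (norm_nonneg (x-y)) n1
    have f3 : ‖x-y‖ ≤ 1/16 := by
      have : L * phi θ ‖x-y‖ * 1 ≤ 2 := le_trans (mul_le_mul_of_nonneg_left n3 (mul_nonneg hL0.le n2)) f6
      nlinarith [norm_nonneg (x-y)]
    have f4 : ϱ ≤ ‖x-y‖ := by
      by_contra h
      push Not at h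
      have := hunif (x,t) ⟨by rw [mem_closedBall_zero_iff]; linarith, by constructor <;> linarith⟩ (y,τ)
        ⟨by rw [mem_closedBall_zero_iff]; exact hy, hτ, hτ0⟩ (by
          rw [Prod.dist_eq, max_lt_iff]
          refine ⟨by rw [dist_eq_norm]; exact h, ?_⟩
          rw [Real.dist_eq]; linarith)
      rw [Real.dist_eq] at this
      have := (abs_lt.1 this).2
      simp only at this
      linarith
    refine ⟨f1, f2, f3, f4, ?_, f6⟩
    have f5 : gg β (x,t) ≤ G0 := by
      rw [hG0, le_div_iff₀ (by positivity)]
      have : L * (ϱ/2) * gg β (x,t) ≤ L * phi θ ‖x-y‖ * gg β (x,t) := by gcongr; linarith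
      linarith
    have hη := eta_pos hx ht
    have : eta (x,t) = (gg β (x,t))^(-(1/β)) := by
      unfold gg
      rw [← Real.rpow_mul hη.le]
      have : -β * -(1/β) = 1 := by field_simp
      rw [this, Real.rpow_one]
    rw [this, hη0]
    exact Real.rpow_le_rpow_of_nonpos (by linarith) f5 (by rw [neg_nonpos]; positivity)
  have hstart : PhiF L θ β κ ε u x0 y0 t0 t0 = m0 := by
    unfold PhiF
    rw [hm0, hκ, sub_self]
    have : m1 * (-t0) / 4 / (-t0) = m1/4 := by
      have h0 : t0 ≠ 0 := by linarith
      field_simp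
    rw [this, ← hm1]; ring
  -- compact set
  let X : Set (Euc N × Euc N × ℝ × ℝ) :=
    (closedBall (0 : Euc N) (3/2) ×ˢ closedBall (0 : Euc N) (7/4) ×ˢ Icc (-(3/2)) (-(κ/2)) ×ˢ Icc (-(7/4)) 0) ∩
      {q | η0 ≤ eta (q.1, q.2.2.1)}
  have hX : IsCompact X := by
    apply IsCompact.inter_right
    · exact (isCompact_closedBall _ _).prod ((isCompact_closedBall _ _).prod (isCompact_Icc.prod isCompact_Icc))
    · exact isClosed_le continuous_const (eta_cont.comp (by fun_prop))
  let F : Euc N × Euc N × ℝ × ℝ → ℝ := fun q => PhiF L θ β κ ε u q.1 q.2.1 q.2.2.1 q.2.2.2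
  have hF : ContinuousOn F X := by
    have c1 : Continuous (fun q : Euc N × Euc N × ℝ × ℝ => u q.1 q.2.2.1) :=
      hu.comp (f := fun q : Euc N × Euc N × ℝ × ℝ => (q.1, q.2.2.1)) (by fun_prop)
    have c2 : Continuous (fun q : Euc N × Euc N × ℝ × ℝ => u q.2.1 q.2.2.2) :=
      hu.comp (f := fun q : Euc N × Euc N × ℝ × ℝ => (q.2.1, q.2.2.2)) (by fun_prop)
    have c3 : Continuous (fun q : Euc N × Euc N × ℝ × ℝ => phi θ ‖q.1 - q.2.1‖) := by
      unfold phi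
      have : Continuous (fun q : Euc N × Euc N × ℝ × ℝ => ‖q.1 - q.2.1‖^(1+θ)) :=
        Continuous.rpow_const (by fun_prop) (fun _ => Or.inr (by linarith))
      fun_prop
    have c4 : ContinuousOn (fun q : Euc N × Euc N × ℝ × ℝ => gg β (q.1, q.2.2.1)) X := by
      unfold gg
      apply ContinuousOn.rpow_const
      · exact (eta_cont.comp (by fun_prop : Continuous (fun q : Euc N × Euc N × ℝ × ℝ => (q.1, q.2.2.1)))).continuousOn
      · intro q hq
        have : η0 ≤ eta (q.1, q.2.2.1) := hq.2
        exact Or.inl (by linarith)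
    have c5 : ContinuousOn (fun q : Euc N × Euc N × ℝ × ℝ => κ/(-q.2.2.1)) X := by
      apply ContinuousOn.div continuousOn_const (by fun_prop)
      intro q hq
      have := hq.1.2.2.1.2
      linarith
    have c6 : Continuous (fun q : Euc N × Euc N × ℝ × ℝ => (q.2.2.1-q.2.2.2)^2/(2*ε)) := by fun_prop
    exact ((((c1.sub c2).continuousOn).sub ((continuous_const.mul c3).continuousOn.mul c4)).sub c5).sub c6.continuousOn
  have hmem : ∀ (x y : Euc N) (t τ : ℝ), ‖x‖ < 3/2 → -(3/2) < t → t < 0 → ‖y‖ ≤ 7/4 → -(7/4) ≤ τ → τ ≤ 0 →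
      m0 ≤ PhiF L θ β κ ε u x y t τ → (x, y, t, τ) ∈ X := by
    intro x y t τ hx ht ht0 hy hτ hτ0 hm
    obtain ⟨f1, f2, f3, f4, f5, f6⟩ := facts x y t τ hx ht ht0 hy hτ hτ0 hm
    refine ⟨⟨?_, ?_, ⟨ht.le, by simp only; linarith⟩, hτ, hτ0⟩, f5⟩
    · rw [mem_closedBall_zero_iff]; exact hx.le
    · rw [mem_closedBall_zero_iff]; exact hy
  have hX0 : (x0, y0, t0, t0) ∈ X :=
    hmem x0 y0 t0 t0 (by linarith) (by linarith) ht0' (by linarith) (by linarith) ht0'.le hstart.ge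
  obtain ⟨⟨xb, yb, tb, τb⟩, hqX, hqm⟩ := hX.exists_isMaxOn ⟨_, hX0⟩ hF
  have hΦ0 : m0 ≤ PhiF L θ β κ ε u xb yb tb τb := by
    have := hqm hX0
    simp only [F, mem_ofPred_eq] at this
    linarith
  obtain ⟨⟨g1, g2, g3, g4⟩, g5⟩ := hqX
  simp only [mem_closedBall_zero_iff, mem_Icc] at g1 g2 g3 g4
  have g5' : 0 < eta (xb, tb) := lt_of_lt_of_le hη0p g5
  unfold eta at g5'
  simp only at g5'
  have hA0 : 0 ≤ 9/4 - ‖xb‖^2 := by nlinarith [norm_nonneg xb]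
  have hB0 : 0 ≤ (tb+3/2)/4 := by linarith [g3.1]
  have hxb : ‖xb‖ < 3/2 := by
    by_contra h
    push Not at h
    have : 9/4 - ‖xb‖^2 ≤ 0 := by nlinarith
    nlinarith
  have htb : -(3/2) < tb := by
    by_contra h
    push Not at h
    have : (tb+3/2)/4 ≤ 0 := by linarith
    nlinarith
  have htb0 : tb < 0 := by linarith [g3.2]
  obtain ⟨f1, f2, f3, f4, f5, f6⟩ := facts xb yb tb τb hxb htb htb0 g2 g4.1 g4.2 hΦ0
  rw [abs_le] at f2
  refine ⟨κ, hκ0, ε, hε0, xb, yb, tb, τb, hxb, htb, htb0, by linarith, by linarith, ?_, ?_, f6, ?_⟩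
  · have := norm_sub_norm_le yb xb
    rw [norm_sub_rev] at this
    linarith
  · intro h
    rw [h, sub_self, norm_zero] at f4
    linarith
  · intro x y t τ hx ht ht0 hy hτ hτ0
    by_cases h : m0 ≤ PhiF L θ β κ ε u x y t τ
    · exact hqm (hmem x y t τ hx ht ht0 hy hτ hτ0 h)
    · push Not at h; linarith

end Part14

section Part15
open scoped RealInnerProductSpace

variable {N : ℕ} {p s lam Lam : ℝ} {K : Euc N → ℝ} {u : Euc N → ℝ → ℝ}
variable {L θ β κ ε : ℝ} {x y z a : Euc N} {t : ℝ} {xb yb : Euc N} {tb τb : ℝ}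

/-- spatial gradient of the penalisation at the first point -/
def PV {N : ℕ} (L θ β : ℝ) (x y : Euc N) (t : ℝ) : Euc N :=
  L • ((gg β (x,t) * dphi θ ‖x-y‖ / ‖x-y‖) • (x-y) + phi θ ‖x-y‖ • gV β (x,t))

/-- spatial gradient of the penalisation at the second point -/
def PW {N : ℕ} (L θ β : ℝ) (x y : Euc N) (t : ℝ) : Euc N :=
  (-(L * gg β (x,t) * dphi θ ‖x-y‖ / ‖x-y‖)) • (x-y)

lemma phi_lip_abs (hθ : 0 < θ) (hθ1 : θ ≤ 1) (ha : a ≠ 0) (h4 : ‖a‖ ≤ 4) (h5 : ‖a+z‖ ≤ 4) :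
    |phi θ ‖a+z‖ - phi θ ‖a‖| ≤ ‖z‖ := by
  rw [abs_le]
  have h1 := phi_lip_vec hθ hθ1 (z := z) ha h4
  refine ⟨?_, by linarith⟩
  by_cases h : a + z = 0
  · rw [h, norm_zero]
    have e : a = -z := eq_neg_of_add_eq_zero_left h
    have h2 := phi_le (θ := θ) (norm_nonneg a)
    have h3 : phi θ 0 = 0 := by unfold phi; rw [Real.zero_rpow (by linarith)]; ring
    rw [h3]
    rw [e, norm_neg] at h2 ⊢
    linarith
  · have h2 := phi_lip_vec hθ hθ1 (a := a+z) (z := -z) h h5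
    rw [add_neg_cancel_right, norm_neg] at h2
    linarith

lemma pen_expand (hθ : 0 < θ) (hθ1 : θ ≤ 1) (hβ : 1 ≤ β) (hL : 0 < L) (hx : ‖x‖ < 3/2)
    (ht : -(3/2) < t) (ht0 : t ≤ 0) (hne : x ≠ y) (hr : ‖x-y‖ ≤ eta (x,t)/(8*β)) (hz : ‖z‖ ≤ ‖x-y‖) :
    L * phi θ ‖x+z-y‖ * gg β (x+z,t) - L * phi θ ‖x-y‖ * gg β (x,t) ≤
      ⟪PV L θ β x y t, z⟫ + (2*L*gg β (x,t)/‖x-y‖) * ‖z‖^2 := by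
  have hη := eta_pos hx ht
  have hη1 := eta_lt_one hx.le ht.le ht0
  have hβ0 : 0 < β := by linarith
  have hg : 0 < gg β (x,t) := Real.rpow_pos_of_pos hη _
  have ha : x - y ≠ 0 := sub_ne_zero.2 hne
  have hr0 : 0 < ‖x-y‖ := norm_pos_iff.2 ha
  have hr8 : ‖x-y‖ * (8*β) ≤ eta (x,t) := (le_div_iff₀ (by positivity)).1 hr
  have hr1 : ‖x-y‖ ≤ 1 := by nlinarith
  have hz4 : ‖z‖ ≤ eta (x,t)/(4*β) := by
    rw [le_div_iff₀ (by positivity)]; nlinarith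
  obtain ⟨-, -, h3, h4⟩ := g_expand hβ hx ht ht0 hz4
  have e1 : x + z - y = (x - y) + z := by abel
  rw [e1]
  have hn4 : ‖x-y+z‖ ≤ 4 := (norm_add_le _ _).trans (by linarith)
  have h5 := phi_lip_abs hθ hθ1 (z := z) ha (by linarith) hn4
  have h6 := phi_vec hθ hθ1 (z := z) ha (by linarith)
  have h7 := phi_le (θ := θ) hr0.le
  have h8 := phi_ge hθ hθ1 hr0.le (by linarith : ‖x-y‖ ≤ 4)
  have ein : ⟪PV L θ β x y t, z⟫ = L * (gg β (x,t) * (dphi θ ‖x-y‖ * (⟪x-y,z⟫/‖x-y‖)) + phi θ ‖x-y‖ * ⟪gV β (x,t), z⟫) := by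
    unfold PV
    rw [real_inner_smul_left, inner_add_left, real_inner_smul_left, real_inner_smul_left]
    ring
  rw [ein]
  set r := ‖x-y‖
  set g := gg β (x,t)
  set g' := gg β (x+z,t)
  set f := phi θ r
  set f' := phi θ ‖x-y+z‖
  set η := eta (x,t)
  set Z := ‖z‖
  have hZ : 0 ≤ Z := norm_nonneg z
  have hcross : (f'-f)*(g'-g) ≤ Z * (4*β*g*Z/η) := by
    refine (le_abs_self _).trans ?_
    rw [abs_mul]
    exact mul_le_mul h5 h4 (abs_nonneg _) hZ
  have hA : g*(f'-f) ≤ g*(dphi θ r * (⟪x-y,z⟫/r) + Z^2/(2*r)) := mul_le_mul_of_nonneg_left (by linarith) hg.le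
  have hB : f*(g'-g) ≤ f*(⟪gV β (x,t), z⟫ + 9*β^2*g*Z^2/η^2) := mul_le_mul_of_nonneg_left h3 (by linarith)
  have hi : 1/η ≤ 1/(8*β*r) := one_div_le_one_div_of_le (by positivity) (by linarith)
  have hE1 : Z * (4*β*g*Z/η) ≤ g*Z^2/(2*r) := by
    have : Z * (4*β*g*Z/η) = 4*β*g*Z^2*(1/η) := by ring
    rw [this]
    calc 4*β*g*Z^2*(1/η) ≤ 4*β*g*Z^2*(1/(8*β*r)) := by gcongr
      _ = g*Z^2/(2*r) := by field_simp; ring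
  have hE2 : f*(9*β^2*g*Z^2/η^2) ≤ g*Z^2/(2*r) := by
    have : f*(9*β^2*g*Z^2/η^2) = f*(9*β^2*g*Z^2*(1/η)^2) := by ring
    rw [this]
    calc f*(9*β^2*g*Z^2*(1/η)^2) ≤ r*(9*β^2*g*Z^2*(1/(8*β*r))^2) := by
          gcongr
      _ = (9/64)*(g*Z^2/r) := by field_simp; ring
      _ ≤ (1/2)*(g*Z^2/r) := mul_le_mul_of_nonneg_right (by norm_num) (by positivity)
      _ = _ := by ring
  have key : f'*g' - f*g ≤ (g * (dphi θ r * (⟪x-y,z⟫/r)) + f * ⟪gV β (x,t), z⟫) + 2*g/r*Z^2 := by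
    have e : f'*g'-f*g = g*(f'-f) + f*(g'-g) + (f'-f)*(g'-g) := by ring
    have e2 : g*Z^2/(2*r) = g/r*Z^2/2 := by ring
    have e3 : 2*g/r*Z^2 = 2*(g/r*Z^2) := by ring
    have e4 : 0 ≤ g/r*Z^2 := by positivity
    have e5 : g*(Z^2/(2*r)) = g/r*Z^2/2 := by ring
    rw [mul_add] at hA hB
    rw [e3]; linarith
  have := mul_le_mul_of_nonneg_left key hL.le
  have e6 : L * ((g * (dphi θ r * (⟪x-y,z⟫/r)) + f * ⟪gV β (x,t), z⟫) + 2*g/r*Z^2) = L * (g * (dphi θ r * (⟪x-y,z⟫/r)) + f * ⟪gV β (x,t), z⟫) + 2*L*g/r*Z^2 := by ring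
  rw [e6] at this
  linarith

lemma PV_norm (hθ : 0 < θ) (hθ1 : θ ≤ 1) (hβ : 1 ≤ β) (hL : 0 < L) (hx : ‖x‖ < 3/2)
    (ht : -(3/2) < t) (ht0 : t ≤ 0) (hne : x ≠ y) (hr : ‖x-y‖ ≤ eta (x,t)/(8*β)) :
    L*gg β (x,t)/4 ≤ ‖PV L θ β x y t‖ ∧ ‖PV L θ β x y t‖ ≤ 2*L*gg β (x,t) := by
  have hη := eta_pos hx ht
  have hη1 := eta_lt_one hx.le ht.le ht0
  have hβ0 : 0 < β := by linarith
  have hg : 0 < gg β (x,t) := Real.rpow_pos_of_pos hη _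
  have ha : x - y ≠ 0 := sub_ne_zero.2 hne
  have hr0 : 0 < ‖x-y‖ := norm_pos_iff.2 ha
  have hr8 : ‖x-y‖ * (8*β) ≤ eta (x,t) := (le_div_iff₀ (by positivity)).1 hr
  have hr1 : ‖x-y‖ ≤ 1 := by nlinarith
  have h7 := phi_le (θ := θ) hr0.le
  have h8 := phi_ge hθ hθ1 hr0.le (by linarith : ‖x-y‖ ≤ 4)
  have hd1 := dphi_le hθ hr0.le
  have hd2 := dphi_ge hθ hθ1 hr0.le (by linarith : ‖x-y‖ ≤ 4)
  have hV := gV_norm hβ hx ht ht0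
  have n1 : ‖(gg β (x,t) * dphi θ ‖x-y‖ / ‖x-y‖) • (x-y)‖ = gg β (x,t) * dphi θ ‖x-y‖ := by
    rw [norm_smul, Real.norm_eq_abs, abs_of_nonneg]
    · field_simp
    · apply div_nonneg (mul_nonneg hg.le (by linarith)) hr0.le
  have n2 : ‖phi θ ‖x-y‖ • gV β (x,t)‖ ≤ gg β (x,t)/4 := by
    rw [norm_smul, Real.norm_eq_abs, abs_of_nonneg (by linarith)]
    calc phi θ ‖x-y‖ * ‖gV β (x,t)‖ ≤ ‖x-y‖ * (2*β*gg β (x,t)/eta (x,t)) := by gcongr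
      _ = (‖x-y‖ * (8*β)) * (gg β (x,t)/(4*eta (x,t))) := by ring
      _ ≤ eta (x,t) * (gg β (x,t)/(4*eta (x,t))) := by gcongr
      _ = gg β (x,t)/4 := by field_simp
  have hn : ‖PV L θ β x y t‖ = L * ‖(gg β (x,t) * dphi θ ‖x-y‖ / ‖x-y‖) • (x-y) + phi θ ‖x-y‖ • gV β (x,t)‖ := by
    unfold PV; rw [norm_smul, Real.norm_eq_abs, abs_of_pos hL]
  have lo := norm_sub_le_norm_add ((gg β (x,t) * dphi θ ‖x-y‖ / ‖x-y‖) • (x-y)) (phi θ ‖x-y‖ • gV β (x,t))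
  have hi := norm_add_le ((gg β (x,t) * dphi θ ‖x-y‖ / ‖x-y‖) • (x-y)) (phi θ ‖x-y‖ • gV β (x,t))
  rw [n1] at lo hi
  rw [hn]
  have q1 : gg β (x,t) * dphi θ ‖x-y‖ ≤ gg β (x,t) := by nlinarith
  have q2 : gg β (x,t)/2 ≤ gg β (x,t) * dphi θ ‖x-y‖ := by nlinarith
  constructor <;> nlinarith

lemma pen_expand2 (hθ : 0 < θ) (hθ1 : θ ≤ 1) (hL : 0 < L) (hx : ‖x‖ < 3/2)
    (ht : -(3/2) < t) (hne : x ≠ y) (hr : ‖x-y‖ ≤ 4) :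
    L * phi θ ‖x-(y+z)‖ * gg β (x,t) - L * phi θ ‖x-y‖ * gg β (x,t) ≤
      ⟪PW L θ β x y t, z⟫ + (2*L*gg β (x,t)/‖x-y‖) * ‖z‖^2 := by
  have hη := eta_pos hx ht
  have hg : 0 < gg β (x,t) := Real.rpow_pos_of_pos hη _
  have ha : x - y ≠ 0 := sub_ne_zero.2 hne
  have hr0 : 0 < ‖x-y‖ := norm_pos_iff.2 ha
  have h6 := phi_vec hθ hθ1 (z := -z) ha hr
  have e1 : x - (y + z) = x - y + -z := by abel
  rw [e1]
  rw [inner_neg_right, norm_neg] at h6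
  unfold PW
  rw [real_inner_smul_left]
  have h7 := mul_le_mul_of_nonneg_left h6 (mul_pos hL hg).le
  have e2 : (2*L*gg β (x,t)/‖x-y‖) * ‖z‖^2 = L * gg β (x,t) * (‖z‖^2/(2*‖x-y‖)) + (3/2)*(L*gg β (x,t)/‖x-y‖*‖z‖^2) := by
    field_simp; ring
  have e3 : 0 ≤ L*gg β (x,t)/‖x-y‖*‖z‖^2 := by positivity
  rw [e2]
  have e4 : -(L * gg β (x,t) * dphi θ ‖x-y‖ / ‖x-y‖) * ⟪x-y,z⟫ = L * gg β (x,t) * (dphi θ ‖x-y‖ * (-⟪x-y,z⟫/‖x-y‖)) := by ring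
  rw [e4]
  linarith

lemma PW_norm (hθ : 0 < θ) (hθ1 : θ ≤ 1) (hL : 0 < L) (hx : ‖x‖ < 3/2)
    (ht : -(3/2) < t) (hne : x ≠ y) (hr : ‖x-y‖ ≤ 4) :
    L*gg β (x,t)/4 ≤ ‖PW L θ β x y t‖ ∧ ‖PW L θ β x y t‖ ≤ 2*L*gg β (x,t) := by
  have hη := eta_pos hx ht
  have hg : 0 < gg β (x,t) := Real.rpow_pos_of_pos hη _
  have hLg := mul_pos hL hg
  have ha : x - y ≠ 0 := sub_ne_zero.2 hne
  have hr0 : 0 < ‖x-y‖ := norm_pos_iff.2 ha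
  have hd1 := dphi_le hθ hr0.le
  have hd2 := dphi_ge hθ hθ1 hr0.le hr
  have n1 : ‖PW L θ β x y t‖ = L * gg β (x,t) * dphi θ ‖x-y‖ := by
    unfold PW
    rw [norm_smul, Real.norm_eq_abs, abs_neg, abs_of_nonneg]
    · field_simp
    · apply div_nonneg (mul_nonneg hLg.le (by linarith)) hr0.le
  rw [n1]
  constructor <;> nlinarith

lemma grad_dir {P : Euc N} {M r0 : ℝ} {f : Euc N → ℝ} (hP : P ≠ 0) (hr0 : 0 < r0)
    (hf : ∀ z, ‖z‖ ≤ r0 → f z ≤ ⟪P,z⟫ + M * ‖z‖^2) :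
    ∃ v : Euc N, ∃ c > 0, ∀ᶠ h in 𝓝[>] (0:ℝ), f (h • v) ≤ -(c*h) := by
  have hPn : 0 < ‖P‖ := norm_pos_iff.2 hP
  refine ⟨-P, ‖P‖^2/2, by positivity, ?_⟩
  have h1 : Tendsto (fun h : ℝ => M*h) (𝓝[>] 0) (𝓝 0) := by
    have : Tendsto (fun h : ℝ => M*h) (𝓝 0) (𝓝 (M*0)) := (continuous_const.mul continuous_id).tendsto 0
    rw [mul_zero] at this
    exact this.mono_left nhdsWithin_le_nhds
  have h2 : Tendsto (fun h : ℝ => h*‖P‖) (𝓝[>] 0) (𝓝 0) := by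
    have : Tendsto (fun h : ℝ => h*‖P‖) (𝓝 0) (𝓝 (0*‖P‖)) := (continuous_id.mul continuous_const).tendsto 0
    rw [zero_mul] at this
    exact this.mono_left nhdsWithin_le_nhds
  filter_upwards [h1.eventually (gt_mem_nhds (show (0:ℝ) < 1/2 by norm_num)), h2.eventually (gt_mem_nhds hr0),
    self_mem_nhdsWithin] with h k1 k2 k3
  have hh : 0 < h := k3
  have hn : ‖h • (-P)‖ = h*‖P‖ := by rw [norm_smul, norm_neg, Real.norm_eq_abs, abs_of_pos hh]
  have := hf (h • (-P)) (by rw [hn]; exact k2.le)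
  rw [hn, real_inner_smul_right, inner_neg_right, real_inner_self_eq_norm_sq] at this
  have h3 : M*h*(h*‖P‖^2) ≤ 1/2*(h*‖P‖^2) := mul_le_mul_of_nonneg_right k1.le (by positivity)
  nlinarith

lemma Sol.neg (S : Sol N p s lam Lam K u) : Sol N p s lam Lam K (fun x t => - u x t) := by
  have e1 : ∀ x y t, |(-u x t) - (-u y t)| = |u x t - u y t| := fun x y t => by
    rw [← abs_neg]; congr 1; ring
  have e2 : ∀ x y t, Jp p ((-u x t) - (-u y t)) = - Jp p (u x t - u y t) := fun x y t => by
    rw [← Jp_neg]; congr 1; ring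
  refine ⟨S.hN, S.hp, S.hs, S.hLam, S.ker, S.cont.neg, ?_, ?_, ?_, ?_⟩
  · intro a b ha hb
    simp only [e1]
    exact S.energy a b ha hb
  · simp only [abs_neg]; exact S.tail
  · simp only [abs_neg]; exact S.bdd
  · intro φ h1 h2 h3
    simp only [e2, neg_mul, integral_neg]
    have := S.weak φ h1 h2 h3
    linarith

lemma midInt_neg (ρ ρ1 : ℝ) (q : Euc N × ℝ) :
    midInt p K (fun x t => - u x t) ρ ρ1 q = - midInt p K u ρ ρ1 q := by
  unfold midInt
  rw [← integral_neg]
  congr 1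
  ext z
  rw [← neg_mul, ← Jp_neg]; congr 2; ring

end Part15

section Part16
open scoped RealInnerProductSpace

variable {N : ℕ} {p s lam Lam : ℝ} {K : Euc N → ℝ} {u : Euc N → ℝ → ℝ}
variable {L θ β κ ε : ℝ} {xb yb : Euc N} {tb τb : ℝ}

lemma doubled (S : Sol N p s lam Lam K u) {C0 : ℝ} (hC0 : 0 < C0)
    (hfar : ∀ᵐ t : ℝ, t ∈ Ioo (-2 : ℝ) 0 → ∀ x ∈ closedBall (0 : Euc N) (7/4),
        ∫⁻ y in {y : Euc N | 1/4 ≤ ‖x - y‖},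
          ENNReal.ofReal |Jp p (u x t - u y t) * K (x - y)| ≤ ENNReal.ofReal C0)
    (hθ : 0 < θ) (hθ1 : θ ≤ 1) (hβ : 1 ≤ β) (hL : 0 < L) (hκ : 0 < κ)
    (MP : MaxPt L θ β κ ε u xb yb tb τb) (hr : ‖xb-yb‖ ≤ eta (xb,tb)/(8*β)) :
    ∀ᶠ ρ in 𝓝[>] (0:ℝ), -(β*(L*gg β (xb,tb))*(‖xb-yb‖/eta (xb,tb))) + midInt p K u ρ (1/4) (xb,tb)
      - midInt p K u ρ (1/4) (yb,τb) ≤ 3*C0 := by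
  have hη := eta_pos MP.hx MP.ht
  have hη1 := eta_lt_one MP.hx.le MP.ht.le MP.ht0.le
  have hβ0 : 0 < β := by linarith
  have hg : 0 < gg β (xb,tb) := Real.rpow_pos_of_pos hη _
  have ha : xb - yb ≠ 0 := sub_ne_zero.2 MP.hne
  have hr0 : 0 < ‖xb-yb‖ := norm_pos_iff.2 ha
  have hr8 : ‖xb-yb‖ * (8*β) ≤ eta (xb,tb) := (le_div_iff₀ (by positivity)).1 hr
  have hr1 : ‖xb-yb‖ ≤ 1 := by nlinarith
  have hLg : 0 < L * gg β (xb,tb) := mul_pos hL hg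
  obtain ⟨dg, hdg, hdg2⟩ := gg_deriv hβ MP.hx MP.ht
  -- first point
  have V1 := visc2 S hC0 hfar (qb := (xb,tb))
    (ψ := fun q => L * phi θ ‖q.1 - yb‖ * gg β q + κ/(-q.2) + (q.2-τb)^2/(2*ε))
    (d := L * phi θ ‖xb-yb‖ * dg + κ/(-tb)^2 + (tb-τb)/ε)
    (by linarith [MP.hx]) (by linarith [MP.ht]) MP.ht0 ?_ ?_ ?_ ?_ (half_pos hC0)
  rotate_left
  · apply ContDiffAt.add
    · apply ContDiffAt.add
      · apply ContDiffAt.mul _ (gg_contDiffAt MP.hx MP.ht)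
        apply contDiffAt_const.mul
        have h1 : ContDiffAt ℝ 2 (fun q : Euc N × ℝ => ‖q.1 - yb‖) (xb,tb) :=
          ContDiffAt.norm ℝ (by fun_prop) ha
        exact ContDiffAt.comp (xb,tb) (phi_contDiffAt hr0) h1
      · apply contDiffAt_const.div (by fun_prop)
        have := MP.ht0
        exact neg_ne_zero.2 this.ne
    · fun_prop
  · have h1 := hdg.const_mul (L * phi θ ‖xb-yb‖)
    have h2 : HasDerivAt (fun τ : ℝ => κ/(-τ)) (κ/(-tb)^2) tb := by
      have := (hasDerivAt_const tb κ).div (hasDerivAt_id tb).neg (neg_ne_zero.2 MP.ht0.ne)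
      refine this.congr_deriv ?_
      simp
    have h3 : HasDerivAt (fun τ : ℝ => (τ-τb)^2/(2*ε)) ((tb-τb)/ε) tb := by
      have := (((hasDerivAt_id tb).sub_const τb).fun_pow 2).div_const (2*ε)
      refine this.congr_deriv ?_
      simp only [id]
      by_cases he : ε = 0
      · simp [he]
      · field_simp; norm_num; ring
    exact (h1.add h2).add h3
  · have hPn := PV_norm hθ hθ1 hβ hL MP.hx MP.ht MP.ht0.le MP.hne hr
    obtain ⟨v, c, hc, hv⟩ := grad_dir (P := PV L θ β xb yb tb) (M := 2*L*gg β (xb,tb)/‖xb-yb‖) (r0 := ‖xb-yb‖)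
      (f := fun z => L * phi θ ‖xb+z-yb‖ * gg β (xb+z,tb) - L * phi θ ‖xb-yb‖ * gg β (xb,tb))
      (by rw [← norm_pos_iff]; linarith [hPn.1]) hr0
      (fun z hz => pen_expand hθ hθ1 hβ hL MP.hx MP.ht MP.ht0.le MP.hne hr hz)
    refine ⟨v, c, hc, ?_⟩
    filter_upwards [hv] with h hh
    linarith
  · have o1 : ∀ᶠ q : Euc N × ℝ in 𝓝 (xb,tb), ‖q.1‖ < 3/2 :=
      (continuous_fst.norm).continuousAt.eventually_lt continuousAt_const MP.hx
    have o2 : ∀ᶠ q : Euc N × ℝ in 𝓝 (xb,tb), -(3/2) < q.2 :=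
      continuousAt_const.eventually_lt continuous_snd.continuousAt MP.ht
    have o3 : ∀ᶠ q : Euc N × ℝ in 𝓝 (xb,tb), q.2 < 0 :=
      continuous_snd.continuousAt.eventually_lt continuousAt_const MP.ht0
    filter_upwards [o1, o2, o3] with q q1 q2 q3
    have := MP.hmax q.1 yb q.2 τb q1 q2 q3 MP.hy.le MP.hτ.le MP.hτ0.le
    unfold PhiF at this
    simp only [Prod.mk.eta] at this
    show u q.1 q.2 - (L * phi θ ‖q.1 - yb‖ * gg β q + κ/(-q.2) + (q.2-τb)^2/(2*ε)) ≤ u xb tb - (L * phi θ ‖xb - yb‖ * gg β (xb,tb) + κ/(-tb) + (tb-τb)^2/(2*ε))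
    linarith
  -- second point
  have hfar2 : ∀ᵐ t : ℝ, t ∈ Ioo (-2 : ℝ) 0 → ∀ x ∈ closedBall (0 : Euc N) (7/4),
        ∫⁻ y in {y : Euc N | 1/4 ≤ ‖x - y‖},
          ENNReal.ofReal |Jp p ((fun x t => - u x t) x t - (fun x t => - u x t) y t) * K (x - y)| ≤ ENNReal.ofReal C0 := by
    have e2 : ∀ x y t, Jp p ((-u x t) - (-u y t)) = - Jp p (u x t - u y t) := fun x y t => by
      rw [← Jp_neg]; congr 1; ring
    simp only [e2, neg_mul, abs_neg]
    exact hfar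
  have V2 := visc2 S.neg hC0 hfar2 (qb := (yb,τb))
    (ψ := fun q => L * phi θ ‖xb - q.1‖ * gg β (xb,tb) + (tb-q.2)^2/(2*ε))
    (d := -((tb-τb)/ε))
    MP.hy (by linarith [MP.hτ]) MP.hτ0 ?_ ?_ ?_ ?_ (half_pos hC0)
  rotate_left
  · apply ContDiffAt.add
    · apply ContDiffAt.mul _ contDiffAt_const
      apply contDiffAt_const.mul
      have h1 : ContDiffAt ℝ 2 (fun q : Euc N × ℝ => ‖xb - q.1‖) (yb,τb) :=
          ContDiffAt.norm ℝ (by fun_prop) ha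
      exact ContDiffAt.comp (yb,τb) (phi_contDiffAt hr0) h1
    · fun_prop
  · have h3 : HasDerivAt (fun τ : ℝ => (tb-τ)^2/(2*ε)) (-((tb-τb)/ε)) τb := by
      have := (((hasDerivAt_id τb).const_sub tb).fun_pow 2).div_const (2*ε)
      refine this.congr_deriv ?_
      simp only [id]
      by_cases he : ε = 0
      · simp [he]
      · field_simp; norm_num; ring
    exact h3.const_add (L * phi θ ‖xb - yb‖ * gg β (xb,tb))
  · have hPn := PW_norm (β := β) hθ hθ1 hL MP.hx MP.ht MP.hne (by linarith)
    obtain ⟨v, c, hc, hv⟩ := grad_dir (P := PW L θ β xb yb tb) (M := 2*L*gg β (xb,tb)/‖xb-yb‖) (r0 := ‖xb-yb‖)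
      (f := fun z => L * phi θ ‖xb-(yb+z)‖ * gg β (xb,tb) - L * phi θ ‖xb-yb‖ * gg β (xb,tb))
      (by rw [← norm_pos_iff]; linarith [hPn.1]) hr0
      (fun z _ => pen_expand2 hθ hθ1 hL MP.hx MP.ht MP.hne (by linarith))
    refine ⟨v, c, hc, ?_⟩
    filter_upwards [hv] with h hh
    linarith
  · have o1 : ∀ᶠ q : Euc N × ℝ in 𝓝 (yb,τb), ‖q.1‖ < 7/4 :=
      (continuous_fst.norm).continuousAt.eventually_lt continuousAt_const MP.hy
    have o2 : ∀ᶠ q : Euc N × ℝ in 𝓝 (yb,τb), -(7/4) < q.2 :=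
      continuousAt_const.eventually_lt continuous_snd.continuousAt MP.hτ
    have o3 : ∀ᶠ q : Euc N × ℝ in 𝓝 (yb,τb), q.2 < 0 :=
      continuous_snd.continuousAt.eventually_lt continuousAt_const MP.hτ0
    filter_upwards [o1, o2, o3] with q q1 q2 q3
    have := MP.hmax xb q.1 tb q.2 MP.hx MP.ht MP.ht0 q1.le q2.le q3.le
    unfold PhiF at this
    show -u q.1 q.2 - (L * phi θ ‖xb - q.1‖ * gg β (xb,tb) + (tb-q.2)^2/(2*ε)) ≤ -u yb τb - (L * phi θ ‖xb - yb‖ * gg β (xb,tb) + (tb-τb)^2/(2*ε))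
    linarith
  filter_upwards [V1, V2] with ρ h1 h2
  rw [midInt_neg] at h2
  have hk : 0 < κ/(-tb)^2 := div_pos hκ (pow_pos (neg_pos.2 MP.ht0) 2)
  have h7 := phi_le (θ := θ) hr0.le
  have h8 := phi_ge hθ hθ1 hr0.le (by linarith : ‖xb-yb‖ ≤ 4)
  have hf0 : 0 ≤ L * phi θ ‖xb-yb‖ := mul_nonneg hL.le (by linarith)
  have t1 : L * phi θ ‖xb-yb‖ * (-(β*gg β (xb,tb)/eta (xb,tb))) ≤ L * phi θ ‖xb-yb‖ * dg :=
    mul_le_mul_of_nonneg_left hdg2 hf0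
  have t2 : L * phi θ ‖xb-yb‖ * (β*gg β (xb,tb)/eta (xb,tb)) ≤ L * ‖xb-yb‖ * (β*gg β (xb,tb)/eta (xb,tb)) := by
    gcongr
  have e1 : β*(L*gg β (xb,tb))*(‖xb-yb‖/eta (xb,tb)) = L * ‖xb-yb‖ * (β*gg β (xb,tb)/eta (xb,tb)) := by ring
  rw [e1]
  linarith

end Part16

section Part17
open scoped RealInnerProductSpace

variable {N : ℕ} {p s lam Lam : ℝ} {K : Euc N → ℝ} {u : Euc N → ℝ → ℝ}
variable {L θ β κ ε : ℝ} {xb yb : Euc N} {tb τb : ℝ}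

lemma pw1 (hθ : 0 < θ) (hθ1 : θ ≤ 1) (hβ : 1 ≤ β) (hL : 0 < L)
    (MP : MaxPt L θ β κ ε u xb yb tb τb) (hr : ‖xb-yb‖ ≤ eta (xb,tb)/(8*β)) {z : Euc N}
    (hz : ‖z‖ ≤ eta (xb,tb)/(4*β)) :
    -(L * phi θ ‖xb+z-yb‖ * gg β (xb+z,tb) - L * phi θ ‖xb-yb‖ * gg β (xb,tb)) ≤ u xb tb - u (xb+z) tb ∧
    u yb τb - u (yb+z) τb ≤ L * phi θ ‖xb-(yb+z)‖ * gg β (xb,tb) - L * phi θ ‖xb-yb‖ * gg β (xb,tb) ∧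
    -(4*β*(L*gg β (xb,tb))*(‖xb-yb‖/eta (xb,tb))*‖z‖) ≤ (u xb tb - u (xb+z) tb) - (u yb τb - u (yb+z) τb) ∧
    -(3*(L*gg β (xb,tb))*‖z‖) ≤ u xb tb - u (xb+z) tb ∧
    u yb τb - u (yb+z) τb ≤ L*gg β (xb,tb)*‖z‖ := by
  have hη := eta_pos MP.hx MP.ht
  have hη1 := eta_lt_one MP.hx.le MP.ht.le MP.ht0.le
  have hβ0 : 0 < β := by linarith
  have hg : 0 < gg β (xb,tb) := Real.rpow_pos_of_pos hη _
  have ha : xb - yb ≠ 0 := sub_ne_zero.2 MP.hne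
  have hr0 : 0 < ‖xb-yb‖ := norm_pos_iff.2 ha
  have hr8 : ‖xb-yb‖ * (8*β) ≤ eta (xb,tb) := (le_div_iff₀ (by positivity)).1 hr
  have hr1 : ‖xb-yb‖ ≤ 1/8 := by nlinarith
  have hz8 : ‖z‖ * (4*β) ≤ eta (xb,tb) := (le_div_iff₀ (by positivity)).1 hz
  have hz1 : ‖z‖ ≤ 1/4 := by nlinarith [norm_nonneg z]
  have hLg : 0 < L * gg β (xb,tb) := mul_pos hL hg
  obtain ⟨h1, h2, -, h4⟩ := g_expand hβ MP.hx MP.ht MP.ht0.le hz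
  have hyz : ‖yb + z‖ ≤ 7/4 := by
    have : yb + z = (xb + z) - (xb - yb) := by abel
    rw [this]; exact (norm_sub_le _ _).trans (by linarith)
  have m1 := MP.hmax (xb+z) yb tb τb h2 MP.ht MP.ht0 MP.hy.le MP.hτ.le MP.hτ0.le
  have m2 := MP.hmax xb (yb+z) tb τb MP.hx MP.ht MP.ht0 hyz MP.hτ.le MP.hτ0.le
  have m3 := MP.hmax (xb+z) (yb+z) tb τb h2 MP.ht MP.ht0 hyz MP.hτ.le MP.hτ0.le
  unfold PhiF at m1 m2 m3
  rw [add_sub_add_right_eq_sub] at m3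
  have h7 := phi_le (θ := θ) hr0.le
  have h8 := phi_ge hθ hθ1 hr0.le (by linarith : ‖xb-yb‖ ≤ 4)
  have hf0 : 0 ≤ L * phi θ ‖xb-yb‖ := mul_nonneg hL.le (by linarith)
  have eg : L * phi θ ‖xb-yb‖ * (gg β (xb+z,tb) - gg β (xb,tb)) ≤ 4*β*(L*gg β (xb,tb))*(‖xb-yb‖/eta (xb,tb))*‖z‖ := by
    calc L * phi θ ‖xb-yb‖ * (gg β (xb+z,tb) - gg β (xb,tb))
        ≤ L * phi θ ‖xb-yb‖ * (4*β*gg β (xb,tb)*‖z‖/eta (xb,tb)) := by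
          gcongr; exact (le_abs_self _).trans h4
      _ ≤ L * ‖xb-yb‖ * (4*β*gg β (xb,tb)*‖z‖/eta (xb,tb)) := by gcongr
      _ = _ := by ring
  have egr : 4*β*(L*gg β (xb,tb))*(‖xb-yb‖/eta (xb,tb))*‖z‖ ≤ (1/2)*(L*gg β (xb,tb)*‖z‖) := by
    have : 4*β*(L*gg β (xb,tb))*(‖xb-yb‖/eta (xb,tb))*‖z‖ = (‖xb-yb‖*(8*β)) * (L*gg β (xb,tb)*‖z‖/(2*eta (xb,tb))) := by
      field_simp; ring
    rw [this]
    calc _ ≤ eta (xb,tb) * (L*gg β (xb,tb)*‖z‖/(2*eta (xb,tb))) := by gcongr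
      _ = _ := by field_simp
  have hg2 : gg β (xb+z,tb) ≤ 2 * gg β (xb,tb) := by
    have : 4*β*gg β (xb,tb)*‖z‖/eta (xb,tb) ≤ gg β (xb,tb) := by
      rw [div_le_iff₀ hη]; nlinarith
    have := (le_abs_self _).trans h4
    linarith
  have e1 : xb + z - yb = (xb - yb) + z := by abel
  have e2 : xb - (yb + z) = (xb - yb) + -z := by abel
  have p1 := phi_lip_vec hθ hθ1 (z := z) ha (by linarith)
  have p2 := phi_lip_vec hθ hθ1 (z := -z) ha (by linarith)
  rw [norm_neg] at p2
  have hg'0 : 0 < gg β (xb+z,tb) := Real.rpow_pos_of_pos h1 _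
  refine ⟨by linarith, by linarith, by linarith, ?_, ?_⟩
  · have : L * phi θ ‖xb+z-yb‖ * gg β (xb+z,tb) - L * phi θ ‖xb-yb‖ * gg β (xb,tb)
        ≤ 3*(L*gg β (xb,tb))*‖z‖ := by
      rw [e1]
      have a1 : L * gg β (xb+z,tb) * (phi θ ‖xb-yb+z‖ - phi θ ‖xb-yb‖) ≤ L * gg β (xb+z,tb) * ‖z‖ := by
        gcongr; linarith
      have a2 : L * gg β (xb+z,tb) * ‖z‖ ≤ L * (2 * gg β (xb,tb)) * ‖z‖ := by gcongr
      have a3 : 0 ≤ L*gg β (xb,tb)*‖z‖ := by positivity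
      linarith
    linarith
  · have : L * phi θ ‖xb-(yb+z)‖ * gg β (xb,tb) - L * phi θ ‖xb-yb‖ * gg β (xb,tb) ≤ L*gg β (xb,tb)*‖z‖ := by
      rw [e2]
      have a1 : L * gg β (xb,tb) * (phi θ ‖xb-yb+ -z‖ - phi θ ‖xb-yb‖) ≤ L * gg β (xb,tb) * ‖z‖ := by
        gcongr; linarith
      linarith
    linarith

lemma rpow_low {p B X : ℝ} (hp : 1 < p) (hB : 0 < B) (h1 : B/16 ≤ X) (h2 : X ≤ 16*B) :
    (1/16)^p * B^(p-2) ≤ X^(p-2) ∧ X^(p-2) ≤ 16^p * B^(p-2) := by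
  have hX : 0 < X := by linarith
  have hBp : 0 < B^(p-2) := Real.rpow_pos_of_pos hB _
  rcases le_total 2 p with h | h
  · have a1 := Real.rpow_le_rpow (by positivity) h1 (by linarith : 0 ≤ p-2)
    have a2 := Real.rpow_le_rpow hX.le h2 (by linarith : 0 ≤ p-2)
    rw [Real.mul_rpow (by norm_num) hB.le] at a2
    have e : B/16 = (1/16)*B := by ring
    rw [e, Real.mul_rpow (by norm_num) hB.le] at a1
    refine ⟨le_trans ?_ a1, a2.trans ?_⟩
    · gcongr ?_ * _
      exact Real.rpow_le_rpow_of_exponent_ge (by norm_num) (by norm_num) (by linarith)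
    · gcongr ?_ * _
      exact Real.rpow_le_rpow_of_exponent_le (by norm_num) (by linarith)
  · have a1 := Real.rpow_le_rpow_of_nonpos (by positivity) h1 (by linarith : p-2 ≤ 0)
    have a2 := Real.rpow_le_rpow_of_nonpos hX h2 (by linarith : p-2 ≤ 0)
    rw [Real.mul_rpow (by norm_num) hB.le] at a2
    have e : B/16 = (16:ℝ)⁻¹*B := by ring
    rw [e, Real.mul_rpow (by norm_num) hB.le, Real.inv_rpow (by norm_num), ← Real.rpow_neg (by norm_num)] at a1
    refine ⟨le_trans ?_ a2, a1.trans ?_⟩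
    · gcongr ?_ * _
      rw [one_div, Real.inv_rpow (by norm_num), ← Real.rpow_neg (by norm_num)]
      exact Real.rpow_le_rpow_of_exponent_le (by norm_num) (by linarith)
    · gcongr ?_ * _
      exact Real.rpow_le_rpow_of_exponent_le (by norm_num) (by linarith)

end Part17

section Part18
open scoped RealInnerProductSpace

variable {N : ℕ} {p s lam Lam : ℝ} {K : Euc N → ℝ} {u : Euc N → ℝ → ℝ}
variable {L θ β κ ε : ℝ} {xb yb : Euc N} {tb τb : ℝ}

set_option maxHeartbeats 2000000 in
lemma pw_gain (hp : 1 < p) (hθ : 0 < θ) (hθ1 : θ ≤ 1) (hβ : 1 ≤ β) (hL : 0 < L)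
    (MP : MaxPt L θ β κ ε u xb yb tb τb) (hr : ‖xb-yb‖ ≤ eta (xb,tb)/(8*β))
    (hχ : 4*β*(‖xb-yb‖/eta (xb,tb)) ≤ θ^2/51200 * ‖xb-yb‖^θ) {z : Euc N}
    (hz : ‖z - (1/4:ℝ)•(xb-yb)‖ ≤ θ/160*‖xb-yb‖^(1+θ/2)) :
    ‖xb-yb‖/8 ≤ ‖z‖ ∧ ‖z‖ ≤ ‖xb-yb‖/2 ∧
    (min 1 (p-1) * (1/16)^p * (θ^2/51200)) * ((L*gg β (xb,tb))^(p-1) * ‖xb-yb‖^(p-1+θ)) ≤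
      Jp p (u xb tb - u (xb+z) tb) - Jp p (u yb τb - u (yb+z) τb) := by
  have hη := eta_pos MP.hx MP.ht
  have hη1 := eta_lt_one MP.hx.le MP.ht.le MP.ht0.le
  have hβ0 : 0 < β := by linarith
  have hg : 0 < gg β (xb,tb) := Real.rpow_pos_of_pos hη _
  have ha : xb - yb ≠ 0 := sub_ne_zero.2 MP.hne
  have hr0 : 0 < ‖xb-yb‖ := norm_pos_iff.2 ha
  have hr8 : ‖xb-yb‖ * (8*β) ≤ eta (xb,tb) := (le_div_iff₀ (by positivity)).1 hr
  have hr1 : ‖xb-yb‖ ≤ 1/8 := by nlinarith only [hr8, hη1, hβ, hr0]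
  have hLg : 0 < L * gg β (xb,tb) := mul_pos hL hg
  set a := xb - yb with had
  set r := ‖a‖ with hrd
  set w := z - (1/4:ℝ)•a with hw
  have hzw : z = (1/4:ℝ)•a + w := by rw [hw]; abel
  have hrp : r^(1+θ/2) ≤ r := by
    calc r^(1+θ/2) ≤ r^(1:ℝ) := Real.rpow_le_rpow_of_exponent_ge hr0 (by linarith) (by linarith)
      _ = r := Real.rpow_one r
  have hw8 : ‖w‖ ≤ r/8 := by
    have : θ/160*r^(1+θ/2) ≤ 1/8*r := mul_le_mul (by linarith) hrp (by positivity) (by norm_num)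
    linarith
  have haa : ‖(1/4:ℝ)•a‖ = r/4 := by rw [norm_smul, Real.norm_eq_abs, abs_of_pos (by norm_num)]; ring
  have hz1 : ‖z‖ ≤ r/2 := by
    rw [hzw]; exact (norm_add_le _ _).trans (by rw [haa]; linarith)
  have hz2 : r/8 ≤ ‖z‖ := by
    rw [hzw]; have := norm_sub_le_norm_add ((1/4:ℝ)•a) w
    rw [haa] at this; linarith
  refine ⟨hz2, hz1, ?_⟩
  set ti := ⟪a,w⟫/r with hti
  have hti1 : |ti| ≤ ‖w‖ := by
    rw [hti, abs_div, abs_of_pos hr0, div_le_iff₀ hr0, mul_comm]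
    exact abs_real_inner_le_norm a w
  have hsg : ⟪a,z⟫/r = r/4 + ti := by
    rw [hzw, inner_add_right, real_inner_smul_right, real_inner_self_eq_norm_sq, hti]
    field_simp; rfl
  have hti2 := abs_le.1 hti1
  have hsg1 : r/8 ≤ ⟪a,z⟫/r := by rw [hsg]; linarith
  have hsg2 : ⟪a,z⟫/r ≤ 3*r/8 := by rw [hsg]; linarith
  have hnz : ‖z‖^2 = r^2/16 + r*ti/2 + ‖w‖^2 := by
    rw [hzw, norm_add_sq_real, haa, real_inner_smul_left]
    have : ⟪a,w⟫ = r*ti := by rw [hti]; field_simp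
    rw [this]; ring
  have hperp : ‖z‖^2 - (⟪a,z⟫/r)^2 ≤ (θ/160)^2 * (r * r^(1+θ)) := by
    have h1 : ‖w‖^2 ≤ (θ/160*r^(1+θ/2))^2 := by gcongr
    have h2 : (r^(1+θ/2))^2 = r * r^(1+θ) := by
      rw [← Real.rpow_natCast, ← Real.rpow_mul hr0.le]
      nth_rewrite 2 [← Real.rpow_one r]
      rw [← Real.rpow_add hr0]; congr 1; push_cast; ring
    rw [mul_pow, h2] at h1
    rw [hnz, hsg]
    have e0 : (r/4+ti)^2 = r^2/16 + r*ti/2 + ti^2 := by ring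
    rw [e0]; linarith only [h1, sq_nonneg ti]
  have g1 := phi_gain hθ hθ1 ha (by linarith) hz1 (by rw [abs_of_nonneg (by linarith)]; exact hsg1) hperp
  have g2 := phi_gain hθ hθ1 (z := -z) ha (by linarith) (by rw [norm_neg]; exact hz1)
    (by rw [inner_neg_right, neg_div, abs_neg, abs_of_nonneg (by linarith)]; exact hsg1)
    (by rw [inner_neg_right, norm_neg, neg_div, neg_sq]; exact hperp)
  rw [inner_neg_right, neg_div] at g2
  have hz4 : ‖z‖ ≤ eta (xb,tb)/(4*β) := by
    rw [le_div_iff₀ (by positivity)]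
    have := mul_le_mul_of_nonneg_right hz1 (by positivity : 0 ≤ 4*β)
    linarith only [this, hr8, mul_pos hr0 hβ0]
  obtain ⟨q1, q2, -, -, -⟩ := pw1 hθ hθ1 hβ hL MP hr hz4
  obtain ⟨-, -, -, h4⟩ := g_expand hβ MP.hx MP.ht MP.ht0.le hz4
  have e1 : xb + z - yb = a + z := by rw [had]; abel
  have e2 : xb - (yb + z) = a + -z := by rw [had]; abel
  rw [e1] at q1
  rw [e2] at q2
  have hD1 := dphi_le hθ hr0.le
  have hD2 := dphi_ge hθ hθ1 hr0.le (by linarith : r ≤ 4)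
  set D := dphi θ r
  set sg := ⟪a,z⟫/r
  set B := L * gg β (xb,tb) with hB
  set d1 := θ^2/25600 with hd1
  have hd1p : 0 < d1 := by positivity
  have hd1s : d1 ≤ 1/8 := by
    have : θ^2 ≤ 1 := pow_le_one₀ hθ.le hθ1
    rw [hd1]; linarith only [this]
  have hrt : r^(1+θ) = r * r^θ := rpow_split hθ hr0.le
  have hrt0 : 0 < r^(1+θ) := by positivity
  have hrt1 : r^(1+θ) ≤ r := by
    calc r^(1+θ) ≤ r^(1:ℝ) := Real.rpow_le_rpow_of_exponent_ge hr0 (by linarith) (by linarith)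
      _ = r := Real.rpow_one r
  have hnaz : ‖a+z‖ ≤ 3*r/2 := (norm_add_le _ _).trans (by linarith)
  have hf1 := phi_le (θ := θ) (norm_nonneg (a+z))
  have hf2 := phi_ge hθ hθ1 (norm_nonneg (a+z)) (by linarith : ‖a+z‖ ≤ 4)
  have herr : L * phi θ ‖a+z‖ * (gg β (xb+z,tb) - gg β (xb,tb)) ≤ d1/2 * (B * r^(1+θ)) := by
    have k1 : 0 ≤ phi θ ‖a+z‖ := by linarith [norm_nonneg (a+z)]
    calc L * phi θ ‖a+z‖ * (gg β (xb+z,tb) - gg β (xb,tb))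
        ≤ L * phi θ ‖a+z‖ * (4*β*gg β (xb,tb)*‖z‖/eta (xb,tb)) := by
          gcongr; exact (le_abs_self _).trans h4
      _ ≤ L * (3*r/2) * (4*β*gg β (xb,tb)*(r/2)/eta (xb,tb)) := by
          gcongr; exact hf1.trans hnaz
      _ = (3/4) * (4*β*(r/eta (xb,tb))) * (B*r) := by rw [hB]; ring
      _ ≤ (3/4) * (θ^2/51200 * r^θ) * (B*r) := by gcongr
      _ = (3/4) * (d1/2 * (B * r^(1+θ))) := by rw [hrt, hd1]; ring
      _ ≤ 1 * (d1/2 * (B * r^(1+θ))) := by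
          apply mul_le_mul_of_nonneg_right (by norm_num) (by positivity)
      _ = _ := one_mul _
  set l := B * (D * sg) with hl
  set d := d1/2 * (B * r^(1+θ)) with hd
  have hDs1 : r/16 ≤ D * sg := by
    have := mul_le_mul hD2 hsg1 (by positivity) (by linarith only [hD2])
    linarith only [this]
  have hDs2 : D * sg ≤ 3*r/8 := by
    have := mul_le_mul hD1 hsg2 (by linarith only [hsg1, hr0]) (by norm_num)
    linarith only [this]
  have hBr : 0 < B*r := by positivity
  have hl1 : B*r/16 ≤ l := by
    have := mul_le_mul_of_nonneg_left hDs1 hLg.le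
    rw [hl]; linarith only [this]
  have hl2 : l ≤ 16*(B*r) := by
    have := mul_le_mul_of_nonneg_left hDs2 hLg.le
    rw [hl]; linarith only [this, hBr]
  have hd0 : 0 ≤ d := by positivity
  have hdl : d ≤ l := by
    have : B * r^(1+θ) ≤ B*r := by gcongr
    have : d ≤ 1/16 * (B*r) := by rw [hd]; exact mul_le_mul (by linarith) this (by positivity) (by norm_num)
    linarith
  have s1 : -l + d ≤ u xb tb - u (xb+z) tb := by
    refine le_trans ?_ q1
    have := mul_le_mul_of_nonneg_left g1 hLg.le
    have e : L * phi θ ‖a+z‖ * gg β (xb+z,tb) - L * phi θ r * gg β (xb,tb) =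
      L * phi θ ‖a+z‖ * (gg β (xb+z,tb) - gg β (xb,tb)) + (B * phi θ ‖a+z‖ - B * phi θ r) := by rw [hB]; ring
    rw [e, hl]
    have e3 : d1 * (B * r^(1+θ)) = 2*d := by rw [hd]; ring
    have e4 : B * (phi θ r + D * sg - d1 * r^(1+θ)) = B * phi θ r + B*(D*sg) - d1 * (B * r^(1+θ)) := by ring
    rw [e4] at this
    linarith
  have s2 : u yb τb - u (yb+z) τb ≤ -l := by
    refine q2.trans ?_
    have := mul_le_mul_of_nonneg_left g2 hLg.le
    have e4 : B * (phi θ r + D * -sg - d1 * r^(1+θ)) = B * phi θ r - B*(D*sg) - d1 * (B * r^(1+θ)) := by ring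
    rw [e4] at this
    have e3 : d1 * (B * r^(1+θ)) = 2*d := by rw [hd]; ring
    have e5 : L * phi θ ‖a+ -z‖ * gg β (xb,tb) - L * phi θ r * gg β (xb,tb) = B * phi θ ‖a+ -z‖ - B * phi θ r := by rw [hB]; ring
    rw [e5, hl]
    linarith
  have j1 := Jp_mono hp s1
  have j2 := Jp_mono hp s2
  have j3 := Jp_gain hp (lt_of_lt_of_le (by positivity) hl1) hd0 hdl
  have j4 := (rpow_low hp hBr hl1 hl2).1
  have hq : 0 ≤ min 1 (p-1) := le_min (by norm_num) (by linarith)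
  have j5 : (min 1 (p-1) * (1/16)^p * (θ^2/51200)) * (B^(p-1) * r^(p-1+θ)) = min 1 (p-1) * ((1/16)^p * (B*r)^(p-2)) * d := by
    have k1 : B^(p-1) = B^(p-2) * B := by
      rw [← Real.rpow_add_one hLg.ne']; congr 1; ring
    have k2 : r^(p-1+θ) = r^(p-2) * r^(1+θ) := by rw [← Real.rpow_add hr0]; congr 1; ring
    rw [Real.mul_rpow hLg.le hr0.le, k1, k2, hd, hd1]; ring
  rw [j5]
  have j6 : min 1 (p-1) * ((1/16)^p * (B*r)^(p-2)) * d ≤ min 1 (p-1) * l^(p-2) * d := by gcongr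
  linarith

lemma pw_out (S : Sol N p s lam Lam K u) (hθ : 0 < θ) (hθ1 : θ ≤ 1) (hβ : 1 ≤ β) (hL : 0 < L)
    (MP : MaxPt L θ β κ ε u xb yb tb τb) (hr : ‖xb-yb‖ ≤ eta (xb,tb)/(8*β)) {z : Euc N}
    (hz0 : z ≠ 0) (hz : ‖z‖ < 1/4) :
    -(2*p*((2*β*(‖xb-yb‖/eta (xb,tb)))^(min 1 (p-1)) * (3*(L*gg β (xb,tb)))^(p-1)) * ‖z‖^(p-1) +
      {z : Euc N | eta (xb,tb)/(4*β) ≤ ‖z‖}.indicator (fun _ => (2*2^(p-1):ℝ)) z) ≤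
      Jp p (u xb tb - u (xb+z) tb) - Jp p (u yb τb - u (yb+z) τb) := by
  have hp := S.hp
  have hη := eta_pos MP.hx MP.ht
  have hη1 := eta_lt_one MP.hx.le MP.ht.le MP.ht0.le
  have hβ0 : 0 < β := by linarith
  have hg : 0 < gg β (xb,tb) := Real.rpow_pos_of_pos hη _
  have ha : xb - yb ≠ 0 := sub_ne_zero.2 MP.hne
  have hr0 : 0 < ‖xb-yb‖ := norm_pos_iff.2 ha
  have hr8 : ‖xb-yb‖ * (8*β) ≤ eta (xb,tb) := (le_div_iff₀ (by positivity)).1 hr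
  have hr1 : ‖xb-yb‖ ≤ 1/8 := by nlinarith
  have hLg : 0 < L * gg β (xb,tb) := mul_pos hL hg
  have hzp : 0 < ‖z‖ := norm_pos_iff.2 hz0
  have hA : 0 ≤ 2*p*((2*β*(‖xb-yb‖/eta (xb,tb)))^(min 1 (p-1)) * (3*(L*gg β (xb,tb)))^(p-1)) * ‖z‖^(p-1) := by positivity
  by_cases h : eta (xb,tb)/(4*β) ≤ ‖z‖
  · rw [indicator_of_mem (by exact h)]
    have b1 : ‖yb‖ ≤ 3/2 + 1/8 := by
      have : yb = xb - (xb - yb) := by abel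
      rw [this]; exact (norm_sub_le _ _).trans (by linarith [MP.hx])
    have c1 : |u xb tb| ≤ 1 := S.bdd xb (by rw [mem_ball_zero_iff]; linarith [MP.hx]) tb ⟨by linarith [MP.ht], MP.ht0.le⟩
    have c2 : |u (xb+z) tb| ≤ 1 := S.bdd _ (by rw [mem_ball_zero_iff]; linarith [MP.hx, norm_add_le xb z]) tb ⟨by linarith [MP.ht], MP.ht0.le⟩
    have c3 : |u yb τb| ≤ 1 := S.bdd yb (by rw [mem_ball_zero_iff]; linarith) τb ⟨by linarith [MP.hτ], MP.hτ0.le⟩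
    have c4 : |u (yb+z) τb| ≤ 1 := S.bdd _ (by rw [mem_ball_zero_iff]; linarith [norm_add_le yb z]) τb ⟨by linarith [MP.hτ], MP.hτ0.le⟩
    rw [abs_le] at c1 c2 c3 c4
    have d1 : |Jp p (u xb tb - u (xb+z) tb)| ≤ 2^(p-1) := by
      rw [Jp_abs hp]; apply Real.rpow_le_rpow (abs_nonneg _) _ (by linarith)
      rw [abs_le]; constructor <;> linarith
    have d2 : |Jp p (u yb τb - u (yb+z) τb)| ≤ 2^(p-1) := by
      rw [Jp_abs hp]; apply Real.rpow_le_rpow (abs_nonneg _) _ (by linarith)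
      rw [abs_le]; constructor <;> linarith
    rw [abs_le] at d1 d2
    linarith
  · rw [indicator_of_notMem (by exact h), add_zero]
    push Not at h
    obtain ⟨-, -, q3, q4, q5⟩ := pw1 hθ hθ1 hβ hL MP hr h.le
    have hBz : 0 < L * gg β (xb,tb) * ‖z‖ := by positivity
    have hc : 0 ≤ β*(L*gg β (xb,tb))*(‖xb-yb‖/eta (xb,tb))*‖z‖ := by positivity
    have := Jp_outer hp (S := 3*(L*gg β (xb,tb))*‖z‖) (χ := 2*β*(‖xb-yb‖/eta (xb,tb)))
      (dx := u xb tb - u (xb+z) tb) (dy := u yb τb - u (yb+z) τb) (by positivity) (by positivity)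
      (by linarith) (by linarith) (by linarith)
    rw [Real.mul_rpow (by positivity) hzp.le] at this
    refine le_trans (le_of_eq ?_) this
    ring

lemma I1' {N : ℕ} (hN : 1 ≤ N) {γ : ℝ} (hγ : 0 < γ) :
    ∃ C : ℝ, 0 < C ∧ ∀ δ : ℝ, 0 < δ →
      IntegrableOn (fun z : Euc N => ‖z‖ ^ (-((N:ℝ) + γ))) {z : Euc N | δ ≤ ‖z‖} ∧
      ∫ z in {z : Euc N | δ ≤ ‖z‖}, ‖z‖ ^ (-((N:ℝ) + γ)) ≤ C * δ ^ (-γ) := by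
  obtain ⟨C, hC, h⟩ := I1 hN hγ
  refine ⟨C, hC, fun δ hδ => ?_⟩
  have h1 := h δ hδ
  have hm : AEStronglyMeasurable (fun z : Euc N => ‖z‖ ^ (-((N:ℝ) + γ))) (volume.restrict {z : Euc N | δ ≤ ‖z‖}) :=
    (measurable_norm.pow_const _).aestronglyMeasurable
  have hnn : ∀ z : Euc N, 0 ≤ ‖z‖ ^ (-((N:ℝ) + γ)) := fun z => by positivity
  constructor
  · refine ⟨hm, ?_⟩
    rw [hasFiniteIntegral_iff_ofReal (ae_of_all _ hnn)]
    exact h1.trans_lt ENNReal.ofReal_lt_top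
  · rw [integral_eq_lintegral_of_nonneg_ae (ae_of_all _ hnn) hm]
    exact ENNReal.toReal_le_of_le_ofReal (by positivity) h1

lemma outer_int {C1 C2 σ γ ρ ρ1 δ A1 A2 c0 : ℝ} {H : Euc N → ℝ} {G : Set (Euc N)}
    (i1 : IntegrableOn (fun z : Euc N => ‖z‖ ^ (-((N:ℝ) + σ))) {z : Euc N | ρ ≤ ‖z‖})
    (i1' : ∫ z in {z : Euc N | ρ ≤ ‖z‖}, ‖z‖ ^ (-((N:ℝ) + σ)) ≤ C1)
    (i2 : IntegrableOn (fun z : Euc N => ‖z‖ ^ (-((N:ℝ) + γ))) {z : Euc N | δ ≤ ‖z‖})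
    (i2' : ∫ z in {z : Euc N | δ ≤ ‖z‖}, ‖z‖ ^ (-((N:ℝ) + γ)) ≤ C2)
    (hH : IntegrableOn H (annZ N ρ ρ1)) (hG : MeasurableSet G) (hGs : G ⊆ annZ N ρ ρ1)
    (hA1 : 0 ≤ A1) (hA2 : 0 ≤ A2) (hg : ∀ z ∈ G, c0 ≤ H z)
    (hl : ∀ z ∈ annZ N ρ ρ1, -(A1 * ‖z‖ ^ (-((N:ℝ) + σ)) +
      {z : Euc N | δ ≤ ‖z‖}.indicator (fun z => A2 * ‖z‖ ^ (-((N:ℝ) + γ))) z) ≤ H z) :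
    c0 * volume.real G - A1*C1 - A2*C2 ≤ ∫ z in annZ N ρ ρ1, H z := by
  have hm := annZ_meas N ρ ρ1
  have hδm : MeasurableSet {z : Euc N | δ ≤ ‖z‖} := measurableSet_le measurable_const measurable_norm
  have hρm : MeasurableSet {z : Euc N | ρ ≤ ‖z‖} := measurableSet_le measurable_const measurable_norm
  have hsub : annZ N ρ ρ1 ⊆ {z : Euc N | ρ ≤ ‖z‖} := fun z hz => hz.1
  have j1 : IntegrableOn (fun z : Euc N => A1 * ‖z‖ ^ (-((N:ℝ) + σ))) (annZ N ρ ρ1) := (i1.mono_set hsub).const_mul A1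
  have j2g : Integrable ({z : Euc N | δ ≤ ‖z‖}.indicator (fun z : Euc N => A2 * ‖z‖ ^ (-((N:ℝ) + γ)))) :=
    (integrable_indicator_iff hδm).2 (i2.const_mul A2)
  have j2 : IntegrableOn (fun z => {z : Euc N | δ ≤ ‖z‖}.indicator (fun z : Euc N => A2 * ‖z‖ ^ (-((N:ℝ) + γ))) z) (annZ N ρ ρ1) := j2g.integrableOn
  have hGf : volume G < ⊤ := (measure_mono hGs).trans_lt (annZ_fin _ _ _)
  have j0g : Integrable (G.indicator (fun _ : Euc N => c0)) :=
    (integrable_indicator_iff hG).2 (integrableOn_const hGf.ne)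
  have j0 : IntegrableOn (fun z => G.indicator (fun _ : Euc N => c0) z) (annZ N ρ ρ1) := j0g.integrableOn
  have j3 : IntegrableOn (fun z => G.indicator (fun _ : Euc N => c0) z - (A1 * ‖z‖ ^ (-((N:ℝ) + σ)) +
      {z : Euc N | δ ≤ ‖z‖}.indicator (fun z => A2 * ‖z‖ ^ (-((N:ℝ) + γ))) z)) (annZ N ρ ρ1) := j0.sub (j1.add j2)
  have main := setIntegral_mono_on j3 hH hm (fun z hz => by
    have hn : 0 ≤ A1 * ‖z‖ ^ (-((N:ℝ) + σ)) +
      {z : Euc N | δ ≤ ‖z‖}.indicator (fun z => A2 * ‖z‖ ^ (-((N:ℝ) + γ))) z := by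
      apply add_nonneg (by positivity)
      apply indicator_nonneg; intro z _; positivity
    by_cases h : z ∈ G
    · rw [indicator_of_mem h]; have := hg z h; linarith
    · rw [indicator_of_notMem h]; have := hl z hz; linarith)
  have e0 : ∫ z in annZ N ρ ρ1, G.indicator (fun _ : Euc N => c0) z = c0 * volume.real G := by
    rw [setIntegral_indicator hG, inter_eq_self_of_subset_right hGs, setIntegral_const, smul_eq_mul, mul_comm]
  have e1 : ∫ z in annZ N ρ ρ1, A1 * ‖z‖ ^ (-((N:ℝ) + σ)) ≤ A1 * C1 := by
    rw [integral_const_mul]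
    apply mul_le_mul_of_nonneg_left _ hA1
    refine le_trans ?_ i1'
    exact setIntegral_mono_set i1 (ae_of_all _ fun z => by positivity) hsub.eventuallyLE
  have e2 : ∫ z in annZ N ρ ρ1, {z : Euc N | δ ≤ ‖z‖}.indicator (fun z => A2 * ‖z‖ ^ (-((N:ℝ) + γ))) z ≤ A2 * C2 := by
    calc _ ≤ ∫ z, {z : Euc N | δ ≤ ‖z‖}.indicator (fun z => A2 * ‖z‖ ^ (-((N:ℝ) + γ))) z :=
          setIntegral_le_integral j2g (ae_of_all _ fun z => indicator_nonneg (fun z _ => by positivity) z)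
      _ = A2 * ∫ z in {z : Euc N | δ ≤ ‖z‖}, ‖z‖ ^ (-((N:ℝ) + γ)) := by
          rw [integral_indicator hδm, integral_const_mul]
      _ ≤ _ := mul_le_mul_of_nonneg_left i2' hA2
  have e3 := integral_sub j0 (j1.add j2)
  have e4 := integral_add j1 j2
  simp only [Pi.add_apply] at e3
  rw [e3, e0, e4] at main
  linarith

end Part18

section Part19
open scoped RealInnerProductSpace

variable {N : ℕ} {p s lam Lam : ℝ} {K : Euc N → ℝ} {u : Euc N → ℝ → ℝ}
variable {L θ β κ ε : ℝ} {xb yb : Euc N} {tb τb : ℝ}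

lemma annZ_split (hp : 1 < p) (hsp : 0 < s * p) (hLam : 0 < Lam) (hK : IsKernel N p s lam Lam K)
    {f : Euc N → ℝ} (hf : Continuous f) {ρ0 ρ ρ1 : ℝ} (h0 : 0 < ρ0) (h1 : ρ0 ≤ ρ) (h2 : ρ ≤ ρ1) :
    ∫ z in annZ N ρ0 ρ1, Jp p (f z) * K z = (∫ z in annZ N ρ0 ρ, Jp p (f z) * K z) +
      ∫ z in annZ N ρ ρ1, Jp p (f z) * K z := by
  have e : annZ N ρ0 ρ1 = annZ N ρ0 ρ ∪ annZ N ρ ρ1 := by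
    ext z
    simp only [annZ, mem_union, mem_ofPred_eq]
    constructor
    · rintro ⟨a, b⟩
      rcases lt_or_ge ‖z‖ ρ with h | h
      · exact Or.inl ⟨a, h⟩
      · exact Or.inr ⟨h, b⟩
    · rintro (⟨a, b⟩ | ⟨a, b⟩)
      · exact ⟨a, by linarith⟩
      · exact ⟨by linarith, b⟩
  have hd : Disjoint (annZ N ρ0 ρ) (annZ N ρ ρ1) := by
    rw [Set.disjoint_left]
    intro z hz hz'
    exact absurd hz'.1 (not_le.2 hz.2)
  rw [e, setIntegral_union hd (annZ_meas _ _ _)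
    (annZ_integrable hp hsp hLam hK hf h0) (annZ_integrable hp hsp hLam hK hf (h0.trans_le h1))]

lemma vol_cb (c : Euc N) {R : ℝ} (hR : 0 ≤ R) :
    volume.real (closedBall c R) = R^N * volume.real (ball (0 : Euc N) 1) := by
  unfold Measure.real
  rw [Measure.addHaar_closedBall _ _ hR, ENNReal.toReal_mul, ENNReal.toReal_ofReal (by positivity),
    finrank_euclideanSpace, Fintype.card_fin]

set_option maxHeartbeats 1000000 in
lemma fin_ineq (S : Sol N p s lam Lam K u) (hsp1 : p - 1 < s * p) (hlam : 0 < lam) {C0 CS C1 C2 θ' : ℝ}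
    (hC0 : 0 < C0)
    (hfar : ∀ᵐ t : ℝ, t ∈ Ioo (-2 : ℝ) 0 → ∀ x ∈ closedBall (0 : Euc N) (7/4),
        ∫⁻ y in {y : Euc N | 1/4 ≤ ‖x - y‖},
          ENNReal.ofReal |Jp p (u x t - u y t) * K (x - y)| ≤ ENNReal.ofReal C0)
    (hCS : 0 < CS)
    (hS : ∀ (P : Euc N) (M δ ρ : ℝ) (f : Euc N → ℝ), Continuous f → 0 < δ → 0 < ρ → P ≠ 0 → 0 ≤ M →
      M * ρ ≤ ‖P‖ → (∀ z, ‖z‖ < ρ → -⟪P, z⟫ - M * ‖z‖^2 ≤ f z) →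
      -(CS * (‖P‖^(p-2) * M * ρ^(p-s*p))) ≤ ∫ z in annZ N δ ρ, Jp p (f z) * K z)
    (h1 : ∀ δ : ℝ, 0 < δ →
      IntegrableOn (fun z : Euc N => ‖z‖ ^ (-((N:ℝ) + (s*p-(p-1))))) {z : Euc N | δ ≤ ‖z‖} ∧
      ∫ z in {z : Euc N | δ ≤ ‖z‖}, ‖z‖ ^ (-((N:ℝ) + (s*p-(p-1)))) ≤ C1 * δ ^ (-(s*p-(p-1))))
    (h2 : ∀ δ : ℝ, 0 < δ →
      IntegrableOn (fun z : Euc N => ‖z‖ ^ (-((N:ℝ) + s*p))) {z : Euc N | δ ≤ ‖z‖} ∧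
      ∫ z in {z : Euc N | δ ≤ ‖z‖}, ‖z‖ ^ (-((N:ℝ) + s*p)) ≤ C2 * δ ^ (-(s*p)))
    (hθ : 0 < θ) (hθ1 : θ ≤ 1) (hβ : 1 ≤ β) (hL : 0 < L) (hκ : 0 < κ) (hθ' : 0 < θ')
    (MP : MaxPt L θ β κ ε u xb yb tb τb) {r η B χ : ℝ} (hrd : r = ‖xb-yb‖) (hηd : η = eta (xb,tb))
    (hBd : B = L * gg β (xb,tb)) (hχd : χ = r/η)
    (hr : r ≤ η/(8*β)) (hχ : 4*β*χ ≤ θ^2/51200 * r^θ) (hρ : r^θ' ≤ 1/8) :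
    (min 1 (p-1) * (1/16)^p * (θ^2/51200)) * lam * ((θ/160)^N * volume.real (ball (0 : Euc N) 1))
        * (B^(p-1) * r^(-(s*p-(p-1)) + θ*(1+N/2))) ≤
      3*C0 + β*B*χ + 4*CS*16^p*(B^(p-1)*r^(-(s*p-(p-1))+θ'*(p-s*p))) +
      2*p*((2*β*χ)^(min 1 (p-1)) * (3*B)^(p-1))*Lam*C1*(r^(1+θ'))^(-(s*p-(p-1)))
      + 2*2^(p-1)*Lam*C2*(η/(4*β))^(-(s*p)) := by
  have hp := S.hp
  have hLam := S.hLam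
  have hK := S.ker
  have hsp : 0 < s * p := mul_pos S.hs.1 (by linarith)
  have hη : 0 < η := by rw [hηd]; exact eta_pos MP.hx MP.ht
  have hη1 : η < 1 := by rw [hηd]; exact eta_lt_one MP.hx.le MP.ht.le MP.ht0.le
  have hβ0 : 0 < β := by linarith
  have hg : 0 < gg β (xb,tb) := Real.rpow_pos_of_pos (eta_pos MP.hx MP.ht) _
  have ha : xb - yb ≠ 0 := sub_ne_zero.2 MP.hne
  have hr0 : 0 < r := by rw [hrd]; exact norm_pos_iff.2 ha
  have hr8 : r * (8*β) ≤ η := (le_div_iff₀ (by positivity)).1 hr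
  have hr1 : r ≤ 1/8 := by nlinarith only [hr8, hη1, hβ, hr0]
  have hB : 0 < B := by rw [hBd]; exact mul_pos hL hg
  have hχ0 : 0 < χ := by rw [hχd]; positivity
  set σ := s*p-(p-1) with hσ
  set ρ := r^(1+θ') with hρd
  have hρ0 : 0 < ρ := by positivity
  have hρr : ρ = r * r^θ' := by rw [hρd, Real.rpow_add hr0, Real.rpow_one]
  have hρ8 : ρ ≤ r/8 := by
    have := mul_le_mul_of_nonneg_left hρ hr0.le
    rw [hρr]; linarith only [this]
  have hrb : ‖xb-yb‖ ≤ eta (xb,tb)/(8*β) := by rw [← hrd, ← hηd]; exact hr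
  have hχb : 4*β*(‖xb-yb‖/eta (xb,tb)) ≤ θ^2/51200 * ‖xb-yb‖^θ := by rw [← hrd, ← hηd, ← hχd]; exact hχ
  have cx : Continuous (fun z => u xb tb - u (xb+z) tb) :=
    continuous_const.sub (S.cont.comp (by fun_prop : Continuous fun z : Euc N => (xb+z, tb)))
  have cy : Continuous (fun z => u yb τb - u (yb+z) τb) :=
    continuous_const.sub (S.cont.comp (by fun_prop : Continuous fun z : Euc N => (yb+z, τb)))
  -- the doubled inequality
  have D := doubled S hC0 hfar hθ hθ1 hβ hL hκ MP hrb
  obtain ⟨ρ0, hD, hρ0'⟩ := (D.and (Ioo_mem_nhdsGT hρ0)).exists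
  rw [← hrd, ← hηd, ← hBd, ← hχd] at hD
  have sx : midInt p K u ρ0 (1/4) (xb,tb) = (∫ z in annZ N ρ0 ρ, Jp p (u xb tb - u (xb+z) tb) * K z) +
      ∫ z in annZ N ρ (1/4), Jp p (u xb tb - u (xb+z) tb) * K z :=
    annZ_split hp hsp hLam hK cx hρ0'.1 hρ0'.2.le (by linarith)
  have sy : midInt p K u ρ0 (1/4) (yb,τb) = (∫ z in annZ N ρ0 ρ, Jp p (u yb τb - u (yb+z) τb) * K z) +
      ∫ z in annZ N ρ (1/4), Jp p (u yb τb - u (yb+z) τb) * K z :=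
    annZ_split hp hsp hLam hK cy hρ0'.1 hρ0'.2.le (by linarith)
  -- inner estimates
  have hM0 : 0 ≤ 2*B/r := by positivity
  have hMρ : 2*B/r*ρ ≤ B/4 := by
    have : 2*B/r*ρ = 2*B*r^θ' := by rw [hρr]; field_simp
    rw [this]
    have := mul_le_mul_of_nonneg_left hρ (by positivity : 0 ≤ 2*B)
    linarith only [this]
  have inner_gen : ∀ X : ℝ, B/4 ≤ X → X ≤ 2*B →
      CS * (X^(p-2) * (2*B/r) * ρ^(p-s*p)) ≤ 2*CS*16^p*(B^(p-1)*r^(-σ+θ'*(p-s*p))) := by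
    intro X hX1 hX2
    have := (rpow_low hp hB (by linarith : B/16 ≤ X) (by linarith)).2
    have e1 : B^(p-1) = B^(p-2) * B := by
      rw [← Real.rpow_add_one hB.ne']; congr 1; ring
    have e2 : r^(-σ+θ'*(p-s*p)) = ρ^(p-s*p) / r := by
      rw [hρd, ← Real.rpow_mul hr0.le, ← Real.rpow_sub_one hr0.ne']; congr 1; rw [hσ]; ring
    calc CS * (X^(p-2) * (2*B/r) * ρ^(p-s*p)) ≤ CS * (16^p * B^(p-2) * (2*B/r) * ρ^(p-s*p)) := by gcongr
      _ = _ := by rw [e1, e2]; ring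
  have hzsmall : ∀ z : Euc N, ‖z‖ < ρ → ‖z‖ ≤ ‖xb-yb‖ ∧ ‖z‖ ≤ eta (xb,tb)/(4*β) := by
    intro z hz
    have hzr : ‖z‖ ≤ r := by linarith
    refine ⟨hrd ▸ hzr, ?_⟩
    rw [← hηd, le_div_iff₀ (by positivity)]
    have := mul_le_mul_of_nonneg_right hzr (by positivity : 0 ≤ 4*β)
    linarith only [this, hr8, mul_pos hr0 hβ0]
  have inx : -(2*CS*16^p*(B^(p-1)*r^(-σ+θ'*(p-s*p)))) ≤ ∫ z in annZ N ρ0 ρ, Jp p (u xb tb - u (xb+z) tb) * K z := by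
    have hPn := PV_norm hθ hθ1 hβ hL MP.hx MP.ht MP.ht0.le MP.hne hrb
    rw [mul_assoc 2, ← hBd] at hPn
    have := hS (PV L θ β xb yb tb) (2*B/r) ρ0 ρ (fun z => u xb tb - u (xb+z) tb) cx hρ0'.1 hρ0
      (by rw [← norm_pos_iff]; linarith [hPn.1]) hM0 (by linarith [hPn.1]) (fun z hz => by
        have a1 := pen_expand hθ hθ1 hβ hL MP.hx MP.ht MP.ht0.le MP.hne hrb (hzsmall z hz).1
        have a2 := (pw1 hθ hθ1 hβ hL MP hrb (hzsmall z hz).2).1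
        rw [mul_assoc 2, ← hBd, ← hrd] at a1
        rw [← hrd] at a2
        linarith only [a1, a2])
    have a3 := inner_gen _ hPn.1 hPn.2
    linarith only [this, a3]
  have iny : -(2*CS*16^p*(B^(p-1)*r^(-σ+θ'*(p-s*p)))) ≤ -∫ z in annZ N ρ0 ρ, Jp p (u yb τb - u (yb+z) τb) * K z := by
    have hPn := PW_norm (β := β) hθ hθ1 hL MP.hx MP.ht MP.hne (by rw [← hrd]; linarith)
    rw [mul_assoc 2, ← hBd] at hPn
    have := hS (PW L θ β xb yb tb) (2*B/r) ρ0 ρ (fun z => -(u yb τb - u (yb+z) τb)) cy.neg hρ0'.1 hρ0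
      (by rw [← norm_pos_iff]; linarith [hPn.1]) hM0 (by linarith [hPn.1]) (fun z hz => by
        have a1 := pen_expand2 (β := β) (z := z) hθ hθ1 hL MP.hx MP.ht MP.hne (by rw [← hrd]; linarith)
        have a2 := (pw1 hθ hθ1 hβ hL MP hrb (hzsmall z hz).2).2.1
        rw [mul_assoc 2, ← hBd, ← hrd] at a1
        rw [← hrd] at a2
        linarith only [a1, a2])
    have a3 := inner_gen _ hPn.1 hPn.2
    rw [← integral_neg]
    simp only [Jp_neg, neg_mul] at this
    linarith only [this, a3]
  -- outer estimate
  have jx := annZ_integrable hp hsp hLam hK cx (ρ1 := 1/4) hρ0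
  have jy := annZ_integrable hp hsp hLam hK cy (ρ1 := 1/4) hρ0
  set cG := min 1 (p-1) * (1/16)^p * (θ^2/51200) with hcG
  have hcG0 : 0 ≤ cG := by
    have : 0 ≤ min 1 (p-1) := le_min (by norm_num) (by linarith)
    positivity
  set A := 2*p*((2*β*χ)^(min 1 (p-1)) * (3*B)^(p-1)) with hA
  have hA0 : 0 ≤ A := by positivity
  set H : Euc N → ℝ := fun z => Jp p (u xb tb - u (xb+z) tb) * K z - Jp p (u yb τb - u (yb+z) τb) * K z with hH
  have hδ0 : 0 < η/(4*β) := by positivity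
  have hn0 : 0 ≤ (N:ℝ) + s*p := by positivity
  have out := outer_int (N := N) (H := H) (ρ := ρ) (ρ1 := 1/4) (A1 := A*Lam) (A2 := 2*2^(p-1)*Lam)
    (c0 := cG * (B^(p-1) * r^(p-1+θ)) * (lam * r^(-((N:ℝ)+s*p))))
    (G := closedBall ((1/4:ℝ)•(xb-yb)) (θ/160*r^(1+θ/2)))
    (h1 ρ hρ0).1 (h1 ρ hρ0).2 (h2 _ hδ0).1 (h2 _ hδ0).2 (jx.sub jy) measurableSet_closedBall
    ?_ (by positivity) (by positivity) ?_ ?_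
  · rw [vol_cb _ (by positivity)] at out
    have e1 : ∫ z in annZ N ρ (1/4), H z = (∫ z in annZ N ρ (1/4), Jp p (u xb tb - u (xb+z) tb) * K z) -
      ∫ z in annZ N ρ (1/4), Jp p (u yb τb - u (yb+z) τb) * K z := integral_sub jx jy
    have e2 : cG * (B^(p-1) * r^(p-1+θ)) * (lam * r^(-((N:ℝ)+s*p))) * ((θ/160*r^(1+θ/2))^N * volume.real (ball (0 : Euc N) 1))
       = cG * lam * ((θ/160)^N * volume.real (ball (0 : Euc N) 1)) * (B^(p-1) * r^(-σ + θ*(1+N/2))) := by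
      have : r^(-σ + θ*(1+N/2)) = r^(p-1+θ) * r^(-((N:ℝ)+s*p)) * (r^(1+θ/2))^N := by
        rw [← Real.rpow_natCast, ← Real.rpow_mul hr0.le, ← Real.rpow_add hr0, ← Real.rpow_add hr0]
        congr 1; rw [hσ]; ring
      rw [this, mul_pow]; ring
    rw [e1, e2] at out
    have e3 : 4*CS*16^p*(B^(p-1)*r^(-σ+θ'*(p-s*p))) = 2*(2*CS*16^p*(B^(p-1)*r^(-σ+θ'*(p-s*p)))) := by ring
    have e4 : A * Lam * C1 * ρ^(-σ) = A * Lam * (C1 * ρ^(-σ)) := by ring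
    have e5 : 2*2^(p-1)*Lam*C2*(η/(4*β))^(-(s*p)) = 2*2^(p-1)*Lam*(C2*(η/(4*β))^(-(s*p))) := by ring
    have e6 : β * B * χ = β * (L * gg β (xb,tb)) * χ := by rw [hBd]
    rw [e3, e4, e5]
    rw [sx, sy] at hD
    linarith only [hD, out, inx, iny]
  · intro z hz
    rw [mem_closedBall, dist_eq_norm, hrd] at hz
    obtain ⟨k1, k2, -⟩ := pw_gain hp hθ hθ1 hβ hL MP hrb hχb hz
    rw [← hrd] at k1 k2
    exact ⟨by linarith, by linarith⟩
  · intro z hz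
    rw [mem_closedBall, dist_eq_norm, hrd] at hz
    obtain ⟨k1, k2, k3⟩ := pw_gain hp hθ hθ1 hβ hL MP hrb hχb hz
    rw [← hrd] at k1 k2
    rw [← hrd, ← hBd, ← hcG] at k3
    have hz0 : z ≠ 0 := by rw [← norm_pos_iff]; linarith
    have hzp : 0 < ‖z‖ := norm_pos_iff.2 hz0
    have k4 : lam * r^(-((N:ℝ)+s*p)) ≤ K z := by
      refine le_trans ?_ (hK.2.2.2 z hz0).1
      gcongr 1
      exact Real.rpow_le_rpow_of_nonpos hzp (by linarith) (by linarith)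
    rw [hH]
    show _ ≤ Jp p (u xb tb - u (xb+z) tb) * K z - Jp p (u yb τb - u (yb+z) τb) * K z
    rw [← sub_mul]
    have k5 : 0 ≤ cG * (B^(p-1) * r^(p-1+θ)) := by positivity
    exact mul_le_mul k3 k4 (by positivity) (k5.trans k3)
  · intro z hz
    have hzp : 0 < ‖z‖ := hρ0.trans_le hz.1
    have hz0 : z ≠ 0 := norm_pos_iff.1 hzp
    have k3 := pw_out S hθ hθ1 hβ hL MP hrb hz0 hz.2
    rw [← hrd, ← hBd, ← hηd, ← hχd, ← hA] at k3
    have hKz := hK.2.2.2 z hz0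
    have hK0 := hK.2.1 z hz0
    rw [hH]
    show _ ≤ Jp p (u xb tb - u (xb+z) tb) * K z - Jp p (u yb τb - u (yb+z) τb) * K z
    rw [← sub_mul]
    have k4 := mul_le_mul_of_nonneg_right k3 hK0.le
    refine le_trans ?_ k4
    rw [neg_mul, neg_le_neg_iff]
    have hI : 0 ≤ {z : Euc N | η/(4*β) ≤ ‖z‖}.indicator (fun _ => (2*2^(p-1):ℝ)) z :=
      indicator_nonneg (fun _ _ => by positivity) _
    refine (mul_le_mul_of_nonneg_left hKz.2 (add_nonneg (by positivity) hI)).trans (le_of_eq ?_)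
    have e1 : ‖z‖^(-((N:ℝ)+σ)) = ‖z‖^(p-1) * ‖z‖^(-((N:ℝ)+s*p)) := by
      rw [← Real.rpow_add hzp]; congr 1; rw [hσ]; ring
    rw [e1]
    by_cases h : η/(4*β) ≤ ‖z‖
    · rw [indicator_of_mem (by exact h), indicator_of_mem (by exact h)]; ring
    · rw [indicator_of_notMem (by exact h), indicator_of_notMem (by exact h)]; ring

end Part19

section Part20
open scoped RealInnerProductSpace

variable {N : ℕ} {p s lam Lam : ℝ}

lemma small_pow {a c : ℝ} (ha : 0 < a) (hc : 0 < c) : ∀ᶠ r in 𝓝[>] (0:ℝ), r^a < c := by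
  have h : Tendsto (fun r : ℝ => r^a) (𝓝[>] 0) (𝓝 0) := by
    have := (Real.continuousAt_rpow_const 0 a (Or.inr ha.le)).tendsto
    rw [Real.zero_rpow ha.ne'] at this
    exact this.mono_left nhdsWithin_le_nhds
  exact h.eventually (gt_mem_nhds hc)

set_option maxHeartbeats 1000000 in
lemma no_max (hN : 1 ≤ N) (hp : 1 < p) (hs : s ∈ Ioo (0:ℝ) 1) (hsp1 : p - 1 < s * p)
    (hlam : 0 < lam) (hLam : 0 < Lam) :
    ∃ L θ β : ℝ, 64 ≤ L ∧ 0 < θ ∧ θ ≤ 1 ∧ 1 ≤ β ∧ ∀ (K : Euc N → ℝ) (u : Euc N → ℝ → ℝ),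
      Sol N p s lam Lam K u → ∀ κ ε : ℝ, 0 < κ → ∀ (xb yb : Euc N) (tb τb : ℝ),
        ¬ MaxPt L θ β κ ε u xb yb tb τb := by
  have hsp : 0 < s * p := mul_pos hs.1 (by linarith)
  have hps : 0 < p - s * p := by nlinarith [hs.2]
  set σ := s*p-(p-1) with hσ
  have hσ0 : 0 < σ := by linarith
  have hσ1 : σ < 1 := by linarith
  have hpσ : p - s*p = 1 - σ := by rw [hσ]; ring
  obtain ⟨C0, hC0, hfar⟩ := far_bound (N := N) (lam := lam) hN hp hs hLam (show (0:ℝ) < 1/4 by norm_num)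
  obtain ⟨CS, hCS, hS⟩ := lemS (N := N) (lam := lam) hN hp hs hLam
  obtain ⟨C1, hC1, h1⟩ := I1' hN hσ0
  obtain ⟨C2, hC2, h2⟩ := I1' hN hsp
  set q := min 1 (p-1) with hq
  have hq0 : 0 < q := lt_min (by norm_num) (by linarith)
  have hq1 : q ≤ 1 := min_le_left _ _
  have hqp : q ≤ p-1 := min_le_right _ _
  set β := 4/q + s*p/(p-1) + 1 with hβd
  have hp1 : 0 < p - 1 := by linarith
  have hβ : 1 ≤ β := by
    have : 0 ≤ 4/q := by positivity
    have : 0 ≤ s*p/(p-1) := by positivity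
    linarith
  have hβ0 : 0 < β := by linarith
  set α := 1/β with hα
  have hα0 : 0 < α := by positivity
  have hαq : α ≤ q/4 := by
    have h : 4/q ≤ β := by have : 0 ≤ s*p/(p-1) := by positivity
                           linarith
    rw [hα, div_le_iff₀ hβ0]
    rw [div_le_iff₀ hq0] at h
    linarith
  have hαs : α*(s*p) ≤ p-1 := by
    have h : s*p/(p-1) ≤ β := by have : 0 ≤ 4/q := by positivity
                                 linarith
    rw [div_le_iff₀ hp1] at h
    rw [hα, one_div_mul_eq_div, div_le_iff₀ hβ0]
    linarith
  set θ' := q/4 with hθ'd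
  have hθ' : 0 < θ' := by positivity
  have hαq' : α ≤ q/4 := hαq
  have hθ'q : θ' = q/4 := rfl
  set ω := min σ (min (θ'*(1-σ)) (q/2)) with hω
  have hω0 : 0 < ω := lt_min hσ0 (lt_min (mul_pos hθ' (by linarith)) (by positivity))
  have hω1 : ω ≤ σ := min_le_left _ _
  have hω2 : ω ≤ θ'*(1-σ) := (min_le_right _ _).trans (min_le_left _ _)
  have hω3 : ω ≤ q/2 := (min_le_right _ _).trans (min_le_right _ _)
  have hN' : (1:ℝ) ≤ N := by exact_mod_cast hN
  set θ := ω/(N+2) with hθd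
  have hθ : 0 < θ := by positivity
  have hθ4 : θ ≤ 1/4 := by
    rw [hθd, div_le_iff₀ (by positivity)]; linarith
  have hθ1 : θ ≤ 1 := by linarith
  have hθω : θ*(1+N/2) = ω/2 := by rw [hθd]; field_simp; ring
  set c := (q * (1/16)^p * (θ^2/51200)) * lam * ((θ/160)^N * volume.real (ball (0 : Euc N) 1)) with hc
  have hV : 0 < volume.real (ball (0 : Euc N) 1) :=
    ENNReal.toReal_pos (measure_ball_pos _ _ (by norm_num)).ne' measure_ball_lt_top.ne
  have hc0 : 0 < c := by positivity
  set C' := 3*C0 + 4*β + 4*CS*16^p + 2*p*((2*β)^q*3^(p-1))*Lam*C1 + 2*2^(p-1)*Lam*C2*(4*β)^(s*p) with hC'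
  have hC'0 : 0 < C' := by positivity
  obtain ⟨r0, hr0all⟩ := mem_nhdsGT_iff_exists_Ioo_subset.1
    ((small_pow (show (0:ℝ) < 1/2 by norm_num) (show 0 < 1/(8*β) by positivity)).and
      ((small_pow (show (0:ℝ) < 1/2 by norm_num) (show 0 < θ^2/51200/(4*β) by positivity)).and
      ((small_pow hθ' (show (0:ℝ) < 1/8 by norm_num)).and
        (small_pow (show 0 < ω/2 by positivity) (show 0 < c/C' by positivity)))))
  obtain ⟨hr00, hr0s⟩ := hr0all
  have hr00 : 0 < r0 := hr00
  set L := 64 + 8/r0 with hL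
  have hL64 : 64 ≤ L := by have : 0 < 8/r0 := by positivity
                           linarith
  have hL0 : 0 < L := by linarith
  refine ⟨L, θ, β, hL64, hθ, hθ1, hβ, ?_⟩
  intro K u S κ ε hκ xb yb tb τb MP
  have hη := eta_pos MP.hx MP.ht
  have hη1 := eta_lt_one MP.hx.le MP.ht.le MP.ht0.le
  have hg1 := gg_one_le hβ0.le MP.hx MP.ht MP.ht0.le
  have ha : xb - yb ≠ 0 := sub_ne_zero.2 MP.hne
  have hrp : 0 < ‖xb-yb‖ := norm_pos_iff.2 ha
  have hr4 : ‖xb-yb‖ ≤ 4 := (norm_sub_le _ _).trans (by linarith [MP.hx, MP.hy])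
  have hphi := phi_ge hθ hθ1 hrp.le hr4
  have hsm := MP.hsm
  obtain ⟨r, hr⟩ : ∃ r, r = ‖xb-yb‖ := ⟨_, rfl⟩
  obtain ⟨η, hηe⟩ : ∃ η, η = eta (xb,tb) := ⟨_, rfl⟩
  obtain ⟨g, hge⟩ : ∃ g, g = gg β (xb,tb) := ⟨_, rfl⟩
  have hgη : g = η^(-β) := by rw [hge, hηe]; rfl
  have key : r ≤ η/(8*β) → 4*β*(r/η) ≤ θ^2/51200 * r^θ → r^θ' ≤ 1/8 → _ :=
    fun a1 a2 a3 => fin_ineq S hsp1 hlam hC0 (hfar K u S) hCS (hS K S.ker) h1 h2 hθ hθ1 hβ hL0 hκ hθ' MP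
      hr hηe rfl rfl a1 a2 a3
  rw [← hge] at key hsm hg1
  rw [← hηe] at hη hη1
  rw [← hr] at hrp hr4 hphi hsm
  rw [← hq, ← hσ, hθω, hpσ, ← hc] at key
  clear_value c C' L θ ω θ' α β q σ
  clear hfar hS h1 h2 hr hηe hge ha MP S
  set B := L * g with hB
  have hB64 : 64 ≤ B := by
    have : L*1 ≤ L*g := mul_le_mul_of_nonneg_left hg1 hL0.le
    rw [hB]; linarith only [this, hL64]
  have hB0 : 0 < B := by linarith
  have hrB : r * B ≤ 4 := by
    have : L * (r/2) * g ≤ L * phi θ r * g := by gcongr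
    rw [hB]; linarith
  have hrL : r * L ≤ 4 := by
    have : r * L * 1 ≤ r * L * g := by gcongr
    rw [hB] at hrB; linarith
  have hrg : r * g ≤ 1 := by
    have : r * g * 64 ≤ r * g * L := by gcongr
    rw [hB] at hrB; linarith
  have hrr0 : r < r0 := by
    by_contra hcon
    push Not at hcon
    have : r0 * L ≤ r * L := by gcongr
    have e : r0 * L = 64*r0 + 8 := by rw [hL]; field_simp
    linarith
  have hr1 : r < 1 := by
    have : r*64 ≤ r*L := mul_le_mul_of_nonneg_left hL64 hrp.le
    linarith only [this, hrL]
  obtain ⟨k1, k2, k3, k4⟩ := hr0s ⟨hrp, hrr0⟩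
  -- chi
  have hηg : η⁻¹ = g^α := by
    rw [hgη, ← Real.rpow_mul hη.le, ← Real.rpow_neg_one]
    congr 1; rw [hα]; field_simp
  have hg0 : 0 < g := by linarith
  have hgr : g ≤ r⁻¹ := by
    rw [← one_div, le_div_iff₀ hrp]; linarith
  have hχ : r/η ≤ r^(1-α) := by
    rw [div_eq_mul_inv, hηg]
    calc r * g^α ≤ r * (r⁻¹)^α := by gcongr
      _ = r^(1-α) := by
        rw [Real.inv_rpow hrp.le, ← Real.rpow_neg hrp.le]
        nth_rewrite 1 [← Real.rpow_one r]
        rw [← Real.rpow_add hrp]; rfl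
  have hχ0 : 0 < r/η := by positivity
  have hmono : ∀ a b : ℝ, a ≤ b → r^b ≤ r^a := fun a b hab => Real.rpow_le_rpow_of_exponent_ge hrp hr1.le hab
  have c1 : r ≤ η/(8*β) := by
    have : r/η ≤ 1/(8*β) := hχ.trans ((hmono (1/2) (1-α) (by linarith)).trans k1.le)
    rw [div_le_iff₀ hη] at this
    calc r ≤ _ := this
      _ = _ := by ring
  have c2 : 4*β*(r/η) ≤ θ^2/51200 * r^θ := by
    have a1 : r^(1-α) ≤ r^(1/2:ℝ) * r^θ := by
      rw [← Real.rpow_add hrp]; exact hmono _ _ (by linarith)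
    calc 4*β*(r/η) ≤ 4*β*(θ^2/51200/(4*β) * r^θ) := by
          gcongr; exact hχ.trans (a1.trans (by gcongr))
      _ = _ := by field_simp
  have main := key c1 c2 k3.le
  clear key
  have hBp : 1 ≤ B^(p-1) := Real.one_le_rpow (by linarith) hp1.le
  set T := B^(p-1) * r^(-σ+ω) with hT
  have hrT : 1 ≤ r^(-σ+ω) := Real.one_le_rpow_of_pos_of_le_one_of_nonpos hrp hr1.le (by linarith)
  have hBT : B^(p-1) ≤ T := le_mul_of_one_le_right (by linarith) hrT
  have hT1 : 1 ≤ T := hBp.trans hBT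
  have t1 : 3*C0 ≤ 3*C0*T := le_mul_of_one_le_right (by positivity) hT1
  have t2 : β*B*(r/η) ≤ 4*β*T := by
    have : B*(r/η) ≤ 4*B^(p-1) := by
      rcases le_total 2 p with h | h
      · have b1 : B ≤ B^(p-1) := by
          calc B = B^(1:ℝ) := (Real.rpow_one B).symm
            _ ≤ _ := Real.rpow_le_rpow_of_exponent_le (by linarith) (by linarith)
        have b2 : r/η ≤ 1 := hχ.trans (Real.rpow_le_one hrp.le hr1.le (by linarith))
        calc B*(r/η) ≤ B^(p-1)*1 := by gcongr
          _ ≤ _ := by linarith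
      · have b1 : B = B^(p-1) * B^(2-p) := by rw [← Real.rpow_add hB0]; ring_nf; rw [Real.rpow_one]
        have b3 : (r*B)^(2-p) ≤ 4 := by
          calc (r*B)^(2-p) ≤ 4^(2-p) := Real.rpow_le_rpow (by positivity) hrB (by linarith)
            _ ≤ 4^(1:ℝ) := Real.rpow_le_rpow_of_exponent_le (by norm_num) (by linarith)
            _ = 4 := Real.rpow_one 4
        have b4 : r^(1-α) ≤ r^(2-p) := hmono _ _ (by linarith)
        calc B*(r/η) ≤ B * r^(2-p) := by gcongr; exact hχ.trans b4
          _ = B^(p-1) * (r*B)^(2-p) := by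
            rw [Real.mul_rpow hrp.le hB0.le]; nth_rewrite 1 [b1]; ring
          _ ≤ B^(p-1) * 4 := by gcongr
          _ = _ := by ring
    calc β*B*(r/η) = β*(B*(r/η)) := by ring
      _ ≤ β*(4*T) := mul_le_mul_of_nonneg_left (this.trans (by linarith only [hBT])) hβ0.le
      _ = _ := by ring
  have t3 : 4*CS*16^p*(B^(p-1)*r^(-σ+θ'*(1-σ))) ≤ 4*CS*16^p*T := by
    rw [hT]; gcongr 4*CS*16^p*(B^(p-1)*?_)
    exact hmono _ _ (by linarith)
  have t4 : 2*p*((2*β*(r/η))^q * (3*B)^(p-1))*Lam*C1*(r^(1+θ'))^(-σ) ≤ 2*p*((2*β)^q*3^(p-1))*Lam*C1*T := by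
    have b1 : (2*β*(r/η))^q ≤ (2*β)^q * r^((1-α)*q) := by
      rw [Real.mul_rpow (by positivity) hχ0.le, Real.rpow_mul hrp.le]
      gcongr
    have b2 : (r^(1+θ'))^(-σ) = r^(-(1+θ')*σ) := by rw [← Real.rpow_mul hrp.le]; congr 1; ring
    have b3 : r^((1-α)*q) * r^(-(1+θ')*σ) ≤ r^(-σ+ω) := by
      rw [← Real.rpow_add hrp]
      apply hmono
      have e1 : α*q ≤ q/4*1 := mul_le_mul hαq' hq1 hq0.le (by positivity)
      have e2 : θ'*σ ≤ θ'*1 := mul_le_mul_of_nonneg_left hσ1.le hθ'.le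
      have e3 : (1-α)*q + -(1+θ')*σ = q - α*q - σ - θ'*σ := by ring
      rw [e3]
      linarith only [hω3, e1, e2, hθ'q]
    rw [b2, Real.mul_rpow (by norm_num) hB0.le]
    calc 2*p*((2*β*(r/η))^q * (3^(p-1)*B^(p-1)))*Lam*C1*r^(-(1+θ')*σ)
        ≤ 2*p*(((2*β)^q * r^((1-α)*q)) * (3^(p-1)*B^(p-1)))*Lam*C1*r^(-(1+θ')*σ) := by gcongr
      _ = 2*p*((2*β)^q*3^(p-1))*Lam*C1*(B^(p-1)*(r^((1-α)*q)*r^(-(1+θ')*σ))) := by ring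
      _ ≤ 2*p*((2*β)^q*3^(p-1))*Lam*C1*(B^(p-1)*r^(-σ+ω)) := by gcongr
  have t5 : 2*2^(p-1)*Lam*C2*(η/(4*β))^(-(s*p)) ≤ 2*2^(p-1)*Lam*C2*(4*β)^(s*p)*T := by
    have b1 : (η/(4*β))^(-(s*p)) = (4*β)^(s*p) * g^(α*(s*p)) := by
      rw [Real.rpow_neg (by positivity), ← Real.inv_rpow (by positivity), inv_div, div_eq_mul_inv, hηg,
        Real.mul_rpow (by positivity) (by positivity), ← Real.rpow_mul hg0.le]
    have b2 : g^(α*(s*p)) ≤ T := by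
      refine le_trans ?_ hBT
      calc g^(α*(s*p)) ≤ g^(p-1) := Real.rpow_le_rpow_of_exponent_le hg1 hαs
        _ ≤ B^(p-1) := Real.rpow_le_rpow hg0.le (le_mul_of_one_le_left hg0.le (by linarith only [hL64])) hp1.le
    rw [b1]
    calc 2*2^(p-1)*Lam*C2*((4*β)^(s*p)*g^(α*(s*p))) ≤ 2*2^(p-1)*Lam*C2*((4*β)^(s*p)*T) := by gcongr
      _ = _ := by ring
  have tot : c * (B^(p-1)*r^(-σ+ω/2)) ≤ C' * T := by
    rw [hC']; linarith only [main, t1, t2, t3, t4, t5]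
  have e1 : r^(-σ+ω) = r^(-σ+ω/2) * r^(ω/2) := by rw [← Real.rpow_add hrp]; congr 1; ring
  have hX : 0 < B^(p-1)*r^(-σ+ω/2) := by positivity
  rw [hT, e1] at tot
  have tot2 : c * (B^(p-1)*r^(-σ+ω/2)) ≤ (C' * r^(ω/2)) * (B^(p-1)*r^(-σ+ω/2)) := by
    linarith only [tot]
  have tot3 := le_of_mul_le_mul_right tot2 hX
  rw [lt_div_iff₀ hC'0] at k4
  linarith

/-- Interior Lipschitz bound for negative times. -/
lemma lip_neg (hN : 1 ≤ N) (hp : 1 < p) (hs : s ∈ Ioo (0:ℝ) 1) (hsp1 : p - 1 < s * p)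
    (hlam : 0 < lam) (hLam : 0 < Lam) :
    ∃ C : ℝ, 0 < C ∧ ∀ (K : Euc N → ℝ) (u : Euc N → ℝ → ℝ),
      Sol N p s lam Lam K u → ∀ (x y : Euc N) (t : ℝ), ‖x‖ < 1 → ‖y‖ < 1 → -1 < t → t < 0 →
        u x t - u y t ≤ C * ‖x-y‖ := by
  obtain ⟨L, θ, β, hL, hθ, hθ1, hβ, h⟩ := no_max (N := N) (lam := lam) hN hp hs hsp1 hlam hLam
  refine ⟨L * (32/5)^β, by positivity, ?_⟩
  intro K u S x y t hx hy ht ht0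
  have hη : 5/32 ≤ eta (x,t) := by
    unfold eta
    have h1 : 5/4 ≤ 9/4 - ‖x‖^2 := by nlinarith [norm_nonneg x]
    have h2 : 1/8 ≤ (t+3/2)/4 := by linarith
    calc (5/32:ℝ) = 5/4*(1/8) := by norm_num
      _ ≤ _ := mul_le_mul h1 h2 (by norm_num) (by linarith)
  have hg : gg β (x,t) ≤ (32/5)^β := by
    unfold gg
    have := Real.rpow_le_rpow_of_nonpos (by norm_num) hη (by linarith : -β ≤ 0)
    refine this.trans (le_of_eq ?_)
    rw [Real.rpow_neg (by norm_num), ← Real.inv_rpow (by norm_num)]; norm_num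
  have hg0 : 0 < gg β (x,t) := Real.rpow_pos_of_pos (by linarith) _
  have hb : u x t - u y t ≤ L * phi θ ‖x-y‖ * gg β (x,t) := by
    by_contra hcon
    push Not at hcon
    obtain ⟨κ, hκ, ε, hε, xb, yb, tb, τb, MP⟩ := exists_max hθ hθ1 hβ hL S.cont S.bdd hx hy ht ht0 hcon
    exact h K u S κ ε hκ xb yb tb τb MP
  refine hb.trans ?_
  have h1 := phi_le (θ := θ) (norm_nonneg (x-y))
  calc L * phi θ ‖x-y‖ * gg β (x,t) ≤ L * ‖x-y‖ * gg β (x,t) := by gcongr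
    _ ≤ L * ‖x-y‖ * (32/5)^β := by gcongr
    _ = _ := by ring

end Part20

section Part21

lemma sol_of {N : ℕ} {p s lam Lam : ℝ} (hN : 1 ≤ N)
    (hp : 1 < p) (hs : s ∈ Ioo (0 : ℝ) 1) (hLam : 0 < Lam)
    {K : Euc N → ℝ} {u : Euc N → ℝ → ℝ}
    (hK : IsKernel N p s lam Lam K)
    (hu : Continuous fun q : Euc N × ℝ => u q.1 q.2)
    (hsol : IsLocalWeakSolution N p s K (ball 0 2) (Ioc (-2) 0) u)
    (h1 : (⨆ x ∈ ball (0 : Euc N) 2, ⨆ t ∈ Ioc (-2 : ℝ) 0, ENNReal.ofReal |u x t|)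
          + tailSup N p s u 0 2 (Ioc (-2) 0) ≤ 1) : Sol N p s lam Lam K u := by
  have hp1 : 0 < p - 1 := by linarith
  have hspp : 0 < s * p := mul_pos hs.1 (by linarith)
  obtain ⟨hreg, hweak⟩ := hsol
  rw [interior_Ioc] at hreg hweak
  have hsup := le_self_add.trans h1
  have htail := le_add_self.trans h1
  have hfin : ∀ᵐ t : ℝ, t ∈ Ioo (-2 : ℝ) 0 →
      ∫⁻ x, ENNReal.ofReal (|u x t| ^ (p - 1) / (1 + ‖x‖ ^ ((N : ℝ) + s * p))) < ⊤ := by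
    have hn : ∀ n : ℕ, ∀ᵐ t : ℝ, t ∈ Icc (-2 + 1/((n:ℝ)+1)) (-(1/((n:ℝ)+1))) →
        ∫⁻ x, ENNReal.ofReal (|u x t| ^ (p - 1) / (1 + ‖x‖ ^ ((N : ℝ) + s * p))) < ⊤ := by
      intro n
      have hpos : 0 < 1/((n:ℝ)+1) := by positivity
      have := (hreg (Icc (-2 + 1/((n:ℝ)+1)) (-(1/((n:ℝ)+1)))) isCompact_Icc
        (fun t ht => ⟨by linarith [ht.1], by linarith [ht.2]⟩) ∅ isOpen_empty
        (by simp) (by simp)).2.2.1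
      rw [← ae_restrict_iff' measurableSet_Icc]
      filter_upwards [ENNReal.ae_le_essSup (μ := volume.restrict (Icc (-2 + 1/((n:ℝ)+1)) (-(1/((n:ℝ)+1)))))
        (fun t => ∫⁻ x, ENNReal.ofReal (|u x t| ^ (p - 1) / (1 + ‖x‖ ^ ((N : ℝ) + s * p))))] with t ht
      exact ht.trans_lt this
    filter_upwards [ae_all_iff.2 hn] with t ht htI
    obtain ⟨n, hn⟩ := exists_nat_one_div_lt (show 0 < min (t+2) (-t) from
      lt_min (by linarith [htI.1]) (by linarith [htI.2]))
    have a := hn.trans_le (min_le_left _ _)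
    have b := hn.trans_le (min_le_right _ _)
    exact ht n ⟨by linarith, by linarith⟩
  refine ⟨hN, hp, hs, hLam, hK, hu, ?_, ?_, ?_, hweak⟩
  · intro a b ha hb
    exact (hreg (Icc a b) isCompact_Icc (fun t ht => ⟨ha.trans_le ht.1, ht.2.trans_lt hb⟩)
      (ball 0 (15/8)) isOpen_ball
      (by rw [closure_ball _ (by norm_num)]; exact isCompact_closedBall _ _)
      (by rw [closure_ball _ (by norm_num)]; exact closedBall_subset_ball (by norm_num))).1
  · have ht2 : ∀ᵐ t : ℝ, t ∈ Ioc (-2:ℝ) 0 → tailFn N p s (fun x => u x t) 0 2 ≤ 1 := by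
      rw [← ae_restrict_iff' measurableSet_Ioc]
      filter_upwards [ENNReal.ae_le_essSup (μ := volume.restrict (Ioc (-2:ℝ) 0))
        (fun t => ENNReal.ofReal (tailFn N p s (fun x => u x t) 0 2))] with t ht
      have := ht.trans htail
      rwa [← ENNReal.ofReal_one, ENNReal.ofReal_le_ofReal_iff zero_le_one] at this
    filter_upwards [hfin, ht2] with t hf ht htI
    have hf := hf htI
    have ht := ht ⟨htI.1, htI.2.le⟩
    have hut : Continuous fun x => u x t := hu.comp (by fun_prop : Continuous fun x : Euc N => (x, t))
    have hms : MeasurableSet ((ball (0 : Euc N) 2)ᶜ) := measurableSet_ball.compl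
    have hmeas : Measurable fun x : Euc N => |u x t|^(p-1) * ‖x‖^(-((N:ℝ)+s*p)) := by
      have := hut.measurable
      fun_prop
    have hcomp : ∀ x ∈ (ball (0 : Euc N) 2)ᶜ, |u x t|^(p-1) * ‖x‖^(-((N:ℝ)+s*p)) ≤
        2 * (|u x t| ^ (p - 1) / (1 + ‖x‖ ^ ((N : ℝ) + s * p))) := by
      intro x hx
      have hx2 : 2 ≤ ‖x‖ := by simpa using hx
      have hX : 1 ≤ ‖x‖^((N:ℝ)+s*p) := Real.one_le_rpow (by linarith) (by positivity)
      rw [Real.rpow_neg (by positivity), mul_div_assoc', mul_comm (2:ℝ), mul_div_assoc]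
      gcongr
      rw [← one_div, div_le_div_iff₀ (by linarith) (by linarith)]
      linarith
    have hlt : ∫⁻ x in (ball (0 : Euc N) 2)ᶜ, ENNReal.ofReal (|u x t|^(p-1) * ‖x‖^(-((N:ℝ)+s*p))) < ⊤ := by
      calc _ ≤ ∫⁻ x in (ball (0 : Euc N) 2)ᶜ, ENNReal.ofReal 2 *
            ENNReal.ofReal (|u x t| ^ (p - 1) / (1 + ‖x‖ ^ ((N : ℝ) + s * p))) := by
            refine setLIntegral_mono' hms fun x hx => ?_
            rw [← ENNReal.ofReal_mul (by norm_num)]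
            exact ENNReal.ofReal_le_ofReal (hcomp x hx)
        _ ≤ ∫⁻ x, ENNReal.ofReal 2 *
            ENNReal.ofReal (|u x t| ^ (p - 1) / (1 + ‖x‖ ^ ((N : ℝ) + s * p))) := setLIntegral_le_lintegral _ _
        _ < ⊤ := by
          rw [lintegral_const_mul' _ _ ENNReal.ofReal_ne_top]
          exact ENNReal.mul_lt_top ENNReal.ofReal_lt_top hf
    have hnn : ∀ x : Euc N, 0 ≤ |u x t|^(p-1) * ‖x‖^(-((N:ℝ)+s*p)) := fun x => by positivity
    have hI0 : 0 ≤ ∫ x in (ball (0 : Euc N) 2)ᶜ, |u x t|^(p-1) * ‖x‖^(-((N:ℝ)+s*p)) :=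
      integral_nonneg hnn
    unfold tailFn at ht
    simp only [sub_zero] at ht
    have h2 : (1:ℝ) ≤ 2^(s*p) := Real.one_le_rpow (by norm_num) hspp.le
    have hI : ∫ x in (ball (0 : Euc N) 2)ᶜ, |u x t|^(p-1) * ‖x‖^(-((N:ℝ)+s*p)) ≤ 1 := by
      by_contra hcon
      push Not at hcon
      have : 1 < (2^(s*p) * ∫ x in (ball (0 : Euc N) 2)ᶜ, |u x t|^(p-1) * ‖x‖^(-((N:ℝ)+s*p)))^(1/(p-1)) :=
        Real.one_lt_rpow (one_lt_mul_of_le_of_lt h2 hcon) (by positivity)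
      linarith
    rw [integral_eq_lintegral_of_nonneg_ae (Eventually.of_forall hnn) hmeas.aestronglyMeasurable] at hI
    rwa [← ENNReal.toReal_le_toReal hlt.ne ENNReal.one_ne_top, ENNReal.toReal_one]
  · intro x hx t ht
    have h : ENNReal.ofReal |u x t| ≤ 1 := by
      refine le_trans ?_ hsup
      exact (le_iSup₂ (f := fun t (_ : t ∈ Ioc (-2:ℝ) 0) => ENNReal.ofReal |u x t|) t ht).trans
        (le_iSup₂ (f := fun x (_ : x ∈ ball (0 : Euc N) 2) => ⨆ t ∈ Ioc (-2 : ℝ) 0, ENNReal.ofReal |u x t|) x hx)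
    rwa [← ENNReal.ofReal_one, ENNReal.ofReal_le_ofReal_iff zero_le_one] at h

end Part21


/-- Lipschitz regularity at the normalised scale. -/
theorem lipschitz_normalised_scale
    (N : ℕ) (hN : 1 ≤ N) (p s lam Lam : ℝ)
    (hp : 1 < p) (hs : s ∈ Ioo (0 : ℝ) 1) (hsp : p - 1 < s * p)
    (hlam : 0 < lam) (hlamLam : lam ≤ Lam) :
    ∃ C : ℝ, 0 < C ∧
      ∀ (K : Euc N → ℝ) (u : Euc N → ℝ → ℝ),
        IsKernel N p s lam Lam K →
        (Continuous fun q : Euc N × ℝ => u q.1 q.2) →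
        IsLocalWeakSolution N p s K (ball 0 2) (Ioc (-2) 0) u →
        (⨆ x ∈ ball (0 : Euc N) 2, ⨆ t ∈ Ioc (-2 : ℝ) 0, ENNReal.ofReal |u x t|)
          + tailSup N p s u 0 2 (Ioc (-2) 0) ≤ 1 →
        ∀ t ∈ Ioc (-1 : ℝ) 0, ∀ x ∈ ball (0 : Euc N) 1, ∀ y ∈ ball (0 : Euc N) 1,
          |u x t - u y t| ≤ C * dist x y := by
  have hLam : 0 < Lam := hlam.trans_le hlamLam
  obtain ⟨C, hC, h⟩ := lip_neg (N := N) hN hp hs hsp hlam hLam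
  refine ⟨C, hC, ?_⟩
  intro K u hK hu hsol h1 t ht x hx y hy
  have S := sol_of hN hp hs hLam hK hu hsol h1
  rw [mem_ball_zero_iff] at hx hy
  have hneg : ∀ τ, -1 < τ → τ < 0 → |u x τ - u y τ| ≤ C * dist x y := by
    intro τ h1 h2
    rw [abs_le, dist_eq_norm]
    have a := h K u S x y τ hx hy h1 h2
    have b := h K u S y x τ hy hx h1 h2
    rw [norm_sub_rev] at b
    exact ⟨by linarith, a⟩
  rcases ht.2.lt_or_eq with h0 | h0
  · exact hneg t ht.1 h0
  · subst h0
    have hc : Continuous fun τ => |u x τ - u y τ| := by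
      have hx' : Continuous fun τ => u x τ := hu.comp (by fun_prop : Continuous fun τ : ℝ => (x, τ))
      have hy' : Continuous fun τ => u y τ := hu.comp (by fun_prop : Continuous fun τ : ℝ => (y, τ))
      fun_prop
    have hten : Tendsto (fun τ => |u x τ - u y τ|) (𝓝[<] 0) (𝓝 |u x 0 - u y 0|) :=
      (hc.tendsto 0).mono_left nhdsWithin_le_nhds
    refine le_of_tendsto hten ?_
    filter_upwards [Ioo_mem_nhdsLT (show (-1:ℝ) < 0 by norm_num)] with τ hτ
    exact hneg τ hτ.1 hτ.2
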